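/- Let φ ∈ C^∞(ℝ^n_y × ℝ^n_ξ) be real-valued with |det ∂_y∂_ξ φ(y,ξ)| ≥ C₀ > 0 for all (y,ξ), and with every entry h of ∂_y∂_ξ φ satisfying |∂_y^α h| ≤ C_α and |∂_ξ^β h| ≤ C_β for all |α|, |β| ≤ 2n+1. Let a ∈ C^∞(ℝ^n_x × ℝ^n_ξ) satisfy ∂_x^α ∂_ξ^β a ∈ L^∞(ℝ^n_x × ℝ^n_ξ) for all multi-indices α, β ∈ {0,1}^n, and assume a(x,ξ) = 0 whenever ξ lies outside some compact set K. Then the operator Tu(x) = ∫∫ e^{i(x·ξ + φ(y,ξ))} a(x,ξ) u(y) dy dξ, defined for Schwartz u, satisfies ‖Tu‖_{L²(ℝ^n)} ≤ C ‖u‖_{L²(ℝ^n)}, where C depends only on n, C₀, the phase constants, and sup_{α,β∈{0,1}^n} ‖∂_x^α ∂_ξ^β a‖_{L^∞}, and is independent of K. -/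

import Mathlib

open MeasureTheory Complex SchwartzMap
open scoped BigOperators ENNReal Real RealInnerProductSpace

noncomputable section

/-- The derivative of `g` along the direction `v`. -/
def dLine {W F : Type*} [NormedAddCommGroup W] [NormedSpace ℝ W]
    [NormedAddCommGroup F] [NormedSpace ℝ F] (v : W) (g : W → F) : W → F :=
  fun z => fderiv ℝ g z v

/-- The iterated partial derivative `∂^α` along the coordinate directions `dirs`,
with multiplicities given by the multi-index `α`. -/
def mderiv {n : ℕ} {W F : Type*} [NormedAddCommGroup W] [NormedSpace ℝ W]
    [NormedAddCommGroup F] [NormedSpace ℝ F]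
    (dirs : Fin n → W) (α : Fin n → ℕ) (g : W → F) : W → F :=
  ((List.ofFn fun i => (dLine (dirs i) (F := F))^[α i]).foldr (· ∘ ·) id) g

/-- The length `|α|` of a multi-index. -/
def mdeg {n : ℕ} (α : Fin n → ℕ) : ℕ := ∑ i, α i

/-- The first-factor coordinate directions in `ℝ^n × ℝ^n`. -/
def dX {n : ℕ} (i : Fin n) : EuclideanSpace ℝ (Fin n) × EuclideanSpace ℝ (Fin n) :=
  (EuclideanSpace.single i 1, 0)

/-- The second-factor coordinate directions in `ℝ^n × ℝ^n`. -/
def dY {n : ℕ} (j : Fin n) : EuclideanSpace ℝ (Fin n) × EuclideanSpace ℝ (Fin n) :=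
  (0, EuclideanSpace.single j 1)

/-- The entry `∂²φ/∂u_i∂v_j` of the mixed Hessian of a function of two `ℝ^n` variables. -/
def mixedHessXY {n : ℕ}
    (φ : EuclideanSpace ℝ (Fin n) × EuclideanSpace ℝ (Fin n) → ℝ) (i j : Fin n) :
    EuclideanSpace ℝ (Fin n) × EuclideanSpace ℝ (Fin n) → ℝ :=
  dLine (dX i) (dLine (dY j) φ)

theorem cs_step {𝒜 ι : Type*} [NormedRing 𝒜] [StarRing 𝒜] [CStarRing 𝒜]
    (s : Finset ι) (a : ι → 𝒜) (M : ℝ)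
    (h1 : ∀ i ∈ s, ∑ j ∈ s, √‖star (a i) * a j‖ ≤ M)
    (h2 : ∀ i ∈ s, ∑ j ∈ s, √‖a i * star (a j)‖ ≤ M) (hM : 0 ≤ M) (m : ℕ) :
    ∀ (c : 𝒜), ∀ j ∈ s, ‖c * a j * (star (∑ i ∈ s, a i) * ∑ i ∈ s, a i) ^ m‖
      ≤ √(‖c‖ * ‖c * a j‖) * √M * (M * M) ^ m := by
  induction m with
  | zero =>
    intro c j hj
    have hD : ‖a j‖ ≤ M := by
      have := h1 j hj
      refine le_trans ?_ (le_trans (Finset.single_le_sum (f := fun k => √‖star (a j) * a k‖)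
        (fun _ _ => Real.sqrt_nonneg _) hj) this)
      simp only [CStarRing.norm_star_mul_self]
      rw [Real.sqrt_mul_self (norm_nonneg _)]
    simp only [pow_zero, mul_one]
    rw [← Real.sqrt_mul (by positivity)]
    apply Real.le_sqrt_of_sq_le
    have := norm_mul_le c (a j)
    calc ‖c * a j‖ ^ 2 = ‖c * a j‖ * ‖c * a j‖ := by ring
      _ ≤ (‖c‖ * ‖a j‖) * ‖c * a j‖ := by gcongr
      _ ≤ (‖c‖ * M) * ‖c * a j‖ := by gcongr
      _ = _ := by ring
  | succ m ih =>
    intro c j hj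
    set b := star (∑ i ∈ s, a i) * ∑ i ∈ s, a i with hb
    have e : c * a j * b ^ (m + 1)
        = ∑ i ∈ s, ∑ k ∈ s, (c * a j * star (a i)) * a k * b ^ m := by
      rw [pow_succ', ← mul_assoc]
      have hb' : c * a j * b = c * a j * ∑ i ∈ s, ∑ k ∈ s, star (a i) * a k := by
        rw [hb, star_sum, Finset.sum_mul_sum]
      rw [hb', Finset.mul_sum, Finset.sum_mul]
      refine Finset.sum_congr rfl fun i _ => ?_
      rw [Finset.mul_sum, Finset.sum_mul]
      refine Finset.sum_congr rfl fun k _ => ?_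
      simp only [mul_assoc]
    rw [e]
    have hterm : ∀ i ∈ s, ∀ k ∈ s, ‖(c * a j * star (a i)) * a k * b ^ m‖
        ≤ (√(‖c‖ * ‖c * a j‖) * √M * (M * M) ^ m) * (√‖a j * star (a i)‖ * √‖star (a i) * a k‖) := by
      intro i hi k hk
      refine (ih (c * a j * star (a i)) k hk).trans ?_
      have : √(‖c * a j * star (a i)‖ * ‖c * a j * star (a i) * a k‖)
          ≤ √(‖c‖ * ‖c * a j‖) * (√‖a j * star (a i)‖ * √‖star (a i) * a k‖) := by
        rw [← Real.sqrt_mul (by positivity), ← Real.sqrt_mul (by positivity)]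
        apply Real.sqrt_le_sqrt
        have e1 : ‖c * a j * star (a i)‖ ≤ ‖c‖ * ‖a j * star (a i)‖ := by
          rw [mul_assoc]; exact norm_mul_le _ _
        have e2 : ‖c * a j * star (a i) * a k‖ ≤ ‖c * a j‖ * ‖star (a i) * a k‖ := by
          rw [mul_assoc (c * a j)]; exact norm_mul_le _ _
        calc _ ≤ (‖c‖ * ‖a j * star (a i)‖) * (‖c * a j‖ * ‖star (a i) * a k‖) := by gcongr
          _ = _ := by ring
      calc _ ≤ (√(‖c‖ * ‖c * a j‖) * (√‖a j * star (a i)‖ * √‖star (a i) * a k‖)) * √M * (M * M) ^ m := by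
            gcongr
        _ = _ := by ring
    calc _ ≤ ∑ i ∈ s, ∑ k ∈ s, ‖(c * a j * star (a i)) * a k * b ^ m‖ :=
          (norm_sum_le _ _).trans (Finset.sum_le_sum fun i _ => norm_sum_le _ _)
      _ ≤ ∑ i ∈ s, ∑ k ∈ s, (√(‖c‖ * ‖c * a j‖) * √M * (M * M) ^ m) * (√‖a j * star (a i)‖ * √‖star (a i) * a k‖) :=
          Finset.sum_le_sum fun i hi => Finset.sum_le_sum fun k hk => hterm i hi k hk
      _ = (√(‖c‖ * ‖c * a j‖) * √M * (M * M) ^ m) * ∑ i ∈ s, (√‖a j * star (a i)‖ * ∑ k ∈ s, √‖star (a i) * a k‖) := by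
          simp only [Finset.mul_sum]
      _ ≤ (√(‖c‖ * ‖c * a j‖) * √M * (M * M) ^ m) * ∑ i ∈ s, (√‖a j * star (a i)‖ * M) := by
          gcongr with i hi
          exact h1 i hi
      _ = (√(‖c‖ * ‖c * a j‖) * √M * (M * M) ^ m) * ((∑ i ∈ s, √‖a j * star (a i)‖) * M) := by
          rw [Finset.sum_mul]
      _ ≤ (√(‖c‖ * ‖c * a j‖) * √M * (M * M) ^ m) * (M * M) := by
          gcongr
          exact h2 j hj
      _ = _ := by ring

theorem le_of_pow_le_const {x y K : ℝ} (hy : 0 ≤ y)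
    (h : ∀ k : ℕ, x ^ (2 ^ k) ≤ K * y ^ (2 ^ k)) : x ≤ y := by
  by_contra hlt
  push Not at hlt
  rcases hy.eq_or_lt with rfl | hy
  · have := h 0
    simp at this
    linarith
  have h1 : 1 < x / y := (one_lt_div hy).2 hlt
  obtain ⟨N, hN⟩ := pow_unbounded_of_one_lt K h1
  have h2 := h N
  have h3 : (x / y) ^ N ≤ (x / y) ^ (2 ^ N) := pow_le_pow_right₀ h1.le N.lt_two_pow_self.le
  have h4 : (x / y) ^ (2 ^ N) ≤ K := by
    rw [div_pow, div_le_iff₀ (by positivity)]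
    exact h2
  linarith

/-- The Cotlar–Stein lemma. -/
theorem cotlar_stein {𝒜 ι : Type*} [NormedRing 𝒜] [StarRing 𝒜] [CStarRing 𝒜]
    (s : Finset ι) (a : ι → 𝒜) (M : ℝ)
    (h1 : ∀ i ∈ s, ∑ j ∈ s, √‖star (a i) * a j‖ ≤ M)
    (h2 : ∀ i ∈ s, ∑ j ∈ s, √‖a i * star (a j)‖ ≤ M) (hM : 0 ≤ M) :
    ‖∑ i ∈ s, a i‖ ≤ M := by
  set T := ∑ i ∈ s, a i with hT
  have key := cs_step s a M h1 h2 hM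
  set D : ℝ := ∑ j ∈ s, √(‖(1:𝒜)‖ * ‖a j‖) * √M with hD
  have hb : ∀ m : ℕ, ‖T * (star T * T) ^ m‖ ≤ D * (M * M) ^ m := by
    intro m
    have : T * (star T * T) ^ m = ∑ j ∈ s, 1 * a j * (star T * T) ^ m := by
      simp only [one_mul]
      rw [← Finset.sum_mul]
    rw [this, hD, Finset.sum_mul]
    refine (norm_sum_le _ _).trans (Finset.sum_le_sum fun j hj => ?_)
    simpa only [one_mul] using key m 1 j hj
  have hpow : ∀ k : ℕ, ‖(star T * T) ^ (2 ^ k)‖ = ‖star T * T‖ ^ (2 ^ k) := by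
    intro k
    exact (IsSelfAdjoint.star_mul_self T).norm_pow_two_pow k
  have hfin : ‖star T * T‖ ≤ M * M := by
    rcases hM.eq_or_lt with h0 | hMpos
    · have := hb 0
      have hD0 : D = 0 := by rw [hD, ← h0]; simp
      rw [hD0] at this
      have hT0 : T = 0 := by simpa using this
      rw [hT0]; simp [← h0]
    apply le_of_pow_le_const (K := ‖T‖ * D / (M * M)) (by positivity)
    intro k
    rw [← hpow k]
    obtain ⟨m, hm⟩ : ∃ m, 2 ^ k = m + 1 := ⟨2 ^ k - 1, by have := Nat.one_le_two_pow (n := k); omega⟩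
    rw [hm, pow_succ', mul_assoc]
    have := hb m
    calc ‖star T * (T * (star T * T) ^ m)‖ ≤ ‖star T‖ * ‖T * (star T * T) ^ m‖ := norm_mul_le _ _
      _ ≤ ‖T‖ * (D * (M * M) ^ m) := by rw [norm_star]; gcongr
      _ = ‖T‖ * D / (M * M) * (M * M) ^ (m + 1) := by field_simp; ring
  rw [CStarRing.norm_star_mul_self] at hfin
  exact abs_le_of_sq_le_sq' (by nlinarith) hM |>.2

section Hadamard
open Metric Set
variable {E : Type*} [NormedAddCommGroup E] [NormedSpace ℝ E] [CompleteSpace E]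

theorem had_local [Nontrivial E] (f : E → E) (f' : E → E ≃L[ℝ] E)
    (hf' : ∀ y, HasFDerivAt f (f' y : E →L[ℝ] E) y) (B M : ℝ) (hB : 0 < B) (hM : 0 < M)
    (hinv : ∀ y v, ‖(f' y).symm v‖ ≤ B * ‖v‖)
    (hLip : ∀ y z, ‖(f' y : E →L[ℝ] E) - (f' z : E →L[ℝ] E)‖ ≤ M * ‖y - z‖) :
    ∃ r : ℝ, 0 < r ∧ ∀ y, ∃ e : OpenPartialHomeomorph E E, (e : E → E) = f ∧ y ∈ e.source ∧
      closedBall (f y) r ⊆ e.target := by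
  have hc0 : (0:ℝ) ≤ 1 / (2 * B) := by positivity
  set c : NNReal := ⟨1 / (2 * B), hc0⟩ with hc
  set ε : ℝ := 1 / (4 * B * M) with hε
  have hε0 : 0 < ε := by positivity
  refine ⟨1 / (2 * B) * ε, by positivity, fun y => ?_⟩
  have hN : ‖((f' y).symm : E →L[ℝ] E)‖ ≤ B :=
    ContinuousLinearMap.opNorm_le_bound _ hB.le (hinv y)
  have hNpos : 0 < ‖((f' y).symm : E →L[ℝ] E)‖ := (f' y).norm_symm_pos
  have hNi : 1 / B ≤ ‖((f' y).symm : E →L[ℝ] E)‖⁻¹ := by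
    rw [one_div]; exact inv_anti₀ hNpos hN
  have hap : ApproximatesLinearOn f (f' y : E →L[ℝ] E) (ball y (2 * ε)) c := by
    intro x hx z hz
    have := (convex_ball y (2 * ε)).norm_image_sub_le_of_norm_hasFDerivWithin_le'
      (f := f) (f' := fun w => (f' w : E →L[ℝ] E)) (φ := (f' y : E →L[ℝ] E)) (C := M * (2 * ε))
      (fun w _ => (hf' w).hasFDerivWithinAt)
      (fun w hw => (hLip w y).trans (by
        have : ‖w - y‖ < 2 * ε := by simpa [dist_eq_norm] using hw
        gcongr)) hz hx
    refine this.trans (le_of_eq ?_)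
    change _ = (1 / (2 * B)) * ‖x - z‖
    rw [hε]
    field_simp
    norm_num
  have hcN : c < ‖((f' y).symm : E →L[ℝ] E)‖₊⁻¹ := by
    rw [← NNReal.coe_lt_coe]
    push_cast
    change 1 / (2 * B) < _
    refine lt_of_lt_of_le ?_ hNi
    apply one_div_lt_one_div_of_lt <;> linarith
  refine ⟨hap.toOpenPartialHomeomorph f _ (Or.inr hcN) isOpen_ball, rfl, ?_, ?_⟩
  · simp [hε0]
  · refine Subset.trans ?_ (hap.closedBall_subset_target (Or.inr hcN) isOpen_ball (b := y)
      (ε := ε) hε0.le ?_)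
    · apply closedBall_subset_closedBall
      gcongr
      have : 1 / B = 1 / (2 * B) + 1 / (2 * B) := by field_simp; norm_num
      change _ ≤ ‖((f' y).symm : E →L[ℝ] E)‖⁻¹ - 1 / (2 * B)
      linarith
    · apply closedBall_subset_ball; linarith

theorem had_path (f : E → E) (r : ℝ) (hr : 0 < r)
    (hloc : ∀ y, ∃ e : OpenPartialHomeomorph E E, (e : E → E) = f ∧ y ∈ e.source ∧
      closedBall (f y) r ⊆ e.target) (y v : E) :
    ∃ z : ℝ → E, Continuous z ∧ z 0 = y ∧ ∀ t ∈ Icc (0:ℝ) 1, f (z t) = f y + t • v := by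
  obtain ⟨N, hN⟩ := exists_nat_gt (‖v‖ / r)
  have hNpos : (0:ℝ) < N := lt_of_le_of_lt (by positivity) hN
  have hvN : ‖v‖ / N ≤ r := by
    rw [div_lt_iff₀ hr] at hN
    rw [div_le_iff₀ hNpos]; linarith
  have key : ∀ m : ℕ, ∃ z : ℝ → E, Continuous z ∧ z 0 = y ∧
      ∀ t ∈ Icc (0:ℝ) (m / N), f (z t) = f y + t • v := by
    intro m
    induction m with
    | zero =>
      refine ⟨fun _ => y, continuous_const, rfl, fun t ht => ?_⟩
      have : t = 0 := le_antisymm (by simpa using ht.2) ht.1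
      simp [this]
    | succ m ih =>
      obtain ⟨z, hz, hz0, hzl⟩ := ih
      have hτ0 : (0:ℝ) ≤ m / N := by positivity
      obtain ⟨e, he, hes, het⟩ := hloc (z (m / N))
      have hfz := hzl (m / N) ⟨hτ0, le_rfl⟩
      have hττ : ((m + 1 : ℕ) : ℝ) / N = m / N + 1 / N := by push_cast; ring
      set τ : ℝ := m / N with hτ
      have hclamp : ∀ t : ℝ, f y + (max τ (min t (τ + 1 / N))) • v ∈ closedBall (f (z τ)) r := by
        intro t
        rw [mem_closedBall, dist_eq_norm, hfz]
        have : f y + (max τ (min t (τ + 1 / N))) • v - (f y + τ • v)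
            = (max τ (min t (τ + 1 / N)) - τ) • v := by rw [sub_smul]; abel
        rw [this, norm_smul, Real.norm_eq_abs, abs_of_nonneg (by linarith [le_max_left τ (min t (τ + 1 / N))])]
        have h2 : max τ (min t (τ + 1 / N)) - τ ≤ 1 / N := by
          have : max τ (min t (τ + 1 / N)) ≤ τ + 1 / N :=
            max_le (by have : (0:ℝ) < 1 / N := by positivity
                       linarith) (min_le_right _ _)
          linarith
        calc _ ≤ 1 / N * ‖v‖ := by gcongr
          _ = ‖v‖ / N := by ring
          _ ≤ r := hvN
      have hcont : Continuous fun t : ℝ => e.symm (f y + (max τ (min t (τ + 1 / N))) • v) := by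
        refine e.continuousOn_symm.comp_continuous (by fun_prop) fun t => het (hclamp t)
      refine ⟨fun t => if t ≤ τ then z t else e.symm (f y + (max τ (min t (τ + 1 / N))) • v),
        hz.if_le hcont continuous_id continuous_const ?_, ?_, ?_⟩
      · intro t ht
        have ht' : t = τ := ht
        rw [ht']
        have h1 : max τ (min τ (τ + 1 / N)) = τ := by
          have : (0:ℝ) < 1 / N := by positivity
          rw [min_eq_left (by linarith), max_self]
        rw [h1, ← hfz, ← he, e.left_inv hes]
      · simp [hτ0, hz0]
      · intro t ht
        rw [hττ] at ht
        by_cases h : t ≤ τ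
        · simp only [h, if_true]; exact hzl t ⟨ht.1, h⟩
        · simp only [h, if_false]
          have h3 := e.right_inv (het (hclamp t))
          rw [he] at h3
          rw [h3, min_eq_left ht.2, max_eq_right (not_le.1 h).le]
  obtain ⟨z, h1, h2, h3⟩ := key N
  refine ⟨z, h1, h2, fun t ht => h3 t ?_⟩
  rwa [div_self hNpos.ne']

theorem had_section (f : E → E) (r : ℝ) (hr : 0 < r)
    (hloc : ∀ y, ∃ e : OpenPartialHomeomorph E E, (e : E → E) = f ∧ y ∈ e.source ∧
      closedBall (f y) r ⊆ e.target) :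
    ∃ g : E → E, Continuous g ∧ (∀ p, f (g p) = p) ∧ ∀ y, g (f y) = y := by
  have hlh : IsLocalHomeomorph f := fun y => by
    obtain ⟨e, he, hes, -⟩ := hloc y
    exact ⟨e, hes, he.symm⟩
  choose z hz hz0 hzl using had_path f r hr hloc (0 : E)
  let F : C(unitInterval × E, E) := ⟨fun q => f 0 + (q.1 : ℝ) • q.2, by fun_prop⟩
  let G : unitInterval × E → E := fun q => z q.2 q.1
  have hG : Continuous G := by
    refine hlh.continuous_lift (T2Space.isSeparatedMap f) F ?_ ?_ ?_
    · funext q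
      exact hzl q.2 q.1 q.1.2
    · simp only [G]
      simp [hz0, continuous_const]
    · intro a
      exact (hz a).comp continuous_subtype_val
  let g : E → E := fun p => G (1, p - f 0)
  have hg : Continuous g := hG.comp (by fun_prop)
  have hfg : ∀ p, f (g p) = p := by
    intro p
    have := hzl (p - f 0) 1 (by simp)
    simp only [g, G]
    simpa using this
  refine ⟨g, hg, hfg, ?_⟩
  have hcl : IsClosed {y | g (f y) = y} := isClosed_eq (hg.comp hlh.continuous) continuous_id
  have hop : IsOpen {y | g (f y) = y} := by
    rw [isOpen_iff_mem_nhds]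
    intro y hy
    obtain ⟨e, he, hes, -⟩ := hloc y
    have h1 : ∀ᶠ w in nhds y, w ∈ e.source := e.open_source.mem_nhds hes
    have h2 : ∀ᶠ w in nhds y, g (f w) ∈ e.source := by
      have : Filter.Tendsto (fun w => g (f w)) (nhds y) (nhds y) := by
        have h := (hg.comp hlh.continuous).tendsto y
        simp only [Function.comp] at h
        rwa [show g (f y) = y from hy] at h
      exact this (e.open_source.mem_nhds hes)
    filter_upwards [h1, h2] with w hw1 hw2
    apply e.injOn hw2 hw1
    rw [he, hfg]
  have hne : {y | g (f y) = y}.Nonempty := ⟨g 0, by simp [hfg]⟩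
  have := IsClopen.eq_univ ⟨hcl, hop⟩ hne
  intro y
  have : y ∈ {y | g (f y) = y} := by rw [this]; trivial
  exact this

/-- Hadamard's global inverse function theorem, quantitative form. -/
theorem hadamard (f : E → E) (f' : E → E ≃L[ℝ] E)
    (hf' : ∀ y, HasFDerivAt f (f' y : E →L[ℝ] E) y) (B M : ℝ) (hB : 0 < B) (hM : 0 < M)
    (hinv : ∀ y v, ‖(f' y).symm v‖ ≤ B * ‖v‖)
    (hLip : ∀ y z, ‖(f' y : E →L[ℝ] E) - (f' z : E →L[ℝ] E)‖ ≤ M * ‖y - z‖) (y z : E) :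
    ‖y - z‖ ≤ B * ‖f y - f z‖ := by
  rcases subsingleton_or_nontrivial E with h | h
  · simp [Subsingleton.elim y z]
  obtain ⟨r, hr, hloc⟩ := had_local f f' hf' B M hB hM hinv hLip
  obtain ⟨g, hg, hfg, hgf⟩ := had_section f r hr hloc
  have hgd : ∀ p, HasFDerivAt g ((f' (g p)).symm : E →L[ℝ] E) p := by
    intro p
    exact HasFDerivAt.of_local_left_inverse hg.continuousAt (hf' (g p))
      (Filter.Eventually.of_forall hfg)
  have := convex_univ.norm_image_sub_le_of_norm_hasFDerivWithin_le (f := g)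
    (fun p _ => (hgd p).hasFDerivWithinAt)
    (fun p _ => ContinuousLinearMap.opNorm_le_bound _ hB.le (hinv (g p)))
    (mem_univ (f z)) (mem_univ (f y))
  rwa [hgf, hgf] at this
end Hadamard

section Calc
variable {W F : Type*} [NormedAddCommGroup W] [NormedSpace ℝ W]
    [NormedAddCommGroup F] [NormedSpace ℝ F]

theorem dLine_smooth {v : W} {g : W → F} (hg : ContDiff ℝ (⊤ : ℕ∞) g) :
    ContDiff ℝ (⊤ : ℕ∞) (dLine v g) := by
  unfold dLine
  exact (hg.fderiv_right (m := (⊤ : ℕ∞)) (by simp)).clm_apply contDiff_const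

theorem smooth_diff {g : W → F} (hg : ContDiff ℝ (⊤ : ℕ∞) g) : Differentiable ℝ g :=
  hg.differentiable (by simp)

theorem dLine_comm {v w : W} {g : W → F} (hg : ContDiff ℝ (⊤ : ℕ∞) g) :
    dLine v (dLine w g) = dLine w (dLine v g) := by
  funext z
  have hd : Differentiable ℝ (fderiv ℝ g) :=
    (hg.fderiv_right (m := (⊤ : ℕ∞)) (by simp)).differentiable (by simp)
  have key : ∀ a b : W, dLine a (dLine b g) z = fderiv ℝ (fderiv ℝ g) z a b := by
    intro a b
    unfold dLine
    rw [fderiv_clm_apply (hd z) (differentiableAt_const b)]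
    simp
  rw [key, key]
  have hs : IsSymmSndFDerivAt ℝ g z := by
    apply hg.contDiffAt.isSymmSndFDerivAt
    rw [minSmoothness_of_isRCLikeNormedField]
    exact WithTop.coe_le_coe.2 (le_top : (2 : ℕ∞) ≤ ⊤)
  exact hs v w

/-- iterate of `dLine` is smooth -/
theorem dLine_iter_smooth {v : W} {g : W → F} (hg : ContDiff ℝ (⊤ : ℕ∞) g) (k : ℕ) :
    ContDiff ℝ (⊤ : ℕ∞) ((dLine v)^[k] g) := by
  induction k with
  | zero => exact hg
  | succ k ih => rw [Function.iterate_succ_apply']; exact dLine_smooth ih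

theorem dLine_iter_comm {v w : W} {g : W → F} (hg : ContDiff ℝ (⊤ : ℕ∞) g) (k : ℕ) :
    (dLine v)^[k] (dLine w g) = dLine w ((dLine v)^[k] g) := by
  induction k with
  | zero => rfl
  | succ k ih =>
    rw [Function.iterate_succ_apply', Function.iterate_succ_apply', ih,
      dLine_comm (dLine_iter_smooth hg k)]

/-- list version of `mderiv` -/
def lderiv {n : ℕ} (dirs : Fin n → W) (α : Fin n → ℕ) : List (Fin n) → (W → F) → (W → F)
  | [], g => g
  | i :: L, g => (dLine (dirs i))^[α i] (lderiv dirs α L g)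

theorem mderiv_eq_lderiv {n : ℕ} (dirs : Fin n → W) (α : Fin n → ℕ) (g : W → F) :
    mderiv dirs α g = lderiv dirs α (List.finRange n) g := by
  unfold mderiv
  rw [List.ofFn_eq_map]
  generalize List.finRange n = L
  induction L with
  | nil => rfl
  | cons i L ih => simp only [List.map_cons, List.foldr_cons, Function.comp, lderiv]; rw [← ih]

theorem lderiv_smooth {n : ℕ} (dirs : Fin n → W) (α : Fin n → ℕ) {g : W → F}
    (hg : ContDiff ℝ (⊤ : ℕ∞) g) (L : List (Fin n)) :
    ContDiff ℝ (⊤ : ℕ∞) (lderiv dirs α L g) := by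
  induction L with
  | nil => exact hg
  | cons i L ih => exact dLine_iter_smooth ih _

theorem lderiv_comm {n : ℕ} (dirs : Fin n → W) (α : Fin n → ℕ) {g : W → F} (w : W)
    (hg : ContDiff ℝ (⊤ : ℕ∞) g) (L : List (Fin n)) :
    lderiv dirs α L (dLine w g) = dLine w (lderiv dirs α L g) := by
  induction L with
  | nil => rfl
  | cons i L ih =>
    simp only [lderiv]
    rw [ih, dLine_iter_comm (lderiv_smooth dirs α hg L)]

theorem lderiv_congr {n : ℕ} (dirs : Fin n → W) (α β : Fin n → ℕ) (g : W → F) (L : List (Fin n))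
    (h : ∀ i ∈ L, α i = β i) : lderiv dirs α L g = lderiv dirs β L g := by
  induction L with
  | nil => rfl
  | cons i L ih =>
    simp only [lderiv]
    rw [ih (fun j hj => h j (List.mem_cons_of_mem _ hj)), h i List.mem_cons_self]

theorem lderiv_dLine {n : ℕ} (dirs : Fin n → W) (α : Fin n → ℕ) {g : W → F} (l : Fin n)
    (hg : ContDiff ℝ (⊤ : ℕ∞) g) (L : List (Fin n)) (hL : L.Nodup) (hl : l ∈ L) :
    lderiv dirs α L (dLine (dirs l) g) = lderiv dirs (α + Pi.single l 1) L g := by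
  induction L with
  | nil => simp at hl
  | cons i L ih =>
    rw [List.nodup_cons] at hL
    simp only [lderiv]
    by_cases hil : i = l
    · subst hil
      rw [lderiv_comm _ _ _ hg, ← Function.iterate_succ_apply]
      have h1 : (α + Pi.single i 1 : Fin n → ℕ) i = (α i).succ := by simp
      rw [h1]
      congr 1
      apply lderiv_congr
      intro j hj
      have : j ≠ i := fun h => hL.1 (h ▸ hj)
      simp [this]
    · have hlL : l ∈ L := by
        rcases List.mem_cons.1 hl with h | h
        · exact absurd h.symm hil
        · exact h
      rw [ih hL.2 hlL]
      have h1 : (α + Pi.single l 1 : Fin n → ℕ) i = α i := by simp [hil]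
      rw [h1]

theorem mderiv_dLine {n : ℕ} (dirs : Fin n → W) (α : Fin n → ℕ) {g : W → F} (l : Fin n)
    (hg : ContDiff ℝ (⊤ : ℕ∞) g) :
    mderiv dirs α (dLine (dirs l) g) = mderiv dirs (α + Pi.single l 1) g := by
  rw [mderiv_eq_lderiv, mderiv_eq_lderiv]
  exact lderiv_dLine dirs α l hg _ (List.nodup_finRange n) (List.mem_finRange l)

theorem mderiv_zero {n : ℕ} (dirs : Fin n → W) (g : W → F) : mderiv dirs 0 g = g := by
  rw [mderiv_eq_lderiv]
  generalize List.finRange n = L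
  induction L with
  | nil => rfl
  | cons i L ih => simpa [lderiv] using ih

theorem dLine_comp_clm {W' : Type*} [NormedAddCommGroup W'] [NormedSpace ℝ W']
    (T : W' →L[ℝ] W) (v : W') {g : W → F} (hg : Differentiable ℝ g) :
    dLine v (fun z => g (T z)) = fun z => dLine (T v) g (T z) := by
  funext z
  unfold dLine
  have : HasFDerivAt (fun z => g (T z)) ((fderiv ℝ g (T z)).comp T) z :=
    (hg (T z)).hasFDerivAt.comp z T.hasFDerivAt
  rw [this.fderiv]; rfl

theorem lderiv_comp_clm {n : ℕ} {W' : Type*} [NormedAddCommGroup W'] [NormedSpace ℝ W']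
    (T : W' →L[ℝ] W) (dirs : Fin n → W') (α : Fin n → ℕ) {g : W → F}
    (hg : ContDiff ℝ (⊤ : ℕ∞) g) (L : List (Fin n)) :
    lderiv dirs α L (fun z => g (T z)) = fun z => lderiv (fun i => T (dirs i)) α L g (T z) := by
  induction L with
  | nil => rfl
  | cons i L ih =>
    simp only [lderiv]
    rw [ih]
    generalize α i = k
    induction k with
    | zero => rfl
    | succ k ihk =>
      rw [Function.iterate_succ_apply', ihk, Function.iterate_succ_apply']
      rw [dLine_comp_clm T _ (smooth_diff (dLine_iter_smooth (lderiv_smooth _ α hg L) k))]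

theorem mderiv_comp_clm {n : ℕ} {W' : Type*} [NormedAddCommGroup W'] [NormedSpace ℝ W']
    (T : W' →L[ℝ] W) (dirs : Fin n → W') (α : Fin n → ℕ) {g : W → F}
    (hg : ContDiff ℝ (⊤ : ℕ∞) g) :
    mderiv dirs α (fun z => g (T z)) = fun z => mderiv (fun i => T (dirs i)) α g (T z) := by
  simp only [mderiv_eq_lderiv]
  exact lderiv_comp_clm T dirs α hg _

theorem dLine_mul {𝔸 : Type*} [NormedCommRing 𝔸] [NormedAlgebra ℝ 𝔸] (v : W) {f g : W → 𝔸} (hf : Differentiable ℝ f) (hg : Differentiable ℝ g) :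
    dLine v (fun z => f z * g z) = fun z => dLine v f z * g z + f z * dLine v g z := by
  funext z
  unfold dLine
  rw [((hf z).hasFDerivAt.fun_mul (hg z).hasFDerivAt).fderiv]
  simp only [_root_.add_apply, _root_.smul_apply, smul_eq_mul]
  ring

theorem dLine_add (v : W) {f g : W → F} (hf : Differentiable ℝ f) (hg : Differentiable ℝ g) :
    dLine v (fun z => f z + g z) = fun z => dLine v f z + dLine v g z := by
  funext z
  unfold dLine
  rw [((hf z).hasFDerivAt.fun_add (hg z).hasFDerivAt).fderiv]
  rfl

theorem dLine_neg (v : W) (f : W → F) :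
    dLine v (fun z => - f z) = fun z => - dLine v f z := by
  funext z
  unfold dLine
  rw [fderiv_fun_neg]; rfl

theorem dLine_inv (v : W) {f : W → ℝ} (hf : Differentiable ℝ f) (h0 : ∀ z, f z ≠ 0) :
    dLine v (fun z => (f z)⁻¹) = fun z => (- dLine v f z) * ((f z)⁻¹ * (f z)⁻¹) := by
  funext z
  unfold dLine
  have := (hasDerivAt_inv (h0 z)).comp_hasFDerivAt z (hf z).hasFDerivAt
  have h2 : fderiv ℝ (fun z => (f z)⁻¹) z = (-(f z ^ 2)⁻¹) • fderiv ℝ f z := this.fderiv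
  rw [h2]
  simp only [_root_.smul_apply, smul_eq_mul]
  field_simp

/-- uniformly bounded families, together with their derivatives of order `≤ m` along `dirs` -/
def UB {ι : Type*} {n : ℕ} (dirs : Fin n → W) : ℕ → (ι → W → ℝ) → Prop
  | 0, f => (∀ i, ContDiff ℝ (⊤ : ℕ∞) (f i)) ∧ ∃ C : ℝ, ∀ i z, |f i z| ≤ C
  | m + 1, f => ((∀ i, ContDiff ℝ (⊤ : ℕ∞) (f i)) ∧ ∃ C : ℝ, ∀ i z, |f i z| ≤ C) ∧
      ∀ l, UB dirs m (fun i => dLine (dirs l) (f i))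

variable {ι : Type*} {n : ℕ} {dirs : Fin n → W}

theorem UB.smooth {m : ℕ} {f : ι → W → ℝ} (h : UB dirs m f) (i : ι) :
    ContDiff ℝ (⊤ : ℕ∞) (f i) := by
  cases m with
  | zero => exact h.1 i
  | succ m => exact h.1.1 i

theorem UB.diff {m : ℕ} {f : ι → W → ℝ} (h : UB dirs m f) (i : ι) :
    Differentiable ℝ (f i) := smooth_diff (h.smooth i)

theorem UB.bdd {m : ℕ} {f : ι → W → ℝ} (h : UB dirs m f) : ∃ C : ℝ, ∀ i z, |f i z| ≤ C := by
  cases m with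
  | zero => exact h.2
  | succ m => exact h.1.2

theorem UB.down {m : ℕ} : ∀ {f : ι → W → ℝ}, UB dirs (m + 1) f → UB dirs m f := by
  induction m with
  | zero => intro f h; exact h.1
  | succ m ih => intro f h; exact ⟨h.1, fun l => ih (h.2 l)⟩

theorem UB.le {m k : ℕ} (hk : k ≤ m) {f : ι → W → ℝ} (h : UB dirs m f) : UB dirs k f := by
  induction m with
  | zero => rw [Nat.le_zero.1 hk]; exact h
  | succ m ih =>
    rcases Nat.lt_or_ge k (m + 1) with h1 | h1
    · exact ih (Nat.lt_succ_iff.1 h1) h.down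
    · rw [le_antisymm hk h1]; exact h

theorem UB.add {m : ℕ} : ∀ {f g : ι → W → ℝ}, UB dirs m f → UB dirs m g →
    UB dirs m (fun i z => f i z + g i z) := by
  have h0 : ∀ {f g : ι → W → ℝ}, (∃ C : ℝ, ∀ i z, |f i z| ≤ C) → (∃ C : ℝ, ∀ i z, |g i z| ≤ C) →
      ∃ C : ℝ, ∀ i z, |f i z + g i z| ≤ C := by
    rintro f g ⟨C, hC⟩ ⟨D, hD⟩
    exact ⟨C + D, fun i z => (abs_add_le _ _).trans (add_le_add (hC i z) (hD i z))⟩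
  induction m with
  | zero => intro f g hf hg; exact ⟨fun i => (hf.1 i).add (hg.1 i), h0 hf.2 hg.2⟩
  | succ m ih =>
    intro f g hf hg
    refine ⟨⟨fun i => (hf.smooth i).add (hg.smooth i), h0 hf.bdd hg.bdd⟩, fun l => ?_⟩
    have : (fun i => dLine (dirs l) (fun z => f i z + g i z))
        = fun i z => dLine (dirs l) (f i) z + dLine (dirs l) (g i) z := by
      funext i; exact dLine_add _ (hf.diff i) (hg.diff i)
    rw [this]
    exact ih (hf.2 l) (hg.2 l)

theorem UB.neg {m : ℕ} : ∀ {f : ι → W → ℝ}, UB dirs m f → UB dirs m (fun i z => - f i z) := by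
  have h0 : ∀ {f : ι → W → ℝ}, (∃ C : ℝ, ∀ i z, |f i z| ≤ C) →
      ∃ C : ℝ, ∀ i z, |- f i z| ≤ C := by
    rintro f ⟨C, hC⟩
    exact ⟨C, fun i z => by rw [abs_neg]; exact hC i z⟩
  induction m with
  | zero => intro f hf; exact ⟨fun i => (hf.1 i).neg, h0 hf.2⟩
  | succ m ih =>
    intro f hf
    refine ⟨⟨fun i => (hf.smooth i).neg, h0 hf.bdd⟩, fun l => ?_⟩
    have : (fun i => dLine (dirs l) (fun z => - f i z))
        = fun i z => - dLine (dirs l) (f i) z := by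
      funext i; exact dLine_neg _ _
    rw [this]
    exact ih (hf.2 l)

theorem UB.mul {m : ℕ} : ∀ {f g : ι → W → ℝ}, UB dirs m f → UB dirs m g →
    UB dirs m (fun i z => f i z * g i z) := by
  have h0 : ∀ {f g : ι → W → ℝ}, (∃ C : ℝ, ∀ i z, |f i z| ≤ C) → (∃ C : ℝ, ∀ i z, |g i z| ≤ C) →
      ∃ C : ℝ, ∀ i z, |f i z * g i z| ≤ C := by
    rintro f g ⟨C, hC⟩ ⟨D, hD⟩
    refine ⟨C * D, fun i z => ?_⟩
    rw [abs_mul]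
    exact mul_le_mul (hC i z) (hD i z) (abs_nonneg _) ((abs_nonneg _).trans (hC i z))
  induction m with
  | zero => intro f g hf hg; exact ⟨fun i => (hf.1 i).mul (hg.1 i), h0 hf.2 hg.2⟩
  | succ m ih =>
    intro f g hf hg
    refine ⟨⟨fun i => (hf.smooth i).mul (hg.smooth i), h0 hf.bdd hg.bdd⟩, fun l => ?_⟩
    have : (fun i => dLine (dirs l) (fun z => f i z * g i z))
        = fun i z => dLine (dirs l) (f i) z * g i z + f i z * dLine (dirs l) (g i) z := by
      funext i; exact dLine_mul _ (hf.diff i) (hg.diff i)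
    rw [this]
    exact (ih (hf.2 l) hg.down).add (ih hf.down (hg.2 l))

theorem UB.const {m : ℕ} (c : ℝ) : UB dirs m (fun (_ : ι) (_ : W) => c) := by
  have h0 : (∀ _ : ι, ContDiff ℝ (⊤ : ℕ∞) (fun _ : W => c)) ∧ ∃ C : ℝ, ∀ (_ : ι) (_ : W), |c| ≤ C :=
    ⟨fun _ => contDiff_const, |c|, fun _ _ => le_rfl⟩
  induction m generalizing c with
  | zero => exact h0
  | succ m ih =>
    refine ⟨h0, fun l => ?_⟩
    have : (fun _ : ι => dLine (dirs l) (fun _ : W => c)) = fun _ _ => 0 := by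
      funext i z; simp [dLine]
    rw [this]
    exact ih 0 ⟨fun _ => contDiff_const, |(0:ℝ)|, fun _ _ => le_rfl⟩

theorem UB.sum {m : ℕ} {κ : Type*} (s : Finset κ) {f : κ → ι → W → ℝ}
    (h : ∀ k ∈ s, UB dirs m (f k)) : UB dirs m (fun i z => ∑ k ∈ s, f k i z) := by
  classical
  induction s using Finset.induction_on with
  | empty => simpa using UB.const 0
  | insert k s hk ih =>
    simp only [Finset.sum_insert hk]
    exact (h k (Finset.mem_insert_self _ _)).add
      (ih fun j hj => h j (Finset.mem_insert_of_mem hj))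

theorem UB.inv {m : ℕ} {f : ι → W → ℝ} (hf : UB dirs m f) {c : ℝ} (hc : 0 < c)
    (hlow : ∀ i z, c ≤ f i z) : UB dirs m (fun i z => (f i z)⁻¹) := by
  have hne : ∀ i z, f i z ≠ 0 := fun i z => (hc.trans_le (hlow i z)).ne'
  have h0 : (∀ i, ContDiff ℝ (⊤ : ℕ∞) (fun z => (f i z)⁻¹)) ∧
      ∃ C : ℝ, ∀ i z, |(f i z)⁻¹| ≤ C := by
    refine ⟨fun i => (hf.smooth i).inv (hne i), c⁻¹, fun i z => ?_⟩
    rw [abs_inv, abs_of_pos (hc.trans_le (hlow i z))]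
    exact inv_anti₀ hc (hlow i z)
  induction m with
  | zero => exact h0
  | succ m ih =>
    refine ⟨h0, fun l => ?_⟩
    have : (fun i => dLine (dirs l) (fun z => (f i z)⁻¹))
        = fun i z => (- dLine (dirs l) (f i) z) * ((f i z)⁻¹ * (f i z)⁻¹) := by
      funext i; exact dLine_inv _ (hf.diff i) (hne i)
    rw [this]
    have := ih hf.down
    exact (hf.2 l).neg.mul (this.mul this)

theorem UB.of_mderiv {m : ℕ} : ∀ {f : ι → W → ℝ} (Cf : (Fin n → ℕ) → ℝ),
    (∀ i, ContDiff ℝ (⊤ : ℕ∞) (f i)) →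
    (∀ α : Fin n → ℕ, mdeg α ≤ m → ∀ i z, |mderiv dirs α (f i) z| ≤ Cf α) → UB dirs m f := by
  induction m with
  | zero =>
    intro f Cf hs hb
    refine ⟨hs, Cf 0, fun i z => ?_⟩
    have := hb 0 (by simp [mdeg]) i z
    rwa [mderiv_zero] at this
  | succ m ih =>
    intro f Cf hs hb
    refine ⟨⟨hs, Cf 0, fun i z => ?_⟩, fun l => ?_⟩
    · have := hb 0 (by simp [mdeg]) i z
      rwa [mderiv_zero] at this
    · refine ih (fun α => Cf (α + Pi.single l 1)) (fun i => dLine_smooth (hs i)) fun α hα i z => ?_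
      rw [mderiv_dLine _ _ _ (hs i)]
      refine hb _ ?_ i z
      simp only [mdeg, Pi.add_apply, Finset.sum_add_distrib] at hα ⊢
      simp only [Finset.sum_pi_single', Finset.mem_univ, if_true]
      omega

theorem UB.reindex {κ : Type*} {m : ℕ} : ∀ {f : ι → W → ℝ} (_ : UB dirs m f) (g : κ → ι),
    UB dirs m (fun k => f (g k)) := by
  induction m with
  | zero => rintro f ⟨h1, C, hC⟩ g; exact ⟨fun k => h1 _, C, fun k => hC _⟩
  | succ m ih =>
    rintro f ⟨⟨h1, C, hC⟩, h2⟩ g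
    exact ⟨⟨fun k => h1 _, C, fun k => hC _⟩, fun l => ih (h2 l) g⟩
end Calc

section Phase
variable {n : ℕ}

/-- Euclidean space -/
abbrev EE (n : ℕ) := EuclideanSpace ℝ (Fin n)

/-- coordinate direction -/
def eS {n : ℕ} (i : Fin n) : EE n := EuclideanSpace.single i 1

theorem norm_le_sum_abs (v : EE n) : ‖v‖ ≤ ∑ i, |v i| := by
  have h : v = ∑ i, v i • eS i := by
    ext j
    simp [eS, Pi.single_apply]
  calc ‖v‖ = ‖∑ i, v i • eS i‖ := by rw [← h]
    _ ≤ ∑ i, ‖v i • eS i‖ := norm_sum_le _ _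
    _ = ∑ i, |v i| := by
      refine Finset.sum_congr rfl fun i _ => ?_
      rw [norm_smul]; simp [eS]

theorem abs_coord_le (v : EE n) (i : Fin n) : |v i| ≤ ‖v‖ := by
  have := PiLp.norm_apply_le (p := 2) v i
  simpa using this

theorem vec_eq_sum (v : EE n) : v = ∑ i, v i • eS i := by
  ext j
  simp [eS, Pi.single_apply]

theorem fderiv_fst_eq {g : EE n × EE n → ℝ} (v : EE n) (z : EE n × EE n) :
    fderiv ℝ g z (v, 0) = ∑ i, v i * dLine (dX i) g z := by
  have h : (v, (0 : EE n)) = ∑ i, v i • dX i := by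
    have h2 : (v, (0 : EE n)) = (ContinuousLinearMap.inl ℝ (EE n) (EE n)) v := rfl
    rw [h2]
    conv_lhs => rw [vec_eq_sum v]
    rw [map_sum]
    refine Finset.sum_congr rfl fun i _ => ?_
    rw [map_smul]; rfl
  rw [h, map_sum]
  refine Finset.sum_congr rfl fun i _ => ?_
  rw [map_smul]; rfl

theorem hasFDerivAt_slice_fst {F : Type*} [NormedAddCommGroup F] [NormedSpace ℝ F]
    {g : EE n × EE n → F} (hg : Differentiable ℝ g) (y ξ : EE n) :
    HasFDerivAt (fun y => g (y, ξ))
      ((fderiv ℝ g (y, ξ)).comp (ContinuousLinearMap.inl ℝ (EE n) (EE n))) y :=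
  (hg (y, ξ)).hasFDerivAt.comp y (hasFDerivAt_prodMk_left y ξ)

theorem hasFDerivAt_slice_snd {F : Type*} [NormedAddCommGroup F] [NormedSpace ℝ F]
    {g : EE n × EE n → F} (hg : Differentiable ℝ g) (y ξ : EE n) :
    HasFDerivAt (fun ξ => g (y, ξ))
      ((fderiv ℝ g (y, ξ)).comp (ContinuousLinearMap.inr ℝ (EE n) (EE n))) ξ :=
  (hg (y, ξ)).hasFDerivAt.comp ξ (hasFDerivAt_prodMk_right y ξ)

theorem dLine_slice_snd {F : Type*} [NormedAddCommGroup F] [NormedSpace ℝ F]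
    {g : EE n × EE n → F} (hg : Differentiable ℝ g) (y : EE n) (l : Fin n) :
    dLine (eS l) (fun ξ => g (y, ξ)) = fun ξ => dLine (dY l) g (y, ξ) := by
  funext ξ
  unfold dLine
  rw [(hasFDerivAt_slice_snd hg y ξ).fderiv]; rfl

/-- mean value bound in the first variable -/
theorem slice_lip {g : EE n × EE n → ℝ} (hg : Differentiable ℝ g) (C : ℝ)
    (hC : ∀ i z, |dLine (dX i) g z| ≤ C) (y y' ξ : EE n) :
    |g (y', ξ) - g (y, ξ)| ≤ (n * C) * ‖y' - y‖ := by
  have := Convex.norm_image_sub_le_of_norm_hasFDerivWithin_le (𝕜 := ℝ) (s := Set.univ)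
    (f := fun y => g (y, ξ)) (C := n * C) (x := y) (y := y')
    (fun x _ => (hasFDerivAt_slice_fst hg x ξ).hasFDerivWithinAt) ?_ convex_univ trivial trivial
  · simpa using this
  · intro x _
    rcases Nat.eq_zero_or_pos n with hn | hn
    · subst hn
      refine ContinuousLinearMap.opNorm_le_bound _ (by simp) fun v => ?_
      have : v = 0 := Subsingleton.elim _ _
      subst this; rw [map_zero]; simp
    have hC0 : 0 ≤ C := (abs_nonneg _).trans (hC ⟨0, hn⟩ 0)
    refine ContinuousLinearMap.opNorm_le_bound _ (by positivity) fun v => ?_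
    have : ((fderiv ℝ g (x, ξ)).comp (ContinuousLinearMap.inl ℝ (EE n) (EE n))) v
       = ∑ i, v i * dLine (dX i) g (x, ξ) := by
      rw [← fderiv_fst_eq]; rfl
    rw [this, Real.norm_eq_abs]
    calc |∑ i, v i * dLine (dX i) g (x, ξ)| ≤ ∑ i, |v i * dLine (dX i) g (x, ξ)| :=
          Finset.abs_sum_le_sum_abs _ _
      _ ≤ ∑ _i : Fin n, C * ‖v‖ := by
          refine Finset.sum_le_sum fun i _ => ?_
          rw [abs_mul, mul_comm]
          exact mul_le_mul (hC i _) (abs_coord_le v i) (abs_nonneg _) hC0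
      _ = n * C * ‖v‖ := by simp; ring

theorem exists_bound_all {ι κ : Type*} [Finite κ] {W : Type*} (f : κ → ι → W → ℝ)
    (h : ∀ k, ∃ C : ℝ, ∀ i z, |f k i z| ≤ C) : ∃ C : ℝ, 0 ≤ C ∧ ∀ k i z, |f k i z| ≤ C := by
  have := Fintype.ofFinite κ
  choose C hC using h
  refine ⟨∑ k, |C k|, Finset.sum_nonneg fun _ _ => abs_nonneg _, fun k i z => ?_⟩
  exact (hC k i z).trans ((le_abs_self _).trans
    (Finset.single_le_sum (f := fun k => |C k|) (fun _ _ => abs_nonneg _) (Finset.mem_univ k)))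

theorem UB_diffquot {m : ℕ} {ι : Type*} : ∀ {g : ι → EE n × EE n → ℝ}
    (_ : ∀ i, ContDiff ℝ (⊤ : ℕ∞) (g i))
    (_ : ∀ i : Fin n, UB dY m (fun k => dLine (dX i) (g k))),
    UB eS m (fun (p : ι × EE n × EE n) ξ =>
      ‖p.2.2 - p.2.1‖⁻¹ * (g p.1 (p.2.2, ξ) - g p.1 (p.2.1, ξ))) := by
  have h0 : ∀ {m : ℕ} {g : ι → EE n × EE n → ℝ}
    (_ : ∀ i, ContDiff ℝ (⊤ : ℕ∞) (g i))
    (_ : ∀ i : Fin n, UB dY m (fun k => dLine (dX i) (g k))),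
    (∀ p : ι × EE n × EE n, ContDiff ℝ (⊤ : ℕ∞) (fun ξ =>
      ‖p.2.2 - p.2.1‖⁻¹ * (g p.1 (p.2.2, ξ) - g p.1 (p.2.1, ξ)))) ∧
      ∃ C : ℝ, ∀ (p : ι × EE n × EE n) ξ,
        |‖p.2.2 - p.2.1‖⁻¹ * (g p.1 (p.2.2, ξ) - g p.1 (p.2.1, ξ))| ≤ C := by
    intro m g hs hu
    constructor
    · intro p
      have h1 : ∀ y : EE n, ContDiff ℝ (⊤ : ℕ∞) (fun ξ => g p.1 (y, ξ)) := fun y =>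
        (hs p.1).comp (contDiff_const.prodMk contDiff_id)
      exact contDiff_const.mul ((h1 _).sub (h1 _))
    · obtain ⟨C, hC0, hC⟩ := exists_bound_all (fun i k => dLine (dX i) (g k)) (fun i => (hu i).bdd)
      refine ⟨n * C, fun p ξ => ?_⟩
      have := slice_lip (smooth_diff (hs p.1)) C (fun i z => hC i p.1 z) p.2.1 p.2.2 ξ
      rw [abs_mul, abs_inv, abs_norm]
      by_cases hp : ‖p.2.2 - p.2.1‖ = 0
      · rw [hp]; simp; positivity
      · have hp' : 0 < ‖p.2.2 - p.2.1‖ := lt_of_le_of_ne (norm_nonneg _) (Ne.symm hp)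
        rw [inv_mul_le_iff₀ hp']; linarith
  induction m with
  | zero => intro g hs hu; exact h0 hs hu
  | succ m ih =>
    intro g hs hu
    refine ⟨h0 hs hu, fun l => ?_⟩
    have e : (fun p : ι × EE n × EE n => dLine (eS l) (fun ξ =>
        ‖p.2.2 - p.2.1‖⁻¹ * (g p.1 (p.2.2, ξ) - g p.1 (p.2.1, ξ)))) = fun p ξ =>
        ‖p.2.2 - p.2.1‖⁻¹ * (dLine (dY l) (g p.1) (p.2.2, ξ) - dLine (dY l) (g p.1) (p.2.1, ξ)) := by
      funext p ξ
      have h1 := fun y : EE n => hasFDerivAt_slice_snd (smooth_diff (hs p.1)) y ξ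
      have h2 := ((h1 p.2.2).sub (h1 p.2.1)).const_mul (‖p.2.2 - p.2.1‖⁻¹)
      unfold dLine
      erw [h2.fderiv]
      rfl
    rw [e]
    refine ih (g := fun i => dLine (dY l) (g i)) (fun i => dLine_smooth (hs i)) fun i => ?_
    have : (fun k => dLine (dX i) (dLine (dY l) (g k))) = fun k => dLine (dY l) (dLine (dX i) (g k)) := by
      funext k; exact dLine_comm (hs k)
    rw [this]
    exact (hu i).2 l

/-- The phase hypotheses. -/
structure GP (n : ℕ) (C₀ : ℝ) (Cph : (Fin n → ℕ) → ℝ) (φ : EE n × EE n → ℝ) : Prop where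
  sm : ContDiff ℝ (⊤ : ℕ∞) φ
  det : ∀ z, C₀ ≤ |Matrix.det (Matrix.of fun i j => mixedHessXY φ i j z)|
  bd : ∀ i j : Fin n, ∀ α : Fin n → ℕ, mdeg α ≤ 2 * n + 1 →
          (∀ z, |mderiv dX α (mixedHessXY φ i j) z| ≤ Cph α) ∧
          (∀ z, |mderiv dY α (mixedHessXY φ i j) z| ≤ Cph α)

variable {C₀ : ℝ} {Cph : (Fin n → ℕ) → ℝ}

theorem mixed_smooth {φ : EE n × EE n → ℝ} (h : ContDiff ℝ (⊤ : ℕ∞) φ) (i j : Fin n) :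
    ContDiff ℝ (⊤ : ℕ∞) (mixedHessXY φ i j) := dLine_smooth (dLine_smooth h)

/-- swap as a continuous linear map -/
def swapL (n : ℕ) : EE n × EE n →L[ℝ] EE n × EE n :=
  (ContinuousLinearMap.snd ℝ (EE n) (EE n)).prod (ContinuousLinearMap.fst ℝ (EE n) (EE n))

theorem swapL_dX (i : Fin n) : swapL n (dX i) = dY i := rfl
theorem swapL_dY (i : Fin n) : swapL n (dY i) = dX i := rfl

theorem mixed_swap {φ : EE n × EE n → ℝ} (h : ContDiff ℝ (⊤ : ℕ∞) φ) (i j : Fin n) :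
    mixedHessXY (fun z => φ (swapL n z)) i j = fun z => mixedHessXY φ j i (swapL n z) := by
  unfold mixedHessXY
  rw [dLine_comp_clm _ _ (smooth_diff h),
    dLine_comp_clm _ _ (smooth_diff (dLine_smooth h)), swapL_dX, swapL_dY, dLine_comm h]

theorem GP.swap {φ : EE n × EE n → ℝ} (h : GP n C₀ Cph φ) :
    GP n C₀ Cph (fun z => φ (swapL n z)) where
  sm := h.sm.comp (swapL n).contDiff
  det z := by
    have : (Matrix.of fun i j => mixedHessXY (fun z => φ (swapL n z)) i j z) =
      Matrix.transpose (Matrix.of fun i j => mixedHessXY φ i j (swapL n z)) := by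
      ext i j
      simp [mixed_swap h.sm]
    rw [this, Matrix.det_transpose]
    exact h.det _
  bd i j α hα := by
    rw [mixed_swap h.sm, mderiv_comp_clm _ _ _ (mixed_smooth h.sm _ _),
      mderiv_comp_clm _ _ _ (mixed_smooth h.sm _ _)]
    exact ⟨fun z => (h.bd j i α hα).2 _, fun z => (h.bd j i α hα).1 _⟩

/-- index type for phases -/
abbrev Ph (n : ℕ) (C₀ : ℝ) (Cph : (Fin n → ℕ) → ℝ) := {φ : EE n × EE n → ℝ // GP n C₀ Cph φ}

theorem UB_mixed_Y (i j : Fin n) :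
    UB dY (2 * n + 1) (fun p : Ph n C₀ Cph => mixedHessXY p.1 i j) :=
  UB.of_mderiv Cph (fun p => mixed_smooth p.2.sm i j) fun α hα p z => (p.2.bd i j α hα).2 z

theorem UB_mixed_X (i j : Fin n) :
    UB dX (2 * n + 1) (fun p : Ph n C₀ Cph => mixedHessXY p.1 i j) :=
  UB.of_mderiv Cph (fun p => mixed_smooth p.2.sm i j) fun α hα p z => (p.2.bd i j α hα).1 z

/-- the first derivatives of the normalized phase difference -/
theorem UB_theta (l : Fin n) :
    UB eS (2 * n + 1) (fun (p : Ph n C₀ Cph × EE n × EE n) ξ =>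
      ‖p.2.2 - p.2.1‖⁻¹ * (dLine (dY l) p.1.1 (p.2.2, ξ) - dLine (dY l) p.1.1 (p.2.1, ξ))) :=
  UB_diffquot (g := fun p : Ph n C₀ Cph => dLine (dY l) p.1)
    (fun p => dLine_smooth p.2.sm) fun i => UB_mixed_Y i l

end Phase

section Had
variable {n : ℕ} {C₀ : ℝ} {Cph : (Fin n → ℕ) → ℝ}

theorem adj_bound (H : Matrix (Fin n) (Fin n) ℝ) (M : ℝ) (hM : 1 ≤ M) (h : ∀ i j, |H i j| ≤ M)
    (i j : Fin n) : |H.adjugate i j| ≤ (n.factorial : ℝ) * M ^ n := by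
  rw [Matrix.adjugate_apply]
  have := Matrix.det_le (A := H.updateRow j (Pi.single i 1)) (abv := AbsoluteValue.abs) (x := M) ?_
  · simpa using this
  · intro a b
    by_cases ha : a = j
    · subst ha
      simp only [Matrix.updateRow_self, AbsoluteValue.abs_apply]
      by_cases hb : b = i
      · subst hb; simpa using hM
      · simp [hb]; linarith
    · simp only [Matrix.updateRow_ne ha, AbsoluteValue.abs_apply]
      exact h a b

/-- lower bound for a matrix with large determinant -/
theorem mat_lower (H : Matrix (Fin n) (Fin n) ℝ) (M : ℝ) (hM : 1 ≤ M) (h : ∀ i j, |H i j| ≤ M)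
    (hC₀ : 0 < C₀) (hdet : C₀ ≤ |H.det|) (v w : EE n) (hw : ∀ l, w l = ∑ i, v i * H i l) :
    ‖v‖ ≤ (n * (n * ((n.factorial : ℝ) * M ^ n)) / C₀ + 1) * ‖w‖ := by
  have key : ∀ k, H.det * v k = ∑ l, w l * H.adjugate l k := by
    intro k
    have h1 : Matrix.vecMul (Matrix.vecMul (fun i => v i) H) H.adjugate = H.det • (fun i => v i) := by
      rw [Matrix.vecMul_vecMul, Matrix.mul_adjugate, Matrix.vecMul_smul, Matrix.vecMul_one]
    have h2 := congrFun h1 k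
    simp only [Pi.smul_apply, smul_eq_mul] at h2
    rw [← h2]
    simp only [Matrix.vecMul, dotProduct, hw]
  set D : ℝ := (n.factorial : ℝ) * M ^ n with hD
  have hD0 : 0 ≤ D := by positivity
  have hk : ∀ k, |v k| ≤ n * D / C₀ * ‖w‖ := by
    intro k
    have h3 : |H.det * v k| ≤ n * D * ‖w‖ := by
      rw [key k]
      calc |∑ l, w l * H.adjugate l k| ≤ ∑ l, |w l * H.adjugate l k| :=
            Finset.abs_sum_le_sum_abs _ _
        _ ≤ ∑ _l : Fin n, ‖w‖ * D := by
            refine Finset.sum_le_sum fun l _ => ?_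
            rw [abs_mul]
            exact mul_le_mul (abs_coord_le w l) (adj_bound H M hM h l k) (abs_nonneg _) (norm_nonneg _)
        _ = n * D * ‖w‖ := by simp; ring
    rw [abs_mul] at h3
    have h4 : C₀ * |v k| ≤ n * D * ‖w‖ := (mul_le_mul_of_nonneg_right hdet (abs_nonneg _)).trans h3
    rw [div_mul_eq_mul_div, le_div_iff₀ hC₀]; linarith
  calc ‖v‖ ≤ ∑ i, |v i| := norm_le_sum_abs v
    _ ≤ ∑ _i : Fin n, n * D / C₀ * ‖w‖ := Finset.sum_le_sum fun i _ => hk i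
    _ = n * (n * D) / C₀ * ‖w‖ := by simp; ring
    _ ≤ _ := by
      have := norm_nonneg w
      nlinarith

/-- the gradient map `y ↦ ∂_ξ φ(y, ξ)` -/
def gradMap (φ : EE n × EE n → ℝ) (ξ : EE n) (y : EE n) : EE n :=
  WithLp.toLp 2 (fun l => dLine (dY l) φ (y, ξ))

theorem gradMap_hasFDerivAt {φ : EE n × EE n → ℝ} (hφ : ContDiff ℝ (⊤ : ℕ∞) φ) (ξ y : EE n) :
    ∃ L : EE n →L[ℝ] EE n, HasFDerivAt (gradMap φ ξ) L y ∧
      ∀ v l, L v l = ∑ i, v i * mixedHessXY φ i l (y, ξ) := by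
  have h1 : DifferentiableAt ℝ (gradMap φ ξ) y := by
    rw [differentiableAt_euclidean]
    intro l
    exact (hasFDerivAt_slice_fst (smooth_diff (dLine_smooth hφ)) y ξ).differentiableAt
  refine ⟨_, h1.hasFDerivAt, fun v l => ?_⟩
  have h2 := (EuclideanSpace.proj l : EE n →L[ℝ] ℝ).hasFDerivAt.comp y h1.hasFDerivAt
  have h3 := hasFDerivAt_slice_fst (smooth_diff (dLine_smooth (v := dY l) hφ)) y ξ
  have h4 := h2.unique h3
  have h5 := congrArg (fun T : EE n →L[ℝ] ℝ => T v) h4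
  have h6 := fderiv_fst_eq (g := dLine (dY l) φ) v (y, ξ)
  exact h5.trans h6

theorem grad_expand (n : ℕ) (C₀ : ℝ) (hC₀ : 0 < C₀) (Cph : (Fin n → ℕ) → ℝ) :
    ∃ B : ℝ, 0 < B ∧ ∀ φ : Ph n C₀ Cph, ∀ ξ y z : EE n,
      ‖y - z‖ ≤ B * ‖gradMap φ.1 ξ y - gradMap φ.1 ξ z‖ := by
  obtain ⟨M₀, hM₀, hM₀b⟩ := exists_bound_all
    (fun (k : Fin n × Fin n) (p : Ph n C₀ Cph) => mixedHessXY p.1 k.1 k.2)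
    (fun k => (UB_mixed_X k.1 k.2).bdd)
  obtain ⟨M₁, hM₁, hM₁b⟩ := exists_bound_all
    (fun (k : Fin n × Fin n × Fin n) (p : Ph n C₀ Cph) => dLine (dX k.2.2) (mixedHessXY p.1 k.1 k.2.1))
    (fun k => ((UB_mixed_X k.1 k.2.1).2 k.2.2).bdd)
  set B : ℝ := (n * (n * ((n.factorial : ℝ) * (M₀ + 1) ^ n)) / C₀ + 1) with hB
  have hBpos : 0 < B := by positivity
  refine ⟨B, hBpos, fun φ ξ y z => ?_⟩
  choose L hL hLv using fun y => gradMap_hasFDerivAt φ.2.sm ξ y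
  have hlow : ∀ y v, ‖v‖ ≤ B * ‖L y v‖ := by
    intro y v
    exact mat_lower (Matrix.of fun i j => mixedHessXY φ.1 i j (y, ξ)) (M₀ + 1) (by linarith)
      (fun i j => (hM₀b (i, j) φ (y, ξ)).trans (by linarith)) hC₀ (φ.2.det _) v (L y v) (hLv y v)
  have hinj : ∀ y, Function.Injective (L y : EE n →ₗ[ℝ] EE n) := by
    intro y
    rw [injective_iff_map_eq_zero]
    intro v hv
    have h1 := hlow y v
    have h2 : L y v = 0 := hv
    rw [h2, norm_zero, mul_zero] at h1
    exact norm_le_zero_iff.1 h1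
  let f' : EE n → (EE n ≃L[ℝ] EE n) := fun y =>
    (LinearEquiv.ofInjectiveEndo (L y : EE n →ₗ[ℝ] EE n) (hinj y)).toContinuousLinearEquiv
  have hf' : ∀ y v, f' y v = L y v := fun y v => rfl
  have hf'' : ∀ y, (f' y : EE n →L[ℝ] EE n) = L y := fun y => by ext v; rfl
  refine hadamard (gradMap φ.1 ξ) f' (fun y => by rw [hf'']; exact hL y) B
    (n * (n * (n * M₁)) + 1) hBpos (by positivity) (fun y v => ?_) (fun y z => ?_) y z
  · have := hlow y ((f' y).symm v)
    rwa [← hf', ContinuousLinearEquiv.apply_symm_apply] at this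
  · rw [hf'', hf'']
    refine ContinuousLinearMap.opNorm_le_bound _ (by positivity) fun v => ?_
    calc ‖(L y - L z) v‖ ≤ ∑ l, |((L y - L z) v) l| := norm_le_sum_abs _
      _ ≤ ∑ _l : Fin n, n * (n * M₁) * ‖y - z‖ * ‖v‖ := by
          refine Finset.sum_le_sum fun l _ => ?_
          have e : ((L y - L z) v) l = ∑ i, v i * (mixedHessXY φ.1 i l (y, ξ) - mixedHessXY φ.1 i l (z, ξ)) := by
            have : ((L y - L z) v) l = L y v l - L z v l := rfl
            rw [this, hLv, hLv, ← Finset.sum_sub_distrib]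
            exact Finset.sum_congr rfl fun i _ => by ring
          rw [e]
          calc _ ≤ ∑ i, |v i * (mixedHessXY φ.1 i l (y, ξ) - mixedHessXY φ.1 i l (z, ξ))| :=
                Finset.abs_sum_le_sum_abs _ _
            _ ≤ ∑ _i : Fin n, ‖v‖ * (n * M₁ * ‖y - z‖) := by
                refine Finset.sum_le_sum fun i _ => ?_
                rw [abs_mul]
                exact mul_le_mul (abs_coord_le v i)
                  (slice_lip (smooth_diff (mixed_smooth φ.2.sm i l)) M₁
                    (fun k w => hM₁b (i, l, k) φ w) z y ξ) (abs_nonneg _) (norm_nonneg _)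
            _ = _ := by simp; ring
      _ = n * (n * (n * M₁)) * (‖y - z‖ * ‖v‖) := by simp; ring
      _ ≤ _ := by
          have : 0 ≤ ‖y - z‖ * ‖v‖ := by positivity
          nlinarith

/-- lower bound for the gradient of the normalized phase difference -/
theorem theta_lower (n : ℕ) (C₀ : ℝ) (hC₀ : 0 < C₀) (Cph : (Fin n → ℕ) → ℝ) :
    ∃ c : ℝ, 0 < c ∧ ∀ φ : Ph n C₀ Cph, ∀ ξ y z : EE n, y ≠ z →
      c ≤ ∑ l, (‖z - y‖⁻¹ * (dLine (dY l) φ.1 (z, ξ) - dLine (dY l) φ.1 (y, ξ))) *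
        (‖z - y‖⁻¹ * (dLine (dY l) φ.1 (z, ξ) - dLine (dY l) φ.1 (y, ξ))) := by
  obtain ⟨B, hB, h⟩ := grad_expand n C₀ hC₀ Cph
  refine ⟨(B ^ 2)⁻¹, by positivity, fun φ ξ y z hyz => ?_⟩
  have h1 := h φ ξ z y
  have hpos : 0 < ‖z - y‖ := norm_pos_iff.2 (sub_ne_zero.2 hyz.symm)
  have h2 : ‖gradMap φ.1 ξ z - gradMap φ.1 ξ y‖ ^ 2 =
      ∑ l, (dLine (dY l) φ.1 (z, ξ) - dLine (dY l) φ.1 (y, ξ)) ^ 2 := by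
    rw [EuclideanSpace.norm_sq_eq]
    refine Finset.sum_congr rfl fun l _ => ?_
    rw [Real.norm_eq_abs, sq_abs]; rfl
  have h3 : ‖z - y‖ ^ 2 ≤ B ^ 2 * ‖gradMap φ.1 ξ z - gradMap φ.1 ξ y‖ ^ 2 := by
    rw [← mul_pow]; exact pow_le_pow_left₀ hpos.le h1 2
  have h4 : ∑ l, (‖z - y‖⁻¹ * (dLine (dY l) φ.1 (z, ξ) - dLine (dY l) φ.1 (y, ξ))) *
        (‖z - y‖⁻¹ * (dLine (dY l) φ.1 (z, ξ) - dLine (dY l) φ.1 (y, ξ))) =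
      (‖z - y‖ ^ 2)⁻¹ * ‖gradMap φ.1 ξ z - gradMap φ.1 ξ y‖ ^ 2 := by
    rw [h2, Finset.mul_sum]
    refine Finset.sum_congr rfl fun l _ => ?_
    rw [← inv_pow]; ring
  rw [h4, inv_mul_eq_div, le_div_iff₀ (by positivity), inv_mul_le_iff₀ (by positivity)]
  exact h3

end Had

section NSP
variable {n : ℕ} {ι : Type*}

theorem hasCompactSupport_of_ball {F : Type*} [NormedAddCommGroup F] {f : EE n → F} {p : EE n} {R : ℝ}
    (h : ∀ ξ, ξ ∉ Metric.closedBall p R → f ξ = 0) : HasCompactSupport f :=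
  HasCompactSupport.intro (isCompact_closedBall p R) fun ξ hξ => h ξ hξ

theorem dLine_vanish {F : Type*} [NormedAddCommGroup F] [NormedSpace ℝ F] {f : EE n → F} {p : EE n} {R : ℝ}
    (h : ∀ ξ, ξ ∉ Metric.closedBall p R → f ξ = 0) (v : EE n) :
    ∀ ξ, ξ ∉ Metric.closedBall p R → dLine v f ξ = 0 := by
  intro ξ hξ
  have h1 : f =ᶠ[nhds ξ] fun _ => 0 := by
    filter_upwards [Metric.isClosed_closedBall.isOpen_compl.mem_nhds hξ] with z hz using h z hz
  unfold dLine
  rw [h1.fderiv_eq]; simp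

/-- oscillatory integral -/
def oscI (lam : ℝ) (Θ b : EE n → ℝ) : ℂ := ∫ ξ, Complex.exp (Complex.I * ((lam * Θ ξ : ℝ) : ℂ)) * (b ξ : ℂ)

theorem osc_cont (lam : ℝ) {Θ : EE n → ℝ} (hΘ : ContDiff ℝ (⊤ : ℕ∞) Θ) :
    ContDiff ℝ (⊤ : ℕ∞) (fun ξ => Complex.exp (Complex.I * ((lam * Θ ξ : ℝ) : ℂ))) := by
  have h1 : ContDiff ℝ (⊤ : ℕ∞) (fun ξ => ((lam * Θ ξ : ℝ) : ℂ)) :=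
    Complex.ofRealCLM.contDiff.comp (contDiff_const.mul hΘ)
  exact (contDiff_const.mul h1).cexp

theorem osc_deriv (lam : ℝ) {Θ : EE n → ℝ} (hΘ : ContDiff ℝ (⊤ : ℕ∞) Θ) (v ξ : EE n) :
    fderiv ℝ (fun ξ => Complex.exp (Complex.I * ((lam * Θ ξ : ℝ) : ℂ))) ξ v =
      Complex.exp (Complex.I * ((lam * Θ ξ : ℝ) : ℂ)) * (Complex.I * ((lam * dLine v Θ ξ : ℝ) : ℂ)) := by
  have h0 : HasFDerivAt (fun ξ => lam * Θ ξ) (lam • fderiv ℝ Θ ξ) ξ :=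
    ((smooth_diff hΘ) ξ).hasFDerivAt.const_mul lam
  have h1 : HasFDerivAt (fun ξ => ((lam * Θ ξ : ℝ) : ℂ)) (Complex.ofRealCLM.comp (lam • fderiv ℝ Θ ξ)) ξ :=
    Complex.ofRealCLM.hasFDerivAt.comp ξ h0
  have h2 := (h1.const_mul Complex.I).cexp
  rw [h2.fderiv]
  simp [dLine]

theorem osc_norm (t : ℝ) : ‖Complex.exp (Complex.I * (t : ℂ))‖ = 1 := by
  rw [mul_comm]; exact Complex.norm_exp_ofReal_mul_I t

theorem oscI_bound (lam : ℝ) (Θ b : EE n → ℝ) (C R : ℝ) (p : EE n) (hb : ∀ ξ, |b ξ| ≤ C)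
    (hs : ∀ ξ, ξ ∉ Metric.closedBall p R → b ξ = 0) :
    ‖oscI lam Θ b‖ ≤ C * volume.real (Metric.closedBall (0 : EE n) R) := by
  unfold oscI
  rw [← setIntegral_eq_integral_of_forall_compl_eq_zero (s := Metric.closedBall p R)
    (fun ξ hξ => by rw [hs ξ hξ]; simp)]
  have : volume.real (Metric.closedBall (0 : EE n) R) = volume.real (Metric.closedBall p R) := by
    unfold Measure.real
    rw [Measure.addHaar_closedBall_center volume p R]
  rw [this]
  refine norm_setIntegral_le_of_norm_le_const measure_closedBall_lt_top fun ξ _ => ?_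
  rw [norm_mul, osc_norm, one_mul, Complex.norm_real]
  exact hb ξ

theorem osc_ibp (lam : ℝ) {Θ g : EE n → ℝ} (hΘ : ContDiff ℝ (⊤ : ℕ∞) Θ) (hg : ContDiff ℝ (⊤ : ℕ∞) g)
    (hc : HasCompactSupport g) (v : EE n) :
    Complex.I * lam * oscI lam Θ (fun ξ => dLine v Θ ξ * g ξ) = - oscI lam Θ (dLine v g) := by
  have hgc : HasCompactSupport (fun ξ => (g ξ : ℂ)) := hc.comp_left Complex.ofReal_zero
  have hgs : ContDiff ℝ (⊤ : ℕ∞) (fun ξ => (g ξ : ℂ)) := Complex.ofRealCLM.contDiff.comp hg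
  have hgd : ∀ ξ, fderiv ℝ (fun ξ => (g ξ : ℂ)) ξ v = ((dLine v g ξ : ℝ) : ℂ) := by
    intro ξ
    have h1 : HasFDerivAt (fun ξ => (g ξ : ℂ)) (Complex.ofRealCLM.comp (fderiv ℝ g ξ)) ξ :=
      Complex.ofRealCLM.hasFDerivAt.comp ξ ((smooth_diff hg) ξ).hasFDerivAt
    rw [h1.fderiv]; rfl
  have hdc : Continuous (fun ξ => fderiv ℝ (fun ξ => (g ξ : ℂ)) ξ v) :=
    (dLine_smooth (v := v) hgs).continuous
  have hfc : Continuous (fun ξ => fderiv ℝ (fun ξ => Complex.exp (Complex.I * ((lam * Θ ξ : ℝ) : ℂ))) ξ v) :=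
    (dLine_smooth (v := v) (osc_cont lam hΘ)).continuous
  have key := integral_mul_fderiv_eq_neg_fderiv_mul_of_integrable (𝕜 := ℂ) (μ := volume)
    (f := fun ξ => Complex.exp (Complex.I * ((lam * Θ ξ : ℝ) : ℂ))) (g := fun ξ => (g ξ : ℂ)) (v := v)
    ?_ ?_ ?_ (fun x _ => smooth_diff (osc_cont lam hΘ) x) (fun x _ => smooth_diff hgs x)
  · unfold oscI
    simp only [hgd] at key
    rw [key, neg_neg, ← integral_const_mul]
    congr 1
    funext ξ
    rw [osc_deriv lam hΘ]
    push_cast; ring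
  · exact (hfc.mul hgs.continuous).integrable_of_hasCompactSupport hgc.mul_left
  · exact ((osc_cont lam hΘ).continuous.mul hdc).integrable_of_hasCompactSupport
      (hgc.fderiv_apply (𝕜 := ℝ) v).mul_left
  · exact ((osc_cont lam hΘ).continuous.mul hgs.continuous).integrable_of_hasCompactSupport hgc.mul_left

theorem oscI_sum (lam : ℝ) {Θ : EE n → ℝ} (hΘ : ContDiff ℝ (⊤ : ℕ∞) Θ) {κ : Type*} (s : Finset κ)
    (g : κ → EE n → ℝ) (hg : ∀ k, Continuous (g k)) (hc : ∀ k, HasCompactSupport (g k)) :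
    oscI lam Θ (fun ξ => ∑ k ∈ s, g k ξ) = ∑ k ∈ s, oscI lam Θ (g k) := by
  unfold oscI
  rw [← integral_finsetSum]
  · congr 1; funext ξ; push_cast; rw [Finset.mul_sum]
  · intro k _
    exact ((osc_cont lam hΘ).continuous.mul (Complex.continuous_ofReal.comp (hg k))).integrable_of_hasCompactSupport
      ((hc k).comp_left (g := fun t : ℝ => (t : ℂ)) Complex.ofReal_zero).mul_left

theorem nsp {N : ℕ} (Θ : ι → EE n → ℝ) (lam : ι → ℝ) (hΘs : ∀ i, ContDiff ℝ (⊤ : ℕ∞) (Θ i))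
    (hΘ : ∀ l, UB eS N (fun i => dLine (eS l) (Θ i))) (c : ℝ) (hc : 0 < c)
    (hlow : ∀ i ξ, c ≤ ∑ l, dLine (eS l) (Θ i) ξ * dLine (eS l) (Θ i) ξ) (R : ℝ) (p : ι → EE n) :
    ∀ m ≤ N, ∀ b : ι → EE n → ℝ, UB eS m b → (∀ i ξ, ξ ∉ Metric.closedBall (p i) R → b i ξ = 0) →
      ∃ C : ℝ, ∀ i, |lam i| ^ m * ‖oscI (lam i) (Θ i) (b i)‖ ≤ C := by
  have hV : ∀ l, UB eS N (fun i ξ => dLine (eS l) (Θ i) ξ *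
      (∑ k, dLine (eS k) (Θ i) ξ * dLine (eS k) (Θ i) ξ)⁻¹) := fun l =>
    (hΘ l).mul (UB.inv (UB.sum Finset.univ (f := fun k i ξ => dLine (eS k) (Θ i) ξ * dLine (eS k) (Θ i) ξ)
      fun k _ => (hΘ k).mul (hΘ k)) hc hlow)
  set V : Fin n → ι → EE n → ℝ := fun l i ξ => dLine (eS l) (Θ i) ξ *
      (∑ k, dLine (eS k) (Θ i) ξ * dLine (eS k) (Θ i) ξ)⁻¹ with hVdef
  have hVsum : ∀ i ξ, ∑ l, dLine (eS l) (Θ i) ξ * V l i ξ = 1 := by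
    intro i ξ
    simp only [hVdef]
    simp only [← mul_assoc]
    rw [← Finset.sum_mul]
    exact mul_inv_cancel₀ (hc.trans_le (hlow i ξ)).ne'
  intro m
  induction m with
  | zero =>
    intro _ b hb hs
    obtain ⟨C, hC⟩ := hb.bdd
    refine ⟨C * volume.real (Metric.closedBall (0 : EE n) R), fun i => ?_⟩
    rw [pow_zero, one_mul]
    exact oscI_bound _ _ _ C R (p i) (hC i) (hs i)
  | succ m ih =>
    intro hm b hb hs
    have hVb : ∀ l, UB eS (m + 1) (fun i ξ => V l i ξ * b i ξ) := fun l => ((hV l).le hm).mul hb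
    have hVbs : ∀ l i ξ, ξ ∉ Metric.closedBall (p i) R → V l i ξ * b i ξ = 0 := fun l i ξ h => by
      rw [hs i ξ h, mul_zero]
    obtain ⟨C, hC⟩ := ih (by omega) (fun i ξ => ∑ l, dLine (eS l) (fun ξ => V l i ξ * b i ξ) ξ)
      (UB.sum Finset.univ (f := fun l i => dLine (eS l) (fun ξ => V l i ξ * b i ξ)) fun l _ => (hVb l).2 l)
      (fun i ξ h => Finset.sum_eq_zero fun l _ => dLine_vanish (hVbs l i) _ ξ h)
    refine ⟨C, fun i => ?_⟩
    have e1 : oscI (lam i) (Θ i) (b i) =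
        ∑ l, oscI (lam i) (Θ i) (fun ξ => dLine (eS l) (Θ i) ξ * (V l i ξ * b i ξ)) := by
      rw [← oscI_sum _ (hΘs i)]
      · congr 1
        funext ξ
        simp only [← mul_assoc]
        rw [← Finset.sum_mul, hVsum, one_mul]
      · intro l
        exact (dLine_smooth (hΘs i)).continuous.mul ((hVb l).smooth i).continuous
      · intro l
        exact (hasCompactSupport_of_ball (hVbs l i)).mul_left
    have e2 : Complex.I * lam i * oscI (lam i) (Θ i) (b i) =
        - oscI (lam i) (Θ i) (fun ξ => ∑ l, dLine (eS l) (fun ξ => V l i ξ * b i ξ) ξ) := by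
      rw [e1, Finset.mul_sum, oscI_sum _ (hΘs i), ← Finset.sum_neg_distrib]
      · refine Finset.sum_congr rfl fun l _ => ?_
        exact osc_ibp (lam i) (hΘs i) ((hVb l).smooth i) (hasCompactSupport_of_ball (hVbs l i)) _
      · intro l
        exact (dLine_smooth ((hVb l).smooth i)).continuous
      · intro l
        exact hasCompactSupport_of_ball (dLine_vanish (hVbs l i) _)
    have e3 : |lam i| * ‖oscI (lam i) (Θ i) (b i)‖ =
        ‖oscI (lam i) (Θ i) (fun ξ => ∑ l, dLine (eS l) (fun ξ => V l i ξ * b i ξ) ξ)‖ := by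
      have e4 := congrArg norm e2
      rw [norm_neg, norm_mul, norm_mul] at e4
      rw [← e4]; simp
    calc |lam i| ^ (m + 1) * ‖oscI (lam i) (Θ i) (b i)‖
        = |lam i| ^ m * (|lam i| * ‖oscI (lam i) (Θ i) (b i)‖) := by ring
      _ ≤ C := by rw [e3]; exact hC i

end NSP

section Part
variable {n : ℕ}

/-- bump on the line -/
def psi (t : ℝ) : ℝ := Real.smoothTransition (t + 1) - Real.smoothTransition t

theorem psi_smooth : ContDiff ℝ (⊤ : ℕ∞) psi := by
  unfold psi
  exact (Real.smoothTransition.contDiff.comp (contDiff_id.add contDiff_const)).sub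
    Real.smoothTransition.contDiff

theorem psi_zero {t : ℝ} (h : 1 ≤ |t|) : psi t = 0 := by
  unfold psi
  rcases le_abs.1 h with h | h
  · rw [Real.smoothTransition.one_of_one_le h, Real.smoothTransition.one_of_one_le (by linarith), sub_self]
  · rw [Real.smoothTransition.zero_of_nonpos (by linarith),
      Real.smoothTransition.zero_of_nonpos (by linarith), sub_self]

theorem st_diff_abs (a b : ℝ) : |Real.smoothTransition a - Real.smoothTransition b| ≤ 1 := by
  have h1 := Real.smoothTransition.nonneg a
  have h2 := Real.smoothTransition.nonneg b
  have h3 := Real.smoothTransition.le_one a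
  have h4 := Real.smoothTransition.le_one b
  rw [abs_le]; constructor <;> linarith

theorem psi_abs (t : ℝ) : |psi t| ≤ 1 := st_diff_abs _ _

/-- the integer interval `[-N, N]` -/
def boxI (N : ℕ) : Finset ℤ := Finset.Icc (-(N : ℤ)) N

theorem psi_sum (N : ℕ) (t : ℝ) : ∑ m ∈ boxI N, psi (t - m) =
    Real.smoothTransition (t + N + 1) - Real.smoothTransition (t - N) := by
  unfold boxI psi
  induction N with
  | zero => simp
  | succ N ih =>
    have : Finset.Icc (-((N + 1 : ℕ) : ℤ)) ((N + 1 : ℕ) : ℤ) =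
        insert (-((N : ℤ) + 1)) (insert ((N : ℤ) + 1) (Finset.Icc (-(N : ℤ)) N)) := by
      ext m; simp only [Finset.mem_Icc, Finset.mem_insert]; push_cast; omega
    rw [this, Finset.sum_insert, Finset.sum_insert, ih]
    · push_cast
      have e1 : t - (-((N : ℝ) + 1)) + 1 = t + (N + 1) + 1 := by ring
      have e2 : t - (-((N : ℝ) + 1)) = t + N + 1 := by ring
      have e3 : t - ((N : ℝ) + 1) + 1 = t - N := by ring
      rw [e1, e2, e3]; ring
    · simp
    · simp; omega

/-- bump on Euclidean space -/
def chi (v : EE n) : ℝ := ∏ i, psi (v i)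

theorem chi_smooth : ContDiff ℝ (⊤ : ℕ∞) (chi : EE n → ℝ) := by
  unfold chi
  refine contDiff_prod fun i _ => psi_smooth.comp ?_
  exact (EuclideanSpace.proj i : EE n →L[ℝ] ℝ).contDiff

theorem chi_abs (v : EE n) : |chi v| ≤ 1 := by
  unfold chi
  rw [Finset.abs_prod]
  exact Finset.prod_le_one (fun _ _ => abs_nonneg _) fun i _ => psi_abs _

theorem chi_zero' {v : EE n} {i : Fin n} (h : 1 ≤ |v i|) : chi v = 0 :=
  Finset.prod_eq_zero (Finset.mem_univ i) (psi_zero h)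

theorem chi_zero {v : EE n} (h : v ∉ Metric.closedBall (0 : EE n) n) : chi v = 0 := by
  by_contra h1
  apply h
  have h2 : ∀ i, |v i| ≤ 1 := fun i => by
    by_contra h3
    exact h1 (chi_zero' (i := i) (by linarith))
  rw [mem_closedBall_zero_iff]
  calc ‖v‖ ≤ ∑ i, |v i| := norm_le_sum_abs v
    _ ≤ ∑ _i : Fin n, 1 := Finset.sum_le_sum fun i _ => h2 i
    _ = n := by simp

theorem chi_trans_zero {v c : EE n} (h : v ∉ Metric.closedBall c n) : chi (v - c) = 0 := by
  apply chi_zero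
  rw [mem_closedBall_zero_iff]
  rwa [mem_closedBall_iff_norm] at h

/-- translates of a compactly supported smooth function -/
theorem UB_translates {m : ℕ} : ∀ {g : EE n → ℝ} (_ : ContDiff ℝ (⊤ : ℕ∞) g)
    (_ : ∀ ξ, ξ ∉ Metric.closedBall (0 : EE n) n → g ξ = 0),
    UB eS m (fun (c : EE n) ξ => g (ξ - c)) := by
  have h0 : ∀ {g : EE n → ℝ} (_ : ContDiff ℝ (⊤ : ℕ∞) g)
    (_ : ∀ ξ, ξ ∉ Metric.closedBall (0 : EE n) n → g ξ = 0),
    (∀ c : EE n, ContDiff ℝ (⊤ : ℕ∞) (fun ξ => g (ξ - c))) ∧ ∃ C : ℝ, ∀ (c : EE n) ξ, |g (ξ - c)| ≤ C := by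
    intro g hg hc
    refine ⟨fun c => hg.comp (contDiff_id.sub contDiff_const), ?_⟩
    obtain ⟨C, hC⟩ := (hasCompactSupport_of_ball hc).exists_bound_of_continuous hg.continuous
    exact ⟨C, fun c ξ => hC _⟩
  induction m with
  | zero => intro g hg hc; exact h0 hg hc
  | succ m ih =>
    intro g hg hc
    refine ⟨h0 hg hc, fun l => ?_⟩
    have : (fun c : EE n => dLine (eS l) (fun ξ => g (ξ - c))) = fun c ξ => dLine (eS l) g (ξ - c) := by
      funext c ξ
      unfold dLine
      rw [fderiv_comp_sub]
    rw [this]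
    exact ih (dLine_smooth hg) (dLine_vanish hc _)

/-- lattice point as a vector -/
def latt (j : Fin n → ℤ) : EE n := WithLp.toLp 2 (fun i => (j i : ℝ))

theorem latt_apply (j : Fin n → ℤ) (i : Fin n) : latt j i = j i := rfl

/-- boxes in the lattice -/
def boxN (n N : ℕ) : Finset (Fin n → ℤ) := Fintype.piFinset fun _ => boxI N

/-- partial sums of the partition of unity -/
def XN (N : ℕ) (v : EE n) : ℝ := ∑ j ∈ boxN n N, chi (v - latt j)

theorem XN_eq (N : ℕ) (v : EE n) : XN N v = ∏ i,
    (Real.smoothTransition (v i + N + 1) - Real.smoothTransition (v i - N)) := by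
  unfold XN boxN chi
  simp only [← psi_sum]
  rw [Finset.prod_univ_sum]
  rfl

theorem XN_abs (N : ℕ) (v : EE n) : |XN N v| ≤ 1 := by
  rw [XN_eq, Finset.abs_prod]
  exact Finset.prod_le_one (fun _ _ => abs_nonneg _) fun i _ => st_diff_abs _ _

theorem XN_one (N : ℕ) (v : EE n) (h : ‖v‖ ≤ N) : XN N v = 1 := by
  rw [XN_eq]
  refine Finset.prod_eq_one fun i _ => ?_
  have := (abs_coord_le v i).trans h
  rw [abs_le] at this
  rw [Real.smoothTransition.one_of_one_le (by linarith),
    Real.smoothTransition.zero_of_nonpos (by linarith), sub_zero]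

theorem one_add_pow_le (t : ℝ) (ht : 0 ≤ t) (N : ℕ) : (1 + t) ^ N ≤ 2 ^ N * (1 + t ^ N) := by
  rcases le_total t 1 with h | h
  · calc (1 + t) ^ N ≤ 2 ^ N := pow_le_pow_left₀ (by linarith) (by linarith) N
      _ ≤ 2 ^ N * (1 + t ^ N) := by
        have : 0 ≤ t ^ N := by positivity
        have : (0:ℝ) < 2 ^ N := by positivity
        nlinarith
  · calc (1 + t) ^ N ≤ (2 * t) ^ N := pow_le_pow_left₀ (by linarith) (by linarith) N
      _ = 2 ^ N * t ^ N := mul_pow _ _ _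
      _ ≤ _ := by
        have : (0:ℝ) < 2 ^ N := by positivity
        nlinarith

/-- decay of the phase-difference integrals -/
theorem osc_decay (n : ℕ) (C₀ : ℝ) (hC₀ : 0 < C₀) (Cph : (Fin n → ℕ) → ℝ) :
    ∃ C : ℝ, 0 ≤ C ∧ ∀ (φ : Ph n C₀ Cph) (y y' k k' : EE n),
      (1 + ‖y' - y‖) ^ (2 * n + 1) * ‖∫ ξ, Complex.exp (Complex.I * ((φ.1 (y', ξ) - φ.1 (y, ξ) : ℝ) : ℂ)) *
        ((chi (ξ - k) * chi (ξ - k') : ℝ) : ℂ)‖ ≤ C := by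
  obtain ⟨c, hc, hlow⟩ := theta_lower n C₀ hC₀ Cph
  let ι := {p : (Ph n C₀ Cph × EE n × EE n) × EE n × EE n // p.1.2.1 ≠ p.1.2.2}
  let Θ : ι → EE n → ℝ := fun p ξ => ‖p.1.1.2.2 - p.1.1.2.1‖⁻¹ *
    (p.1.1.1.1 (p.1.1.2.2, ξ) - p.1.1.1.1 (p.1.1.2.1, ξ))
  have hΘs : ∀ p, ContDiff ℝ (⊤ : ℕ∞) (Θ p) := by
    intro p
    have h1 : ∀ y : EE n, ContDiff ℝ (⊤ : ℕ∞) (fun ξ => p.1.1.1.1 (y, ξ)) := fun y =>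
        p.1.1.1.2.sm.comp (contDiff_const.prodMk contDiff_id)
    exact contDiff_const.mul ((h1 _).sub (h1 _))
  have hdΘ : ∀ p l, dLine (eS l) (Θ p) = fun ξ => ‖p.1.1.2.2 - p.1.1.2.1‖⁻¹ *
    (dLine (dY l) p.1.1.1.1 (p.1.1.2.2, ξ) - dLine (dY l) p.1.1.1.1 (p.1.1.2.1, ξ)) := by
    intro p l
    funext ξ
    have h1 := fun y : EE n => hasFDerivAt_slice_snd (smooth_diff p.1.1.1.2.sm) y ξ
    have h2 := ((h1 p.1.1.2.2).sub (h1 p.1.1.2.1)).const_mul (‖p.1.1.2.2 - p.1.1.2.1‖⁻¹)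
    unfold dLine
    erw [h2.fderiv]
    rfl
  have hb : UB eS (2 * n + 1) (fun (p : ι) ξ => chi (ξ - p.1.2.1) * chi (ξ - p.1.2.2)) :=
    ((UB_translates chi_smooth fun ξ h => chi_zero h).reindex fun p : ι => p.1.2.1).mul
    ((UB_translates chi_smooth fun ξ h => chi_zero h).reindex fun p : ι => p.1.2.2)
  obtain ⟨C, hC⟩ := nsp (N := 2 * n + 1) Θ (fun p => ‖p.1.1.2.2 - p.1.1.2.1‖) hΘs
    (fun l => by
      have := (UB_theta (C₀ := C₀) (Cph := Cph) l).reindex (fun p : ι => p.1.1)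
      convert this using 2 with p
      rw [hdΘ])
    c hc (fun p ξ => by
      simp only [hdΘ]
      exact hlow _ ξ _ _ p.2) n (fun p => p.1.2.1) (2 * n + 1) le_rfl
    (fun p ξ => chi (ξ - p.1.2.1) * chi (ξ - p.1.2.2)) hb
    (fun p ξ h => by rw [chi_trans_zero h, zero_mul])
  set V := volume.real (Metric.closedBall (0 : EE n) n) with hV
  have hV0 : 0 ≤ V := measureReal_nonneg
  refine ⟨2 ^ (2 * n + 1) * (V + |C|), by positivity, fun φ y y' k k' => ?_⟩
  set I₀ := ∫ ξ, Complex.exp (Complex.I * ((φ.1 (y', ξ) - φ.1 (y, ξ) : ℝ) : ℂ)) *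
        ((chi (ξ - k) * chi (ξ - k') : ℝ) : ℂ) with hI
  have hI0 : ‖I₀‖ ≤ V := by
    have := oscI_bound 1 (fun ξ => φ.1 (y', ξ) - φ.1 (y, ξ)) (fun ξ => chi (ξ - k) * chi (ξ - k')) 1 n k
      (fun ξ => by
        rw [abs_mul]; exact mul_le_one₀ (chi_abs _) (abs_nonneg _) (chi_abs _))
      (fun ξ h => by rw [chi_trans_zero h, zero_mul])
    rw [one_mul] at this
    simp only [oscI, one_mul] at this
    exact this
  have hI1 : ‖y' - y‖ ^ (2 * n + 1) * ‖I₀‖ ≤ |C| := by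
    by_cases hy : y = y'
    · subst hy; simp
    · have := hC ⟨((φ, y, y'), k, k'), hy⟩
      have hne : ‖y' - y‖ ≠ 0 := norm_ne_zero_iff.2 (sub_ne_zero.2 (Ne.symm hy))
      have e : oscI (‖y' - y‖) (Θ ⟨((φ, y, y'), k, k'), hy⟩) (fun ξ => chi (ξ - k) * chi (ξ - k')) = I₀ := by
        rw [hI]; unfold oscI
        congr 1; funext ξ
        congr 4
        simp only [Θ]
        rw [mul_inv_cancel_left₀ hne]
      rw [← e]
      refine le_trans ?_ (this.trans (le_abs_self C))
      simp
  calc (1 + ‖y' - y‖) ^ (2 * n + 1) * ‖I₀‖ ≤ 2 ^ (2 * n + 1) * (1 + ‖y' - y‖ ^ (2 * n + 1)) * ‖I₀‖ :=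
        mul_le_mul_of_nonneg_right (one_add_pow_le _ (norm_nonneg _) _) (norm_nonneg _)
    _ = 2 ^ (2 * n + 1) * (‖I₀‖ + ‖y' - y‖ ^ (2 * n + 1) * ‖I₀‖) := by ring
    _ ≤ 2 ^ (2 * n + 1) * (V + |C|) := by gcongr

end Part

section Kop

theorem lint_cs {α : Type*} [MeasurableSpace α] {μ : Measure α} {f g : α → ℝ≥0∞}
    (hf : AEMeasurable f μ) (hg : AEMeasurable g μ) :
    (∫⁻ x, f x * g x ∂μ) ^ 2 ≤ (∫⁻ x, f x ^ 2 ∂μ) * ∫⁻ x, g x ^ 2 ∂μ := by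
  have h := ENNReal.lintegral_mul_le_Lp_mul_Lq μ (p := 2) (q := 2) Real.HolderConjugate.two_two hf hg
  have h2 := pow_le_pow_left' h 2
  refine h2.trans (le_of_eq ?_)
  rw [mul_pow, ← ENNReal.rpow_natCast, ← ENNReal.rpow_natCast, ← ENNReal.rpow_mul, ← ENNReal.rpow_mul]
  norm_num

theorem eLpNorm_sq {α : Type*} [MeasurableSpace α] {μ : Measure α} {F : Type*} [NormedAddCommGroup F]
    (f : α → F) : (eLpNorm f 2 μ) ^ 2 = ∫⁻ x, ‖f x‖ₑ ^ 2 ∂μ := by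
  rw [eLpNorm_eq_lintegral_rpow_enorm_toReal (by norm_num) (by norm_num), ← ENNReal.rpow_natCast,
    ← ENNReal.rpow_mul]
  norm_num

theorem schur {α β : Type*} [MeasurableSpace α] [MeasurableSpace β] {μ : Measure α} {ν : Measure β}
    [SFinite μ] [SFinite ν] {k : α → β → ℝ≥0∞} (hk : Measurable (Function.uncurry k)) {F : β → ℝ≥0∞}
    (hF : Measurable F) (A B : ℝ≥0∞) (hA : ∀ x, ∫⁻ y, k x y ∂ν ≤ A) (hB : ∀ y, ∫⁻ x, k x y ∂μ ≤ B) :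
    ∫⁻ x, (∫⁻ y, k x y * F y ∂ν) ^ 2 ∂μ ≤ A * B * ∫⁻ y, F y ^ 2 ∂ν := by
  have hkx : ∀ x, Measurable (k x) := fun x => hk.comp measurable_prodMk_left
  have hky : ∀ y, Measurable (fun x => k x y) := fun y => hk.comp measurable_prodMk_right
  have hsq : ∀ a : ℝ≥0∞, (a ^ (1 / 2 : ℝ)) ^ 2 = a := by
    intro a
    rw [← ENNReal.rpow_natCast, ← ENNReal.rpow_mul]; norm_num
  have h1 : ∀ x, (∫⁻ y, k x y * F y ∂ν) ^ 2 ≤ A * ∫⁻ y, k x y * F y ^ 2 ∂ν := by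
    intro x
    have := lint_cs (μ := ν) (f := fun y => (k x y) ^ (1 / 2 : ℝ)) (g := fun y => (k x y) ^ (1 / 2 : ℝ) * F y)
      ((hkx x).pow_const _).aemeasurable (((hkx x).pow_const _).mul hF).aemeasurable
    simp only [← mul_assoc, ← sq, hsq, mul_pow] at this
    exact this.trans (mul_le_mul_left (hA x) _)
  calc ∫⁻ x, (∫⁻ y, k x y * F y ∂ν) ^ 2 ∂μ ≤ ∫⁻ x, A * ∫⁻ y, k x y * F y ^ 2 ∂ν ∂μ := lintegral_mono h1
    _ = A * ∫⁻ x, ∫⁻ y, k x y * F y ^ 2 ∂ν ∂μ := by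
        refine lintegral_const_mul _ ?_
        exact (hk.mul ((hF.comp measurable_snd).pow_const 2)).lintegral_prod_right'
    _ = A * ∫⁻ y, ∫⁻ x, k x y * F y ^ 2 ∂μ ∂ν := by
        rw [lintegral_lintegral_swap]
        exact (hk.mul ((hF.comp measurable_snd).pow_const 2)).aemeasurable
    _ = A * ∫⁻ y, (∫⁻ x, k x y ∂μ) * F y ^ 2 ∂ν := by
        congr 2; funext y
        exact lintegral_mul_const _ (hky y)
    _ ≤ A * ∫⁻ y, B * F y ^ 2 ∂ν := by
        gcongr with y; exact hB y
    _ = A * B * ∫⁻ y, F y ^ 2 ∂ν := by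
        rw [lintegral_const_mul _ (hF.pow_const 2), mul_assoc]

variable {n : ℕ}

/-- the Hilbert space -/
abbrev L2 (n : ℕ) := Lp ℂ 2 (volume : Measure (EE n))

/-- admissible kernels: measurable, bounded, boundedly supported -/
structure KK (K : EE n → EE n → ℂ) : Prop where
  meas : StronglyMeasurable (Function.uncurry K)
  bd : ∃ M : ℝ, 0 ≤ M ∧ ∀ x y, ‖K x y‖ ≤ M
  supp : ∃ R : ℝ, ∀ x y, K x y ≠ 0 → x ∈ Metric.closedBall (0 : EE n) R ∧ y ∈ Metric.closedBall (0 : EE n) R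

/-- Schur bound -/
def SchurB (K : EE n → EE n → ℂ) (D : ℝ≥0∞) : Prop :=
  (∀ x, ∫⁻ y, ‖K x y‖ₑ ≤ D) ∧ (∀ y, ∫⁻ x, ‖K x y‖ₑ ≤ D)

theorem lint_box_bound {f : EE n → ℂ} {M : ℝ} {s : Set (EE n)} (hs : MeasurableSet s)
    (hM : ∀ x, ‖f x‖ ≤ M) (h : ∀ x, f x ≠ 0 → x ∈ s) :
    ∫⁻ x, ‖f x‖ₑ ≤ ENNReal.ofReal M * volume s := by
  calc ∫⁻ x, ‖f x‖ₑ ≤ ∫⁻ x, s.indicator (fun _ => ENNReal.ofReal M) x := by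
        refine lintegral_mono fun x => ?_
        by_cases hx : x ∈ s
        · rw [Set.indicator_of_mem hx, ← ofReal_norm]
          exact ENNReal.ofReal_le_ofReal (hM x)
        · have : f x = 0 := by by_contra h'; exact hx (h x h')
          simp [this]
    _ = ENNReal.ofReal M * volume s := by rw [lintegral_indicator_const hs]

theorem KK.schurB {K : EE n → EE n → ℂ} (h : KK K) : ∃ D : ℝ, 0 ≤ D ∧ SchurB K (ENNReal.ofReal D) := by
  obtain ⟨M, hM0, hM⟩ := h.bd
  obtain ⟨R, hR⟩ := h.supp
  have hfin : volume (Metric.closedBall (0 : EE n) R) ≠ ∞ := measure_closedBall_lt_top.ne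
  refine ⟨M * volume.real (Metric.closedBall (0 : EE n) R), by positivity, ?_⟩
  have e : ENNReal.ofReal (M * volume.real (Metric.closedBall (0 : EE n) R)) =
      ENNReal.ofReal M * volume (Metric.closedBall (0 : EE n) R) := by
    rw [ENNReal.ofReal_mul hM0, ofReal_measureReal hfin]
  rw [e]
  exact ⟨fun x => lint_box_bound Metric.isClosed_closedBall.measurableSet (hM x) fun y hy => (hR x y hy).2,
    fun y => lint_box_bound Metric.isClosed_closedBall.measurableSet (fun x => hM x y) fun x hx => (hR x y hx).1⟩

/-- action of the kernel -/
def kfun (K : EE n → EE n → ℂ) (f : EE n → ℂ) (x : EE n) : ℂ := ∫ y, K x y * f y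

theorem KK.slice_meas {K : EE n → EE n → ℂ} (h : KK K) (x : EE n) : StronglyMeasurable (K x) :=
  h.meas.comp_measurable measurable_prodMk_left

theorem kfun_eLp {K : EE n → EE n → ℂ} (h : KK K) {f : EE n → ℂ} (hf : StronglyMeasurable f) {D : ℝ≥0∞}
    (hD : SchurB K D) : eLpNorm (kfun K f) 2 volume ≤ D * eLpNorm f 2 volume := by
  have h1 : eLpNorm (kfun K f) 2 volume ^ 2 ≤ (D * eLpNorm f 2 volume) ^ 2 := by
    rw [mul_pow, eLpNorm_sq, eLpNorm_sq]
    calc ∫⁻ x, ‖kfun K f x‖ₑ ^ 2 ≤ ∫⁻ x, (∫⁻ y, ‖K x y‖ₑ * ‖f y‖ₑ) ^ 2 := by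
          refine lintegral_mono fun x => ?_
          refine pow_le_pow_left' ?_ 2
          refine (enorm_integral_le_lintegral_enorm _).trans (le_of_eq ?_)
          simp only [enorm_mul]
      _ ≤ D * D * ∫⁻ y, ‖f y‖ₑ ^ 2 := schur (k := fun x y => ‖K x y‖ₑ) h.meas.measurable.enorm hf.measurable.enorm D D hD.1 hD.2
      _ = _ := by rw [sq]
  exact (ENNReal.pow_le_pow_left_iff (by norm_num)).1 h1

theorem kfun_meas {K : EE n → EE n → ℂ} (h : KK K) {f : EE n → ℂ} (hf : StronglyMeasurable f) :
    StronglyMeasurable (kfun K f) := by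
  have : StronglyMeasurable (Function.uncurry fun x y => K x y * f y) :=
    h.meas.mul (hf.comp_measurable measurable_snd)
  exact this.integral_prod_right

theorem kfun_memLp {K : EE n → EE n → ℂ} (h : KK K) (f : L2 n) : MemLp (kfun K f) 2 volume := by
  refine ⟨(kfun_meas h (Lp.stronglyMeasurable f)).aestronglyMeasurable, ?_⟩
  obtain ⟨D, hD0, hD⟩ := h.schurB
  exact (kfun_eLp h (Lp.stronglyMeasurable f) hD).trans_lt
    (ENNReal.mul_lt_top ENNReal.ofReal_lt_top (Lp.memLp f).2)

theorem KK.slice_memLp {K : EE n → EE n → ℂ} (h : KK K) (x : EE n) : MemLp (K x) 2 volume := by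
  obtain ⟨M, hM0, hM⟩ := h.bd
  obtain ⟨R, hR⟩ := h.supp
  have : IsFiniteMeasure (volume.restrict (Metric.closedBall (0 : EE n) R)) :=
    ⟨by rw [Measure.restrict_apply_univ]; exact measure_closedBall_lt_top⟩
  have h1 : MemLp (K x) 2 (volume.restrict (Metric.closedBall (0 : EE n) R)) :=
    MemLp.of_bound (h.slice_meas x).aestronglyMeasurable M (Filter.Eventually.of_forall (hM x))
  rw [← memLp_indicator_iff_restrict Metric.isClosed_closedBall.measurableSet] at h1
  rwa [Set.indicator_eq_self.2 fun y hy => (hR x y hy).2] at h1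

theorem kfun_integrable {K : EE n → EE n → ℂ} (h : KK K) {f : EE n → ℂ} (hf : MemLp f 2 volume) (x : EE n) :
    Integrable (fun y => K x y * f y) volume := (h.slice_memLp x).integrable_mul hf

/-- kernel operator on `L²` -/
def kop {K : EE n → EE n → ℂ} (h : KK K) : L2 n →L[ℂ] L2 n :=
  LinearMap.mkContinuous
    { toFun := fun f => (kfun_memLp h f).toLp
      map_add' := by
        intro f g
        rw [← MemLp.toLp_add, MemLp.toLp_eq_toLp_iff]
        refine Filter.Eventually.of_forall fun x => ?_
        simp only [kfun, Pi.add_apply]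
        rw [← integral_add (kfun_integrable h (Lp.memLp f) x) (kfun_integrable h (Lp.memLp g) x)]
        refine integral_congr_ae ?_
        filter_upwards [Lp.coeFn_add f g] with y hy
        rw [hy, Pi.add_apply, mul_add]
      map_smul' := by
        intro c f
        rw [RingHom.id_apply, ← MemLp.toLp_const_smul, MemLp.toLp_eq_toLp_iff]
        refine Filter.Eventually.of_forall fun x => ?_
        simp only [kfun, Pi.smul_apply, smul_eq_mul]
        rw [← integral_const_mul]
        refine integral_congr_ae ?_
        filter_upwards [Lp.coeFn_smul c f] with y hy
        rw [hy, Pi.smul_apply, smul_eq_mul]; ring }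
    (Classical.choose h.schurB) (by
      intro f
      have hs := Classical.choose_spec h.schurB
      simp only [LinearMap.coe_mk, AddHom.coe_mk, Lp.norm_toLp]
      rw [Lp.norm_def]
      have := kfun_eLp h (Lp.stronglyMeasurable f) hs.2
      have h2 := ENNReal.toReal_mono (ENNReal.mul_ne_top ENNReal.ofReal_ne_top (Lp.eLpNorm_ne_top f)) this
      rwa [ENNReal.toReal_mul, ENNReal.toReal_ofReal hs.1] at h2)

theorem kop_coe {K : EE n → EE n → ℂ} (h : KK K) (f : L2 n) : kop h f =ᵐ[volume] kfun K f :=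
  MemLp.coeFn_toLp (kfun_memLp h f)

theorem kop_norm {K : EE n → EE n → ℂ} (h : KK K) {D : ℝ} (hD0 : 0 ≤ D) (hD : SchurB K (ENNReal.ofReal D)) :
    ‖kop h‖ ≤ D := by
  refine ContinuousLinearMap.opNorm_le_bound _ hD0 fun f => ?_
  have h0 : kop h f = (kfun_memLp h f).toLp := rfl
  rw [h0, Lp.norm_toLp, Lp.norm_def]
  have := kfun_eLp h (Lp.stronglyMeasurable f) hD
  have h2 := ENNReal.toReal_mono (ENNReal.mul_ne_top ENNReal.ofReal_ne_top (Lp.eLpNorm_ne_top f)) this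
  rwa [ENNReal.toReal_mul, ENNReal.toReal_ofReal hD0] at h2

end Kop

section Kop2
variable {n : ℕ}

theorem tri_integrable {K : EE n → EE n → ℂ} (h : KK K) {f g : EE n → ℂ} (hf : MemLp f 2 volume)
    (hg : MemLp g 2 volume) :
    Integrable (fun p : EE n × EE n => g p.1 * (K p.1 p.2 * f p.2)) (volume.prod volume) := by
  obtain ⟨M, hM0, hM⟩ := h.bd
  obtain ⟨R, hR⟩ := h.supp
  have hfin : IsFiniteMeasure (volume.restrict (Metric.closedBall (0 : EE n) R)) :=
    ⟨by rw [Measure.restrict_apply_univ]; exact measure_closedBall_lt_top⟩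
  have hms : MeasurableSet (Metric.closedBall (0 : EE n) R) := Metric.isClosed_closedBall.measurableSet
  have hi : ∀ {f : EE n → ℂ}, MemLp f 2 volume → Integrable ((Metric.closedBall (0 : EE n) R).indicator f) volume := by
    intro f hf
    rw [integrable_indicator_iff hms]
    exact (hf.restrict _).integrable (by norm_num)
  have h1 := ((hi hg).mul_prod (hi hf)).bdd_mul (f := Function.uncurry K) (c := M)
    h.meas.aestronglyMeasurable (Filter.Eventually.of_forall fun p => hM _ _)
  refine h1.congr (Filter.Eventually.of_forall fun p => ?_)
  simp only [Function.uncurry]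
  by_cases hp : K p.1 p.2 = 0
  · rw [hp]; simp
  · rw [Set.indicator_of_mem (hR _ _ hp).1, Set.indicator_of_mem (hR _ _ hp).2]; ring

/-- the adjoint kernel -/
def kst (K : EE n → EE n → ℂ) : EE n → EE n → ℂ := fun x y => starRingEnd ℂ (K y x)

theorem KK.st {K : EE n → EE n → ℂ} (h : KK K) : KK (kst K) where
  meas := Complex.continuous_conj.comp_stronglyMeasurable (h.meas.comp_measurable measurable_swap)
  bd := by
    obtain ⟨M, hM0, hM⟩ := h.bd
    exact ⟨M, hM0, fun x y => by simpa [kst] using hM y x⟩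
  supp := by
    obtain ⟨R, hR⟩ := h.supp
    refine ⟨R, fun x y hxy => ?_⟩
    have : K y x ≠ 0 := fun h0 => hxy (by simp [kst, h0])
    exact ⟨(hR _ _ this).2, (hR _ _ this).1⟩

theorem kop_star {K : EE n → EE n → ℂ} (h : KK K) : star (kop h) = kop h.st := by
  rw [ContinuousLinearMap.star_eq_adjoint]
  symm
  rw [ContinuousLinearMap.eq_adjoint_iff]
  intro f g
  rw [L2.inner_def, L2.inner_def]
  have e1 : ∫ x, inner ℂ (kop h.st f x) (g x) = ∫ x, ∫ y, g x * (K y x * starRingEnd ℂ (f y)) := by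
    refine integral_congr_ae ?_
    filter_upwards [kop_coe h.st f] with x hx
    rw [hx, RCLike.inner_apply, kfun, ← integral_conj, ← integral_const_mul]
    congr 1; funext y
    simp [kst]
  have e2 : ∫ y, inner ℂ (f y) (kop h g y) = ∫ y, ∫ x, g x * (K y x * starRingEnd ℂ (f y)) := by
    refine integral_congr_ae ?_
    filter_upwards [kop_coe h g] with y hy
    rw [hy, RCLike.inner_apply, kfun, ← integral_mul_const]
    congr 1; funext x; ring
  rw [e1, e2]
  refine integral_integral_swap ?_
  have hfc : MemLp (fun y => starRingEnd ℂ (f y)) 2 volume := (Lp.memLp f).star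
  have := tri_integrable h (Lp.memLp g) hfc
  refine this.swap.congr (Filter.Eventually.of_forall fun p => ?_)
  simp only [Function.comp, Prod.swap, Function.uncurry]; ring

/-- composition of kernels -/
def kcomp (K L : EE n → EE n → ℂ) : EE n → EE n → ℂ := fun x z => ∫ y, K x y * L y z

theorem KK.comp {K L : EE n → EE n → ℂ} (hK : KK K) (hL : KK L) : KK (kcomp K L) where
  meas := by
    have : StronglyMeasurable (Function.uncurry fun (p : EE n × EE n) y => K p.1 y * L y p.2) := by
      refine (hK.meas.comp_measurable (g := fun q : (EE n × EE n) × EE n => (q.1.1, q.2)) (by fun_prop)).mul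
        (hL.meas.comp_measurable (g := fun q : (EE n × EE n) × EE n => (q.2, q.1.2)) (by fun_prop))
    exact this.integral_prod_right
  bd := by
    obtain ⟨M, hM0, hM⟩ := hK.bd
    obtain ⟨M', hM0', hM'⟩ := hL.bd
    obtain ⟨R, hR⟩ := hK.supp
    refine ⟨M * M' * volume.real (Metric.closedBall (0 : EE n) R), by positivity, fun x z => ?_⟩
    unfold kcomp
    rw [← setIntegral_eq_integral_of_forall_compl_eq_zero (s := Metric.closedBall (0 : EE n) R)]
    · refine norm_setIntegral_le_of_norm_le_const measure_closedBall_lt_top fun y _ => ?_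
      rw [norm_mul]
      exact mul_le_mul (hM _ _) (hM' _ _) (norm_nonneg _) hM0
    · intro y hy
      have : K x y = 0 := by by_contra h; exact hy (hR _ _ h).2
      rw [this, zero_mul]
  supp := by
    obtain ⟨R, hR⟩ := hK.supp
    obtain ⟨R', hR'⟩ := hL.supp
    refine ⟨max R R', fun x z h => ?_⟩
    have : ∃ y, K x y * L y z ≠ 0 := by
      by_contra h'
      push Not at h'
      exact h (by unfold kcomp; simp [h'])
    obtain ⟨y, hy⟩ := this
    exact ⟨Metric.closedBall_subset_closedBall (le_max_left _ _) (hR _ _ (left_ne_zero_of_mul hy)).1,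
      Metric.closedBall_subset_closedBall (le_max_right _ _) (hR' _ _ (right_ne_zero_of_mul hy)).2⟩

theorem kop_mul {K L : EE n → EE n → ℂ} (hK : KK K) (hL : KK L) : kop hK * kop hL = kop (hK.comp hL) := by
  refine ContinuousLinearMap.ext fun f => ?_
  refine Lp.ext ?_
  refine (kop_coe hK (kop hL f)).trans (Filter.EventuallyEq.trans ?_ (kop_coe (hK.comp hL) f).symm)
  refine Filter.Eventually.of_forall fun x => ?_
  calc kfun K (kop hL f) x = ∫ y, ∫ z, K x y * (L y z * f z) := by
        unfold kfun
        refine integral_congr_ae ?_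
        filter_upwards [kop_coe hL f] with y hy
        rw [hy, kfun, integral_const_mul]
    _ = ∫ z, ∫ y, K x y * (L y z * f z) := by
        refine integral_integral_swap ?_
        exact tri_integrable hL (Lp.memLp f) (hK.slice_memLp x)
    _ = kfun (kcomp K L) f x := by
        unfold kfun kcomp
        congr 1; funext z
        rw [← integral_mul_const]
        congr 1; funext y; ring

/-- a kernel supported in a product of two balls of radius `n` and bounded by `D` -/
theorem ball_schur {K : EE n → EE n → ℂ} {D : ℝ} (hD : 0 ≤ D) (p q : EE n) (hb : ∀ x y, ‖K x y‖ ≤ D)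
    (hs : ∀ x y, K x y ≠ 0 → x ∈ Metric.closedBall p n ∧ y ∈ Metric.closedBall q n) :
    SchurB K (ENNReal.ofReal (D * volume.real (Metric.closedBall (0 : EE n) n))) := by
  have hfin : volume (Metric.closedBall (0 : EE n) n) ≠ ∞ := measure_closedBall_lt_top.ne
  have e : ENNReal.ofReal (D * volume.real (Metric.closedBall (0 : EE n) n)) =
      ENNReal.ofReal D * volume (Metric.closedBall (0 : EE n) n) := by
    rw [ENNReal.ofReal_mul hD, ofReal_measureReal hfin]
  rw [e]
  constructor
  · intro x
    rw [← Measure.addHaar_closedBall_center volume q]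
    exact lint_box_bound Metric.isClosed_closedBall.measurableSet (hb x) fun y hy => (hs x y hy).2
  · intro y
    rw [← Measure.addHaar_closedBall_center volume p]
    exact lint_box_bound Metric.isClosed_closedBall.measurableSet (fun x => hb x y) fun x hx => (hs x y hx).1

end Kop2

section Blocks
variable {n : ℕ} {C₀ : ℝ} {Cph : (Fin n → ℕ) → ℝ}

/-- the exponent -/
def bexp (n : ℕ) : ℝ := 1 + 1 / (2 * ((n : ℝ) + 1))

/-- decaying weight -/
def rw1 (n : ℕ) (m : ℤ) : ℝ := (1 + |(m : ℝ)|) ^ (-bexp n)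

/-- nearest neighbour weight -/
def sw1 (m : ℤ) : ℝ := if |m| ≤ 1 then 1 else 0

theorem rw1_nonneg (m : ℤ) : 0 ≤ rw1 n m := by unfold rw1; positivity
theorem sw1_nonneg (m : ℤ) : 0 ≤ sw1 m := by unfold sw1; split_ifs <;> norm_num

theorem rw1_summable : Summable (rw1 n) := by
  have hb : 1 < bexp n := by unfold bexp; have : (0:ℝ) < 1 / (2 * ((n : ℝ) + 1)) := by positivity
                             linarith
  have h1 : Summable (fun m : ℕ => ((m : ℝ) + 1) ^ (-bexp n)) := by
    have := (Real.summable_nat_rpow (p := -bexp n)).2 (by linarith)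
    have h2 := (summable_nat_add_iff 1).2 this
    simpa using h2
  refine Summable.of_nat_of_neg ?_ ?_
  · refine h1.congr fun m => ?_
    simp [rw1, add_comm]
  · refine h1.congr fun m => ?_
    simp [rw1, add_comm]

theorem sw1_summable : Summable sw1 := by
  refine summable_of_hasFiniteSupport ?_
  refine (Set.finite_Icc (-1 : ℤ) 1).subset fun m hm => ?_
  by_contra h
  apply hm
  unfold sw1
  rw [if_neg]
  intro h'
  exact h (abs_le.1 h')

theorem box_sum_le {g : ℤ → ℝ} (h0 : ∀ m, 0 ≤ g m) (hs : Summable g) (N : ℕ) (j : Fin n → ℤ) :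
    ∑ j' ∈ boxN n N, ∏ i, g (j i - j' i) ≤ (∑' m, g m) ^ n := by
  unfold boxN
  rw [← Finset.prod_univ_sum (fun _ => boxI N) (fun i m => g (j i - m))]
  calc ∏ i, ∑ m ∈ boxI N, g (j i - m) ≤ ∏ _i : Fin n, ∑' m, g m := by
        refine Finset.prod_le_prod (fun i _ => Finset.sum_nonneg fun m _ => h0 _) fun i _ => ?_
        have e : ∑' m, g m = ∑' m, g (j i - m) := ((Equiv.subLeft (j i)).tsum_eq g).symm
        rw [e]
        exact Summable.sum_le_tsum _ (fun m _ => h0 _) ((Equiv.subLeft (j i)).summable_iff.2 hs)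
    _ = (∑' m, g m) ^ n := by simp

theorem weight_le (j j' : Fin n → ℤ) :
    ((1 + ‖latt j' - latt j‖) ^ (2 * n + 1))⁻¹ ≤ (∏ i, rw1 n (j i - j' i)) ^ 2 := by
  set t := 1 + ‖latt j' - latt j‖ with ht
  have ht1 : 1 ≤ t := by rw [ht]; linarith [norm_nonneg (latt j' - latt j)]
  have hb0 : 0 ≤ bexp n := by unfold bexp; positivity
  have h1 : ∀ i, t ^ (-bexp n) ≤ rw1 n (j i - j' i) := by
    intro i
    unfold rw1
    refine Real.rpow_le_rpow_of_nonpos (by positivity) ?_ (by linarith)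
    have := abs_coord_le (latt j' - latt j) i
    have e : (latt j' - latt j) i = -(((j i - j' i : ℤ)) : ℝ) := by
      simp [latt]
    rw [e, abs_neg] at this
    linarith
  have h2 : (t ^ (-bexp n)) ^ n ≤ ∏ i, rw1 n (j i - j' i) := by
    calc (t ^ (-bexp n)) ^ n = ∏ _i : Fin n, t ^ (-bexp n) := by simp
      _ ≤ _ := Finset.prod_le_prod (fun _ _ => by positivity) fun i _ => h1 i
  calc (t ^ (2 * n + 1))⁻¹ ≤ ((t ^ (-bexp n)) ^ n) ^ 2 := by
        have ht0 : 0 ≤ t := by linarith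
        have e1 : (t ^ (2 * n + 1))⁻¹ = t ^ (-((2 * n + 1 : ℕ) : ℝ)) := by
          rw [Real.rpow_neg ht0, Real.rpow_natCast]
        have e2 : ((t ^ (-bexp n)) ^ n) ^ 2 = t ^ (-bexp n * n * (2 : ℕ)) := by
          rw [Real.rpow_mul ht0, Real.rpow_mul ht0, Real.rpow_natCast, Real.rpow_natCast]
        rw [e1, e2]
        refine Real.rpow_le_rpow_of_exponent_le ht1 ?_
        unfold bexp
        push_cast
        have : (n : ℝ) * (1 / (2 * ((n : ℝ) + 1))) ≤ 1 / 2 := by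
          rw [mul_one_div, div_le_div_iff₀ (by positivity) (by norm_num)]
          linarith
        nlinarith
    _ ≤ _ := pow_le_pow_left₀ (by positivity) h2 2

theorem near_zero (k k' : Fin n → ℤ) (h : ∏ i, sw1 (k i - k' i) = 0) (ξ : EE n) :
    chi (ξ - latt k) * chi (ξ - latt k') = 0 := by
  rw [Finset.prod_eq_zero_iff] at h
  obtain ⟨i, _, hi⟩ := h
  have h1 : 2 ≤ |k i - k' i| := by
    unfold sw1 at hi
    split_ifs at hi with h'
    · norm_num at hi
    · omega
  have h2 : (2 : ℝ) ≤ |(k i : ℝ) - k' i| := by exact_mod_cast h1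
  by_cases h3 : 1 ≤ |ξ i - k i|
  · rw [chi_zero' (v := ξ - latt k) (i := i) h3, zero_mul]
  · rw [chi_zero' (v := ξ - latt k') (i := i), mul_zero]
    have : |(k i : ℝ) - k' i| ≤ |ξ i - k i| + |ξ i - k' i| := by
      have := abs_sub_abs_le_abs_sub (ξ i - k i) (ξ i - k' i)
      rw [show (k i : ℝ) - k' i = (ξ i - k' i) - (ξ i - k i) by ring]
      exact (abs_sub _ _).trans (by rw [add_comm])
    push Not at h3
    show 1 ≤ |ξ i - k' i|
    linarith

theorem sw_prod (k k' : Fin n → ℤ) : ∏ i, sw1 (k i - k' i) = 0 ∨ ∏ i, sw1 (k i - k' i) = 1 := by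
  by_cases h : ∀ i, |k i - k' i| ≤ 1
  · right
    exact Finset.prod_eq_one fun i _ => by unfold sw1; rw [if_pos (h i)]
  · left
    push Not at h
    obtain ⟨i, hi⟩ := h
    exact Finset.prod_eq_zero (Finset.mem_univ i) (by unfold sw1; rw [if_neg (by omega)])

/-- master kernel estimate -/
theorem master (n : ℕ) (C₀ : ℝ) (hC₀ : 0 < C₀) (Cph : (Fin n → ℕ) → ℝ) :
    ∃ C : ℝ, 0 ≤ C ∧ ∀ (φ : Ph n C₀ Cph) (j j' k k' : Fin n → ℤ) (y y' : EE n),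
      ‖((chi (y - latt j) * chi (y' - latt j') : ℝ) : ℂ) *
        ∫ ξ, Complex.exp (Complex.I * ((φ.1 (y', ξ) - φ.1 (y, ξ) : ℝ) : ℂ)) *
        ((chi (ξ - latt k) * chi (ξ - latt k') : ℝ) : ℂ)‖ ≤
      C * ((∏ i, rw1 n (j i - j' i)) * (∏ i, sw1 (k i - k' i))) ^ 2 := by
  obtain ⟨C, hC0, hC⟩ := osc_decay n C₀ hC₀ Cph
  refine ⟨(1 + 2 * n) ^ (2 * n + 1) * C, by positivity, fun φ j j' k k' y y' => ?_⟩
  rcases sw_prod k k' with h | h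
  · simp [near_zero k k' h]
    positivity
  rw [h, mul_one]
  by_cases hy : y ∈ Metric.closedBall (latt j) n
  swap
  · rw [chi_trans_zero hy]; simp; positivity
  by_cases hy' : y' ∈ Metric.closedBall (latt j') n
  swap
  · rw [chi_trans_zero hy']; simp; positivity
  rw [mem_closedBall_iff_norm] at hy hy'
  have h1 : 1 + ‖latt j' - latt j‖ ≤ (1 + 2 * n) * (1 + ‖y' - y‖) := by
    have e : latt j' - latt j = (y' - y) - (y' - latt j') + (y - latt j) := by abel
    have : ‖latt j' - latt j‖ ≤ ‖y' - y‖ + n + n := by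
      rw [e]
      exact (norm_add_le _ _).trans (add_le_add ((norm_sub_le _ _).trans (add_le_add le_rfl hy')) hy)
    have h0 : 0 ≤ (n : ℝ) * ‖y' - y‖ := by positivity
    nlinarith
  have h2 := hC φ y y' (latt k) (latt k')
  set I₀ := ∫ ξ, Complex.exp (Complex.I * ((φ.1 (y', ξ) - φ.1 (y, ξ) : ℝ) : ℂ)) *
        ((chi (ξ - latt k) * chi (ξ - latt k') : ℝ) : ℂ) with hI
  have h3 : (1 + ‖latt j' - latt j‖) ^ (2 * n + 1) * ‖I₀‖ ≤ (1 + 2 * n) ^ (2 * n + 1) * C := by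
    calc (1 + ‖latt j' - latt j‖) ^ (2 * n + 1) * ‖I₀‖
        ≤ ((1 + 2 * n) * (1 + ‖y' - y‖)) ^ (2 * n + 1) * ‖I₀‖ := by gcongr
      _ = (1 + 2 * n) ^ (2 * n + 1) * ((1 + ‖y' - y‖) ^ (2 * n + 1) * ‖I₀‖) := by rw [mul_pow]; ring
      _ ≤ _ := by gcongr
  have h4 : ‖I₀‖ ≤ (1 + 2 * n) ^ (2 * n + 1) * C * ((1 + ‖latt j' - latt j‖) ^ (2 * n + 1))⁻¹ := by
    rw [← div_eq_mul_inv, le_div_iff₀ (by positivity)]; linarith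
  calc _ = |chi (y - latt j) * chi (y' - latt j')| * ‖I₀‖ := by
        rw [norm_mul, Complex.norm_real, Real.norm_eq_abs]
    _ ≤ 1 * ‖I₀‖ := by
        gcongr
        rw [abs_mul]
        exact mul_le_one₀ (chi_abs _) (abs_nonneg _) (chi_abs _)
    _ ≤ (1 + 2 * n) ^ (2 * n + 1) * C * (∏ i, rw1 n (j i - j' i)) ^ 2 := by
        rw [one_mul]
        exact h4.trans (mul_le_mul_of_nonneg_left (weight_le j j') (by positivity))

/-- block kernels -/
def Tb (φ : EE n × EE n → ℝ) (j k : EE n) : EE n → EE n → ℂ := fun ξ y =>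
  Complex.exp (Complex.I * ((φ (y, ξ) : ℝ) : ℂ)) * ((chi (ξ - k) * chi (y - j) : ℝ) : ℂ)

theorem Tb_KK {φ : EE n × EE n → ℝ} (hφ : ContDiff ℝ (⊤ : ℕ∞) φ) (j k : EE n) : KK (Tb φ j k) where
  meas := by
    have h1 : Continuous (chi : EE n → ℝ) := chi_smooth.continuous
    have h2 := hφ.continuous
    have : Continuous (Function.uncurry (Tb φ j k)) := by
      unfold Tb Function.uncurry
      fun_prop
    exact this.stronglyMeasurable
  bd := ⟨1, zero_le_one, fun x y => by
    unfold Tb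
    rw [norm_mul, osc_norm, one_mul, Complex.norm_real, Real.norm_eq_abs, abs_mul]
    exact mul_le_one₀ (chi_abs _) (abs_nonneg _) (chi_abs _)⟩
  supp := by
    refine ⟨n + ‖j‖ + ‖k‖, fun x y h => ?_⟩
    have hx : x ∈ Metric.closedBall k n := by
      by_contra h'; exact h (by unfold Tb; rw [chi_trans_zero h']; simp)
    have hy : y ∈ Metric.closedBall j n := by
      by_contra h'; exact h (by unfold Tb; rw [chi_trans_zero h']; simp)
    rw [mem_closedBall_iff_norm] at hx hy
    rw [mem_closedBall_zero_iff, mem_closedBall_zero_iff]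
    have e1 : x = (x - k) + k := by abel
    have e2 : y = (y - j) + j := by abel
    have := norm_nonneg j
    have := norm_nonneg k
    constructor
    · rw [e1]; linarith [norm_add_le (x - k) k]
    · rw [e2]; linarith [norm_add_le (y - j) j]

theorem conj_osc (s t : ℝ) : starRingEnd ℂ (Complex.exp (Complex.I * (s : ℂ))) * Complex.exp (Complex.I * (t : ℂ)) =
    Complex.exp (Complex.I * ((t - s : ℝ) : ℂ)) := by
  rw [← Complex.exp_conj, ← Complex.exp_add]
  congr 1
  simp
  ring

theorem comp1 (φ : EE n × EE n → ℝ) (j j' k k' y y' : EE n) :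
    kcomp (kst (Tb φ j k)) (Tb φ j' k') y y' = ((chi (y - j) * chi (y' - j') : ℝ) : ℂ) *
        ∫ ξ, Complex.exp (Complex.I * ((φ (y', ξ) - φ (y, ξ) : ℝ) : ℂ)) *
        ((chi (ξ - k) * chi (ξ - k') : ℝ) : ℂ) := by
  unfold kcomp kst
  rw [← integral_const_mul]
  congr 1; funext ξ
  unfold Tb
  rw [← conj_osc, map_mul, Complex.conj_ofReal]
  push_cast; ring

theorem comp2 (φ : EE n × EE n → ℝ) (j j' k k' ξ ξ' : EE n) :
    kcomp (Tb φ j k) (kst (Tb φ j' k')) ξ ξ' = ((chi (ξ' - k') * chi (ξ - k) : ℝ) : ℂ) *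
        ∫ y, Complex.exp (Complex.I * (((fun z => φ (swapL n z)) (ξ, y) - (fun z => φ (swapL n z)) (ξ', y) : ℝ) : ℂ)) *
        ((chi (y - j') * chi (y - j) : ℝ) : ℂ) := by
  unfold kcomp kst
  rw [← integral_const_mul]
  congr 1; funext y
  unfold Tb
  rw [← conj_osc, map_mul, Complex.conj_ofReal]
  have e1 : swapL n (ξ, y) = (y, ξ) := rfl
  have e2 : swapL n (ξ', y) = (y, ξ') := rfl
  simp only [e1, e2]
  push_cast; ring

/-- uniform bound for finite sums of blocks -/
theorem blocks_bound (n : ℕ) (C₀ : ℝ) (hC₀ : 0 < C₀) (Cph : (Fin n → ℕ) → ℝ) :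
    ∃ M : ℝ, 0 ≤ M ∧ ∀ (φ : Ph n C₀ Cph) (N : ℕ),
      ‖∑ q ∈ boxN n N ×ˢ boxN n N, kop (Tb_KK φ.2.sm (latt q.1) (latt q.2))‖ ≤ M := by
  obtain ⟨C, hC0, hC⟩ := master n C₀ hC₀ Cph
  set V := volume.real (Metric.closedBall (0 : EE n) n) with hV
  have hV0 : 0 ≤ V := measureReal_nonneg
  set Zr := (∑' m, rw1 n m) ^ n
  set Zs := (∑' m, sw1 m) ^ n
  have hZr : 0 ≤ Zr := pow_nonneg (tsum_nonneg fun m => rw1_nonneg m) n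
  have hZs : 0 ≤ Zs := pow_nonneg (tsum_nonneg fun m => sw1_nonneg m) n
  have hr0 : ∀ j j' : Fin n → ℤ, 0 ≤ ∏ i, rw1 n (j i - j' i) := fun j j' => Finset.prod_nonneg fun i _ => rw1_nonneg _
  have hs0 : ∀ j j' : Fin n → ℤ, 0 ≤ ∏ i, sw1 (j i - j' i) := fun j j' => Finset.prod_nonneg fun i _ => sw1_nonneg _
  have hrs : ∀ j j' : Fin n → ℤ, ∏ i, rw1 n (j i - j' i) = ∏ i, rw1 n (j' i - j i) := fun j j' =>
    Finset.prod_congr rfl fun i _ => by unfold rw1; push_cast; rw [abs_sub_comm]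
  have hss : ∀ j j' : Fin n → ℤ, ∏ i, sw1 (j i - j' i) = ∏ i, sw1 (j' i - j i) := fun j j' =>
    Finset.prod_congr rfl fun i _ => by unfold sw1; rw [abs_sub_comm]
  refine ⟨√(C * V) * (Zr * Zs), by positivity, fun φ N => ?_⟩
  have hsum : ∀ (p : (Fin n → ℤ) × (Fin n → ℤ)) (F : (Fin n → ℤ) × (Fin n → ℤ) → ℝ)
      (g h : ℤ → ℝ) (_ : ∀ m, 0 ≤ g m) (_ : ∀ m, 0 ≤ h m) (_ : Summable g) (_ : Summable h)
      (_ : (∑' m, g m) ^ n * (∑' m, h m) ^ n = Zr * Zs)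
      (_ : ∀ q, F q ≤ C * ((∏ i, g (p.1 i - q.1 i)) * ∏ i, h (p.2 i - q.2 i)) ^ 2 * V),
      ∑ q ∈ boxN n N ×ˢ boxN n N, √(F q) ≤ √(C * V) * (Zr * Zs) := by
    intro p F g h hg hh hgs hhs hz hF
    have hg0 : ∀ q : (Fin n → ℤ) × (Fin n → ℤ), 0 ≤ ∏ i, g (p.1 i - q.1 i) := fun q => Finset.prod_nonneg fun i _ => hg _
    have hh0 : ∀ q : (Fin n → ℤ) × (Fin n → ℤ), 0 ≤ ∏ i, h (p.2 i - q.2 i) := fun q => Finset.prod_nonneg fun i _ => hh _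
    calc ∑ q ∈ boxN n N ×ˢ boxN n N, √(F q) ≤ ∑ q ∈ boxN n N ×ˢ boxN n N,
          √(C * V) * ((∏ i, g (p.1 i - q.1 i)) * ∏ i, h (p.2 i - q.2 i)) := by
          refine Finset.sum_le_sum fun q _ => ?_
          refine (Real.sqrt_le_sqrt (hF q)).trans (le_of_eq ?_)
          rw [show C * ((∏ i, g (p.1 i - q.1 i)) * ∏ i, h (p.2 i - q.2 i)) ^ 2 * V =
            C * V * ((∏ i, g (p.1 i - q.1 i)) * ∏ i, h (p.2 i - q.2 i)) ^ 2 by ring,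
            Real.sqrt_mul (by positivity), Real.sqrt_sq (mul_nonneg (hg0 q) (hh0 q))]
      _ = √(C * V) * ((∑ a ∈ boxN n N, ∏ i, g (p.1 i - a i)) * ∑ b ∈ boxN n N, ∏ i, h (p.2 i - b i)) := by
          rw [← Finset.mul_sum, Finset.sum_product, Finset.sum_mul_sum]
      _ ≤ √(C * V) * (Zr * Zs) := by
          rw [← hz]
          refine mul_le_mul_of_nonneg_left ?_ (Real.sqrt_nonneg _)
          exact mul_le_mul (box_sum_le hg hgs N p.1) (box_sum_le hh hhs N p.2)
            (Finset.sum_nonneg fun b _ => Finset.prod_nonneg fun i _ => hh _)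
            (pow_nonneg (tsum_nonneg hg) n)
  refine cotlar_stein _ _ _ (fun p _ => ?_) (fun p _ => ?_) (by positivity)
  · refine hsum p _ (rw1 n) sw1 rw1_nonneg sw1_nonneg rw1_summable sw1_summable rfl fun q => ?_
    rw [kop_star, kop_mul]
    refine kop_norm _ (by positivity) (ball_schur (by positivity) (latt p.1) (latt q.1) (fun y y' => ?_) (fun y y' h => ?_))
    · rw [comp1]; exact hC φ _ _ _ _ y y'
    · rw [comp1] at h
      constructor
      · by_contra h'; exact h (by rw [chi_trans_zero h']; simp)
      · by_contra h'; exact h (by rw [chi_trans_zero h']; simp)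
  · refine hsum p _ sw1 (rw1 n) sw1_nonneg rw1_nonneg sw1_summable rw1_summable (mul_comm _ _) fun q => ?_
    rw [kop_star, kop_mul]
    refine kop_norm _ (by positivity) (ball_schur (by positivity) (latt p.2) (latt q.2) (fun y y' => ?_) (fun y y' h => ?_))
    · rw [comp2, mul_comm (∏ i, sw1 _), hrs, hss]
      exact hC ⟨_, φ.2.swap⟩ _ _ _ _ y' y
    · rw [comp2] at h
      constructor
      · by_contra h'; exact h (by rw [chi_trans_zero h']; simp)
      · by_contra h'; exact h (by rw [chi_trans_zero h']; simp)

end Blocks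

section Claim1
variable {n : ℕ} {C₀ : ℝ} {Cph : (Fin n → ℕ) → ℝ}

theorem sum_kop_coe {ι : Type*} (s : Finset ι) (K : ι → EE n → EE n → ℂ) (h : ∀ i, KK (K i)) (f : L2 n) :
    ((∑ i ∈ s, kop (h i)) f : EE n → ℂ) =ᵐ[volume] fun x => ∑ i ∈ s, kfun (K i) f x := by
  classical
  induction s using Finset.induction_on with
  | empty =>
    simp only [Finset.sum_empty]
    exact Lp.coeFn_zero _ _ _
  | insert i s hi ih =>
    rw [Finset.sum_insert hi, ContinuousLinearMap.add_apply]
    filter_upwards [Lp.coeFn_add (kop (h i) f) ((∑ i ∈ s, kop (h i)) f), ih, kop_coe (h i) f] with x h1 h2 h3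
    rw [h1, Pi.add_apply, h2, h3, Finset.sum_insert hi]

theorem XN_tendsto (v : EE n) : Filter.Tendsto (fun N => XN N v) Filter.atTop (nhds 1) := by
  refine tendsto_const_nhds.congr' ?_
  obtain ⟨M, hM⟩ := exists_nat_ge ‖v‖
  filter_upwards [Filter.eventually_ge_atTop M] with N hN
  exact (XN_one N v (hM.trans (by exact_mod_cast hN))).symm

theorem sum_Tb (φ : EE n × EE n → ℝ) (N : ℕ) (ξ y : EE n) :
    ∑ q ∈ boxN n N ×ˢ boxN n N, Tb φ (latt q.1) (latt q.2) ξ y =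
      Complex.exp (Complex.I * ((φ (y, ξ) : ℝ) : ℂ)) * ((XN N ξ * XN N y : ℝ) : ℂ) := by
  unfold Tb XN
  rw [← Finset.mul_sum, Finset.sum_product, Finset.sum_mul_sum, Finset.sum_comm]
  push_cast
  rfl

theorem claim1 (n : ℕ) (C₀ : ℝ) (hC₀ : 0 < C₀) (Cph : (Fin n → ℕ) → ℝ) :
    ∃ M : ℝ, 0 ≤ M ∧ ∀ (φ : Ph n C₀ Cph) (u : EE n → ℂ), MemLp u 2 volume → Integrable u volume →
      eLpNorm (fun ξ => ∫ y, Complex.exp (Complex.I * ((φ.1 (y, ξ) : ℝ) : ℂ)) * u y) 2 volume ≤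
        ENNReal.ofReal M * eLpNorm u 2 volume := by
  obtain ⟨M, hM0, hM⟩ := blocks_bound n C₀ hC₀ Cph
  refine ⟨M, hM0, fun φ u hu hu1 => ?_⟩
  set f : L2 n := hu.toLp with hf
  have hfu : f =ᵐ[volume] u := hu.coeFn_toLp
  let F : ℕ → EE n → ℂ := fun N ξ => ∑ q ∈ boxN n N ×ˢ boxN n N, kfun (Tb φ.1 (latt q.1) (latt q.2)) f ξ
  have hF : ∀ N ξ, F N ξ = ∫ y, Complex.exp (Complex.I * ((φ.1 (y, ξ) : ℝ) : ℂ)) * ((XN N ξ * XN N y : ℝ) : ℂ) * u y := by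
    intro N ξ
    show ∑ q ∈ boxN n N ×ˢ boxN n N, kfun (Tb φ.1 (latt q.1) (latt q.2)) f ξ = _
    unfold kfun
    rw [← integral_finsetSum]
    · refine integral_congr_ae ?_
      filter_upwards [hfu] with y hy
      rw [← Finset.sum_mul, sum_Tb, hy]
    · intro q _
      exact kfun_integrable (Tb_KK φ.2.sm _ _) (Lp.memLp f) ξ
  have hFe : ∀ N, eLpNorm (F N) 2 volume ≤ ENNReal.ofReal M * eLpNorm u 2 volume := by
    intro N
    have h1 := sum_kop_coe (boxN n N ×ˢ boxN n N) (fun q => Tb φ.1 (latt q.1) (latt q.2))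
      (fun q => Tb_KK φ.2.sm _ _) f
    rw [← eLpNorm_congr_ae h1, ← eLpNorm_congr_ae hfu]
    have h2 := ContinuousLinearMap.le_of_opNorm_le _ (hM φ N) f
    rw [Lp.norm_def, Lp.norm_def] at h2
    rw [← ENNReal.ofReal_toReal (Lp.eLpNorm_ne_top f), ← ENNReal.ofReal_mul hM0]
    rw [← ENNReal.ofReal_toReal (Lp.eLpNorm_ne_top ((∑ q ∈ boxN n N ×ˢ boxN n N, kop (Tb_KK φ.2.sm (latt q.1) (latt q.2))) f))]
    exact ENNReal.ofReal_le_ofReal h2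
  have hFm : ∀ N, AEStronglyMeasurable (F N) volume := by
    intro N
    have h1 := sum_kop_coe (boxN n N ×ˢ boxN n N) (fun q => Tb φ.1 (latt q.1) (latt q.2))
      (fun q => Tb_KK φ.2.sm _ _) f
    exact (Lp.aestronglyMeasurable _).congr h1
  have hlim : ∀ ξ, Filter.Tendsto (fun N => F N ξ) Filter.atTop
      (nhds (∫ y, Complex.exp (Complex.I * ((φ.1 (y, ξ) : ℝ) : ℂ)) * u y)) := by
    intro ξ
    simp only [hF]
    have hφc := φ.2.sm.continuous
    refine tendsto_integral_of_dominated_convergence (fun y => ‖u y‖) (fun N => ?_) hu1.norm (fun N => ?_) ?_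
    · refine AEStronglyMeasurable.mul (Continuous.aestronglyMeasurable ?_) hu1.1
      have h1 : Continuous (chi : EE n → ℝ) := chi_smooth.continuous
      have : Continuous (XN (n := n) N) := by unfold XN; fun_prop
      fun_prop
    · refine Filter.Eventually.of_forall fun y => ?_
      rw [norm_mul, norm_mul, osc_norm, one_mul, Complex.norm_real, Real.norm_eq_abs, abs_mul]
      refine mul_le_of_le_one_left (norm_nonneg _) ?_
      exact mul_le_one₀ (XN_abs _ _) (abs_nonneg _) (XN_abs _ _)
    · refine Filter.Eventually.of_forall fun y => ?_
      have h1 : Filter.Tendsto (fun N => ((XN N ξ * XN N y : ℝ) : ℂ)) Filter.atTop (nhds ((1 * 1 : ℝ) : ℂ)) :=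
        (Complex.continuous_ofReal.tendsto _).comp ((XN_tendsto ξ).mul (XN_tendsto y))
      have h2 := (h1.const_mul (Complex.exp (Complex.I * ((φ.1 (y, ξ) : ℝ) : ℂ)))).mul_const (u y)
      simpa using h2
  refine (Lp.eLpNorm_lim_le_liminf_eLpNorm hFm _ (Filter.Eventually.of_forall hlim)).trans ?_
  refine (Filter.liminf_le_liminf (v := fun _ => ENNReal.ofReal M * eLpNorm u 2 volume)
    (Filter.Eventually.of_forall hFe)).trans ?_
  rw [Filter.liminf_const]

end Claim1

section Bessel
variable {n : ℕ}

/-- side length of the cubes -/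
def rr : ℝ := √(2 * π)
theorem rr_pos : 0 < rr := Real.sqrt_pos.2 (by positivity)
theorem rr_sq : rr * rr = 2 * π := Real.mul_self_sqrt (by positivity)

/-- half open cube -/
def QQ (n : ℕ) : Set (EE n) := {s | ∀ i, s i ∈ Set.Ico 0 rr}

theorem coord_meas (i : Fin n) : Measurable (fun s : EE n => s i) :=
  (by fun_prop : Continuous (fun s : EE n => s i)).measurable

theorem QQ_meas : MeasurableSet (QQ n) := by
  have : QQ n = ⋂ i, (fun s : EE n => s i) ⁻¹' Set.Ico 0 rr := by ext s; simp [QQ]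
  rw [this]
  exact MeasurableSet.iInter fun i => coord_meas i measurableSet_Ico

theorem QQ_bdd : Bornology.IsBounded (QQ n) := by
  refine (Metric.isBounded_closedBall (x := (0 : EE n)) (r := n * rr)).subset fun s hs => ?_
  rw [mem_closedBall_zero_iff]
  refine (norm_le_sum_abs s).trans ?_
  calc ∑ i, |s i| ≤ ∑ _i : Fin n, rr := Finset.sum_le_sum fun i _ => by
        rw [abs_of_nonneg (hs i).1]; exact (hs i).2.le
    _ = n * rr := by simp

/-- measure on the cube -/
def muQ (n : ℕ) : Measure (EE n) := volume.restrict (QQ n)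

instance : IsFiniteMeasure (muQ n) := ⟨by
  unfold muQ; rw [Measure.restrict_apply_univ]; exact QQ_bdd.measure_lt_top⟩

/-- exponentials -/
def ee (k : Fin n → ℤ) (s : EE n) : ℂ := Complex.exp (Complex.I * ((rr * ⟪latt k, s⟫ : ℝ) : ℂ))

theorem ee_cont (k : Fin n → ℤ) : Continuous (ee k) := by unfold ee; fun_prop

theorem ee_norm (k : Fin n → ℤ) (s : EE n) : ‖ee k s‖ = 1 := osc_norm _

theorem inner_latt (k : Fin n → ℤ) (s : EE n) : ⟪latt k, s⟫ = ∑ i, (k i : ℝ) * s i := by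
  rw [PiLp.inner_apply]
  refine Finset.sum_congr rfl fun i _ => ?_
  simp [latt, mul_comm]

theorem int1 (m : ℤ) (hm : m ≠ 0) :
    ∫ x in Set.Ico 0 rr, Complex.exp (Complex.I * ((rr * (m * x) : ℝ) : ℂ)) = 0 := by
  rw [integral_Ico_eq_integral_Ioc, ← intervalIntegral.integral_of_le rr_pos.le]
  have hc : Complex.I * (rr : ℂ) * m ≠ 0 := by
    have : (rr : ℂ) ≠ 0 := by exact_mod_cast rr_pos.ne'
    have : (m : ℂ) ≠ 0 := by exact_mod_cast hm
    simp [*]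
  have := integral_exp_mul_complex (a := 0) (b := rr) hc
  have e : ∀ x : ℝ, Complex.I * ((rr * (m * x) : ℝ) : ℂ) = Complex.I * (rr : ℂ) * m * x := by
    intro x; push_cast; ring
  simp only [e]
  rw [this]
  have h2 : Complex.I * (rr : ℂ) * m * rr = m * (2 * π * Complex.I) := by
    have : (rr : ℂ) * rr = 2 * π := by exact_mod_cast rr_sq
    linear_combination Complex.I * m * this
  rw [h2, Complex.exp_int_mul_two_pi_mul_I]
  simp

theorem int_ee (m : Fin n → ℤ) : ∫ s, ee m s ∂(muQ n) = if m = 0 then ((rr ^ n : ℝ) : ℂ) else 0 := by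
  unfold muQ
  rw [← integral_indicator QQ_meas]
  let g : Fin n → ℝ → ℂ := fun i => (Set.Ico 0 rr).indicator
    (fun x : ℝ => Complex.exp (Complex.I * ((rr * (m i * x) : ℝ) : ℂ)))
  have h1 : ∀ s : EE n, (QQ n).indicator (ee m) s = ∏ i, g i (s i) := by
    intro s
    by_cases hs : s ∈ QQ n
    · rw [Set.indicator_of_mem hs]
      have : ∀ i, g i (s i) = Complex.exp (Complex.I * ((rr * (m i * s i) : ℝ) : ℂ)) := fun i =>
        Set.indicator_of_mem (hs i) _
      simp only [this]
      rw [← Complex.exp_sum]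
      unfold ee
      rw [inner_latt]
      congr 1
      push_cast
      rw [Finset.mul_sum, Finset.mul_sum]
    · rw [Set.indicator_of_notMem hs]
      simp only [QQ, Set.mem_ofPred_eq, not_forall] at hs
      obtain ⟨i, hi⟩ := hs
      exact (Finset.prod_eq_zero (Finset.mem_univ i) (Set.indicator_of_notMem hi _)).symm
  simp only [h1]
  rw [← (PiLp.volume_preserving_toLp (Fin n)).integral_comp
    (MeasurableEquiv.toLp 2 (Fin n → ℝ)).measurableEmbedding]
  have h2 : ∀ x : Fin n → ℝ, ∏ i, g i ((WithLp.toLp 2 x : EE n) i) = ∏ i, g i (x i) := fun x => rfl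
  simp only [h2]
  rw [integral_fintype_prod_volume_eq_prod]
  have h3 : ∀ i, ∫ x, g i x = if m i = 0 then (rr : ℂ) else 0 := by
    intro i
    show ∫ x, (Set.Ico 0 rr).indicator _ x = _
    rw [integral_indicator measurableSet_Ico]
    split_ifs with hm
    · simp [hm, rr_pos.le]
    · exact int1 _ hm
  simp only [h3]
  split_ifs with hm
  · simp [hm]
  · obtain ⟨i, hi⟩ := Function.ne_iff.1 hm
    exact Finset.prod_eq_zero (Finset.mem_univ i) (if_neg hi)

theorem ee_memLp (k : Fin n → ℤ) : MemLp (fun s => starRingEnd ℂ (ee k s)) 2 (muQ n) :=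
  MemLp.of_bound (Complex.continuous_conj.comp (ee_cont k)).aestronglyMeasurable 1
    (Filter.Eventually.of_forall fun s => by rw [RCLike.norm_conj, ee_norm])

theorem ee_mul_conj (k l : Fin n → ℤ) (s : EE n) : ee k s * starRingEnd ℂ (ee l s) = ee (k - l) s := by
  rw [mul_comm]
  unfold ee
  rw [conj_osc]
  congr 3
  simp only [inner_latt, Pi.sub_apply]
  rw [← mul_sub, ← Finset.sum_sub_distrib]
  congr 1
  refine Finset.sum_congr rfl fun i _ => ?_
  push_cast; ring

theorem bessel {v : EE n → ℂ} (hv : MemLp v 2 (muQ n)) (S : Finset (Fin n → ℤ)) :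
    ∑ k ∈ S, ‖∫ s, v s * ee k s ∂(muQ n)‖ ^ 2 ≤ rr ^ n * ∫ s, ‖v s‖ ^ 2 ∂(muQ n) := by
  set c : ℝ := (√(rr ^ n))⁻¹ with hc
  have hr : 0 < rr ^ n := pow_pos rr_pos n
  have hcc : c * c = (rr ^ n)⁻¹ := by
    rw [hc, ← mul_inv, Real.mul_self_sqrt hr.le]
  let E : (Fin n → ℤ) → Lp ℂ 2 (muQ n) := fun k => (c : ℂ) • (ee_memLp k).toLp
  have hE0 : ∀ k, (ee_memLp k).toLp =ᵐ[muQ n] fun s => starRingEnd ℂ (ee k s) := fun k => MemLp.coeFn_toLp _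
  have hortho : Orthonormal ℂ E := by
    rw [orthonormal_iff_ite]
    intro k l
    show inner ℂ ((c : ℂ) • (ee_memLp k).toLp) ((c : ℂ) • (ee_memLp l).toLp) = _
    rw [inner_smul_left, inner_smul_right, Complex.conj_ofReal, ← mul_assoc, ← Complex.ofReal_mul, hcc, L2.inner_def]
    have : ∫ a, inner ℂ ((ee_memLp k).toLp _ a) ((ee_memLp l).toLp _ a) ∂(muQ n) = ∫ a, ee (k - l) a ∂(muQ n) := by
      refine integral_congr_ae ?_
      filter_upwards [hE0 k, hE0 l] with a h1 h2
      rw [h1, h2, RCLike.inner_apply, ← ee_mul_conj]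
      simp [mul_comm]
    rw [this, int_ee]
    by_cases h : k = l
    · simp [h, sub_eq_zero]
      exact inv_mul_cancel₀ (by exact_mod_cast hr.ne')
    · simp [h, sub_eq_zero]
  have hb := hortho.sum_inner_products_le (s := S) (x := hv.toLp)
  have h1 : ∀ k, ‖inner ℂ (E k) hv.toLp‖ ^ 2 = (rr ^ n)⁻¹ * ‖∫ s, v s * ee k s ∂(muQ n)‖ ^ 2 := by
    intro k
    show ‖inner ℂ ((c : ℂ) • (ee_memLp k).toLp) hv.toLp‖ ^ 2 = _
    rw [inner_smul_left, Complex.conj_ofReal, norm_mul, mul_pow, Complex.norm_real, Real.norm_eq_abs, sq_abs, pow_two c, hcc, L2.inner_def]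
    congr 3
    refine integral_congr_ae ?_
    filter_upwards [hE0 k, hv.coeFn_toLp] with a h1 h2
    rw [h1, h2, RCLike.inner_apply]
    simp
  have h2 : ‖hv.toLp‖ ^ 2 = ∫ s, ‖v s‖ ^ 2 ∂(muQ n) := by
    have h3 : ((‖hv.toLp‖ ^ 2 : ℝ) : ℂ) = ((∫ s, ‖v s‖ ^ 2 ∂(muQ n) : ℝ) : ℂ) := by
      rw [Complex.ofReal_pow]
      have h4 := inner_self_eq_norm_sq_to_K (𝕜 := ℂ) hv.toLp
      rw [L2.inner_def] at h4
      refine h4.symm.trans ?_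
      rw [← integral_complex_ofReal]
      refine integral_congr_ae ?_
      filter_upwards [hv.coeFn_toLp] with a ha
      rw [ha, inner_self_eq_norm_sq_to_K]
      simp
    exact_mod_cast h3
  simp only [h1, h2, ← Finset.mul_sum] at hb
  rw [inv_mul_le_iff₀ hr] at hb
  exact hb

end Bessel

section SBsec
variable {n : ℕ}

/-- mixed derivative predicate -/
def SB {W : Type*} [NormedAddCommGroup W] [NormedSpace ℝ W] (P : (W → ℂ) → Prop) : List W → (W → ℂ) → Prop
  | [], g => P g
  | v :: L, g => SB P L g ∧ SB P L (dLine v g)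

variable {W : Type*} [NormedAddCommGroup W] [NormedSpace ℝ W]

theorem SB_append (P : (W → ℂ) → Prop) (L₁ L₂ : List W) (g : W → ℂ) :
    SB P (L₁ ++ L₂) g ↔ SB (SB P L₂) L₁ g := by
  induction L₁ generalizing g with
  | nil => rfl
  | cons v L ih => exact and_congr (ih g) (ih _)

theorem SB_of_lderiv (P : (W → ℂ) → Prop) (dirs : Fin n → W) (l : List (Fin n)) (hl : l.Nodup) {g : W → ℂ}
    (hg : ContDiff ℝ (⊤ : ℕ∞) g) (h : ∀ α : Fin n → ℕ, (∀ i, α i ≤ 1) → P (lderiv dirs α l g)) :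
    SB P (l.map dirs) g := by
  induction l generalizing g with
  | nil => exact h 0 (fun i => by simp)
  | cons i l ih =>
    rw [List.nodup_cons] at hl
    have key : ∀ (m : ℕ) (hm : m ≤ 1) (α : Fin n → ℕ), (∀ i, α i ≤ 1) →
        P ((dLine (dirs i))^[m] (lderiv dirs α l g)) := by
      intro m hm α hα
      have h1 := h (Function.update α i m) (fun j => by
        by_cases hj : j = i
        · subst hj; simpa using hm
        · rw [Function.update_of_ne hj]; exact hα j)
      have h2 : lderiv dirs (Function.update α i m) (i :: l) g =
          (dLine (dirs i))^[(Function.update α i m) i] (lderiv dirs (Function.update α i m) l g) := rfl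
      rw [h2, Function.update_self, lderiv_congr dirs (Function.update α i m) α g l] at h1
      · exact h1
      · intro j hj
        rw [Function.update_of_ne]
        rintro rfl
        exact hl.1 hj
    refine ⟨ih hl.2 hg fun α hα => key 0 (by norm_num) α hα, ih hl.2 (dLine_smooth hg) fun α hα => ?_⟩
    rw [lderiv_comm dirs α _ hg]
    exact key 1 le_rfl α hα

/-- bounded on a set -/
def bdd (Q : Set W) (M : ℝ) (g : W → ℂ) : Prop := ∀ z ∈ Q, ‖g z‖ ≤ M

theorem SB_mono {Q Q' : Set W} {M M' : ℝ} (hQ : Q' ⊆ Q) (hM : M ≤ M') (L : List W) {g : W → ℂ}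
    (h : SB (bdd Q M) L g) : SB (bdd Q' M') L g := by
  induction L generalizing g with
  | nil => exact fun z hz => (h z (hQ hz)).trans hM
  | cons v L ih => exact ⟨ih h.1, ih h.2⟩

theorem SB_add {Q : Set W} {M N : ℝ} (L : List W) {f g : W → ℂ}
    (hf : ContDiff ℝ (⊤ : ℕ∞) f) (hg : ContDiff ℝ (⊤ : ℕ∞) g)
    (h1 : SB (bdd Q M) L f) (h2 : SB (bdd Q N) L g) : SB (bdd Q (M + N)) L (fun z => f z + g z) := by
  induction L generalizing f g with
  | nil => exact fun z hz => (norm_add_le _ _).trans (add_le_add (h1 z hz) (h2 z hz))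
  | cons v L ih =>
    refine ⟨ih hf hg h1.1 h2.1, ?_⟩
    rw [dLine_add v (smooth_diff hf) (smooth_diff hg)]
    exact ih (dLine_smooth hf) (dLine_smooth hg) h1.2 h2.2

theorem SB_mul {Q : Set W} {M N : ℝ} (hM : 0 ≤ M) (hN : 0 ≤ N) (L : List W) {f g : W → ℂ}
    (hf : ContDiff ℝ (⊤ : ℕ∞) f) (hg : ContDiff ℝ (⊤ : ℕ∞) g)
    (h1 : SB (bdd Q M) L f) (h2 : SB (bdd Q N) L g) :
    SB (bdd Q (2 ^ L.length * (M * N))) L (fun z => f z * g z) := by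
  induction L generalizing f g with
  | nil =>
    intro z hz
    simp only [List.length_nil, pow_zero, one_mul, norm_mul]
    exact mul_le_mul (h1 z hz) (h2 z hz) (norm_nonneg _) hM
  | cons v L ih =>
    have e : (2 : ℝ) ^ (v :: L).length * (M * N) = 2 ^ L.length * (M * N) + 2 ^ L.length * (M * N) := by
      rw [List.length_cons, pow_succ]; ring
    rw [e]
    constructor
    · refine SB_mono le_rfl ?_ L (ih hf hg h1.1 h2.1)
      have : 0 ≤ 2 ^ L.length * (M * N) := by positivity
      linarith
    · rw [dLine_mul v (smooth_diff hf) (smooth_diff hg)]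
      exact SB_add L ((dLine_smooth hf).mul hg) (hf.mul (dLine_smooth hg))
        (ih (dLine_smooth hf) hg h1.2 h2.1) (ih hf (dLine_smooth hg) h1.1 h2.2)

theorem SB_exists {Q : Set W} (hQ : IsCompact Q) (L : List W) {g : W → ℂ} (hg : ContDiff ℝ (⊤ : ℕ∞) g) :
    ∃ M : ℝ, 0 ≤ M ∧ SB (bdd Q M) L g := by
  induction L generalizing g with
  | nil =>
    obtain ⟨M, hM⟩ := hQ.exists_bound_of_continuousOn hg.continuous.continuousOn
    exact ⟨max M 0, le_max_right _ _, fun z hz => (hM z hz).trans (le_max_left _ _)⟩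
  | cons v L ih =>
    obtain ⟨M, hM0, hM⟩ := ih hg
    obtain ⟨N, hN0, hN⟩ := ih (dLine_smooth (v := v) hg)
    exact ⟨max M N, le_max_of_le_left hM0, SB_mono le_rfl (le_max_left _ _) L hM,
      SB_mono le_rfl (le_max_right _ _) L hN⟩

theorem dLine_affine (T : W →L[ℝ] W) (p v : W) {g : W → ℂ} (hg : Differentiable ℝ g) :
    dLine v (fun z => g (T z + p)) = fun z => dLine (T v) g (T z + p) := by
  have h1 := dLine_comp_clm T v (g := fun z => g (z + p)) (hg.comp (by fun_prop))
  rw [h1]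
  funext z
  unfold dLine
  rw [fderiv_comp_add_right]

theorem SB_affine {Q Q' : Set W} {M : ℝ} (L : List W) (T : W →L[ℝ] W) (p : W) (hT : ∀ v ∈ L, T v = v)
    (hQ : ∀ z ∈ Q', T z + p ∈ Q) {g : W → ℂ} (hg : ContDiff ℝ (⊤ : ℕ∞) g)
    (h : SB (bdd Q M) L g) : SB (bdd Q' M) L (fun z => g (T z + p)) := by
  induction L generalizing g with
  | nil => exact fun z hz => h _ (hQ z hz)
  | cons v L ih =>
    have hT' : ∀ v ∈ L, T v = v := fun w hw => hT w (List.mem_cons_of_mem _ hw)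
    refine ⟨ih hT' hg h.1, ?_⟩
    rw [dLine_affine T p v (smooth_diff hg), hT v List.mem_cons_self]
    exact ih hT' (dLine_smooth hg) h.2

/-- all coordinates -/
def crd (c : Fin n ⊕ Fin n) : (EE n × EE n) →L[ℝ] ℝ :=
  Sum.elim (fun i => (EuclideanSpace.proj i : EE n →L[ℝ] ℝ).comp (ContinuousLinearMap.fst ℝ (EE n) (EE n)))
    (fun i => (EuclideanSpace.proj i : EE n →L[ℝ] ℝ).comp (ContinuousLinearMap.snd ℝ (EE n) (EE n))) c

theorem crd_inl (i : Fin n) (z : EE n × EE n) : crd (Sum.inl i) z = z.1 i := rfl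
theorem crd_inr (i : Fin n) (z : EE n × EE n) : crd (Sum.inr i) z = z.2 i := rfl

/-- coordinate directions -/
def dirC (c : Fin n ⊕ Fin n) : EE n × EE n := Sum.elim dX dY c

theorem crd_dirC (c c' : Fin n ⊕ Fin n) : crd c (dirC c') = if c = c' then 1 else 0 := by
  rcases c with i | i <;> rcases c' with j | j <;>
    simp [crd_inl, crd_inr, dirC, dX, dY]

/-- closed double cube -/
def Qz (n : ℕ) : Set (EE n × EE n) := {z | ∀ c, crd c z ∈ Set.Icc 0 rr}

theorem Qz_compact : IsCompact (Qz n) := by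
  refine Metric.isCompact_of_isClosed_isBounded ?_ ?_
  · have : Qz n = ⋂ c, (crd c) ⁻¹' Set.Icc 0 rr := by ext; simp [Qz]
    rw [this]
    exact isClosed_iInter fun c => isClosed_Icc.preimage (crd c).continuous
  · have h : ∀ v : EE n, (∀ i, v i ∈ Set.Icc 0 rr) → v ∈ Metric.closedBall (0 : EE n) (n * rr) := by
      intro v hv
      rw [mem_closedBall_zero_iff]
      refine (norm_le_sum_abs v).trans ?_
      calc ∑ i, |v i| ≤ ∑ _i : Fin n, rr := Finset.sum_le_sum fun i _ => by
            rw [abs_of_nonneg (hv i).1]; exact (hv i).2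
        _ = n * rr := by simp
    refine ((Metric.isBounded_closedBall (x := (0 : EE n)) (r := n * rr)).prod
      (Metric.isBounded_closedBall (x := (0 : EE n)) (r := n * rr))).subset fun z hz => ?_
    exact ⟨h _ fun i => hz (Sum.inl i), h _ fun i => hz (Sum.inr i)⟩

/-- projection killing coordinate `c` -/
def Tc (c : Fin n ⊕ Fin n) : (EE n × EE n) →L[ℝ] (EE n × EE n) :=
  ContinuousLinearMap.id ℝ _ - (crd c).smulRight (dirC c)

theorem Tc_apply (c : Fin n ⊕ Fin n) (z : EE n × EE n) : Tc c z = z - crd c z • dirC c := rfl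

theorem crd_fr (c c' : Fin n ⊕ Fin n) (ρ : ℝ) (z : EE n × EE n) :
    crd c' (Tc c z + ρ • dirC c) = if c' = c then ρ else crd c' z := by
  rw [Tc_apply, map_add, map_sub, map_smul, map_smul, crd_dirC]
  split_ifs with h
  · subst h; simp
  · simp

theorem ext_crd {z z' : EE n × EE n} (h : ∀ c, crd c z = crd c z') : z = z' := by
  refine Prod.ext ?_ ?_
  · ext i; exact h (Sum.inl i)
  · ext i; exact h (Sum.inr i)

theorem fr_mem (c : Fin n ⊕ Fin n) {ρ : ℝ} (hρ : ρ ∈ Set.Icc 0 rr) {z : EE n × EE n} (hz : z ∈ Qz n) :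
    Tc c z + ρ • dirC c ∈ Qz n := by
  intro c'
  rw [crd_fr]
  split_ifs
  · exact hρ
  · exact hz c'

theorem Tc_dir {c c' : Fin n ⊕ Fin n} (h : c ≠ c') : Tc c (dirC c') = dirC c' := by
  rw [Tc_apply, crd_dirC, if_neg h]; simp

theorem ftc_fr (c : Fin n ⊕ Fin n) {g : EE n × EE n → ℂ} (hg : ContDiff ℝ (⊤ : ℕ∞) g) {z : EE n × EE n}
    (hz : z ∈ Qz n) :
    g z = g (Tc c z + (0 : ℝ) • dirC c) +
      ∫ ρ in Set.Ioc 0 rr, (if ρ ≤ crd c z then dLine (dirC c) g (Tc c z + ρ • dirC c) else 0) := by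
  have hd : ∀ ρ : ℝ, HasDerivAt (fun ρ : ℝ => g (Tc c z + ρ • dirC c)) (dLine (dirC c) g (Tc c z + ρ • dirC c)) ρ := by
    intro ρ
    have h1 : HasDerivAt (fun ρ : ℝ => Tc c z + ρ • dirC c) (dirC c) ρ := by
      have := ((hasDerivAt_id ρ).smul_const (dirC c)).const_add (Tc c z)
      simpa using this
    exact ((smooth_diff hg) _).hasFDerivAt.comp_hasDerivAt ρ h1
  have hcont : Continuous (fun ρ : ℝ => dLine (dirC c) g (Tc c z + ρ • dirC c)) := by
    have := (dLine_smooth (v := dirC c) hg).continuous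
    fun_prop
  have h2 := intervalIntegral.integral_eq_sub_of_hasDerivAt (a := 0) (b := crd c z) (fun ρ _ => hd ρ)
    (hcont.intervalIntegrable _ _)
  have e : Tc c z + crd c z • dirC c = z := by rw [Tc_apply]; abel
  rw [e] at h2
  have h3 : ∫ ρ in Set.Ioc 0 rr, (if ρ ≤ crd c z then dLine (dirC c) g (Tc c z + ρ • dirC c) else 0) =
      ∫ ρ in (0 : ℝ)..crd c z, dLine (dirC c) g (Tc c z + ρ • dirC c) := by
    rw [intervalIntegral.integral_of_le (hz c).1]
    have h4 : Set.Ioc 0 (crd c z) = Set.Ioc 0 rr ∩ Set.Iic (crd c z) := by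
      rw [Set.Ioc_inter_Iic, min_eq_right (hz c).2]
    rw [h4, ← setIntegral_indicator measurableSet_Iic]
    rfl
  rw [h3, h2]
  ring

end SBsec

section Bilin
variable {n : ℕ}

/-- measure on the double cube -/
def muz (n : ℕ) : Measure (EE n × EE n) := (muQ n).prod (muQ n)

instance : IsFiniteMeasure (muz n) := by unfold muz; infer_instance

theorem muz_ae : ∀ᵐ z ∂(muz n), z ∈ Qz n := by
  have h : muz n = (volume.prod volume).restrict (QQ n ×ˢ QQ n) := by
    unfold muz muQ; rw [Measure.prod_restrict]
  rw [h]
  filter_upwards [ae_restrict_mem (QQ_meas.prod QQ_meas)] with z hz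
  intro c
  rcases c with i | i
  · exact ⟨(hz.1 i).1, (hz.1 i).2.le⟩
  · exact ⟨(hz.2 i).1, (hz.2 i).2.le⟩

/-- bounded measurable families -/
def BM (v : (Fin n → ℤ) → EE n → ℂ) : Prop := (∀ j, Measurable (v j)) ∧ ∃ M : ℝ, ∀ j s, ‖v j s‖ ≤ M

/-- norm of a family -/
def nv (J : Finset (Fin n → ℤ)) (v : (Fin n → ℤ) → EE n → ℂ) : ℝ :=
  √(∑ j ∈ J, ∫ s, ‖v j s‖ ^ 2 ∂(muQ n))

/-- the weight -/
def FF (v w : (Fin n → ℤ) → EE n → ℂ) (j k : Fin n → ℤ) (z : EE n × EE n) : ℂ :=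
  (v j z.1 * ee k z.1) * (w k z.2 * ee j z.2)

/-- the bilinear form -/
def BB (J K : Finset (Fin n → ℤ)) (A : (Fin n → ℤ) → (Fin n → ℤ) → EE n × EE n → ℂ)
    (v w : (Fin n → ℤ) → EE n → ℂ) : ℂ :=
  ∑ j ∈ J, ∑ k ∈ K, ∫ z, FF v w j k z * A j k z ∂(muz n)

/-- the bilinear estimate -/
def PP (J K : Finset (Fin n → ℤ)) (A : (Fin n → ℤ) → (Fin n → ℤ) → EE n × EE n → ℂ) (M : ℝ) : Prop :=
  ∀ v w, BM v → BM w → ‖BB J K A v w‖ ≤ M * (nv J v * nv K w)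

theorem BM.memLp {v : (Fin n → ℤ) → EE n → ℂ} (h : BM v) (j : Fin n → ℤ) : MemLp (v j) 2 (muQ n) := by
  obtain ⟨M, hM⟩ := h.2
  exact MemLp.of_bound (h.1 j).aestronglyMeasurable M (Filter.Eventually.of_forall (hM j))

theorem FF_meas {v w : (Fin n → ℤ) → EE n → ℂ} (hv : BM v) (hw : BM w) (j k : Fin n → ℤ) :
    Measurable (FF v w j k) := by
  have h1 := hv.1 j
  have h2 := hw.1 k
  have h3 := (ee_cont j).measurable
  have h4 := (ee_cont k).measurable
  unfold FF
  fun_prop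

theorem FF_bdd {v w : (Fin n → ℤ) → EE n → ℂ} (hv : BM v) (hw : BM w) :
    ∃ M : ℝ, 0 ≤ M ∧ ∀ j k z, ‖FF v w j k z‖ ≤ M := by
  obtain ⟨M, hM⟩ := hv.2
  obtain ⟨N, hN⟩ := hw.2
  have hM0 : 0 ≤ M := (norm_nonneg _).trans (hM 0 0)
  have hN0 : 0 ≤ N := (norm_nonneg _).trans (hN 0 0)
  refine ⟨M * N, by positivity, fun j k z => ?_⟩
  unfold FF
  rw [norm_mul, norm_mul, norm_mul, ee_norm, ee_norm, mul_one, mul_one]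
  exact mul_le_mul (hM _ _) (hN _ _) (norm_nonneg _) hM0

theorem PP_const (J K : Finset (Fin n → ℤ)) (A : (Fin n → ℤ) → (Fin n → ℤ) → EE n × EE n → ℂ) {M : ℝ}
    (hA : ∀ j k z z', A j k z = A j k z') (hM : ∀ j k, ‖A j k 0‖ ≤ M) : PP J K A (rr ^ n * M) := by
  intro v w hv hw
  have hM0 : 0 ≤ M := (norm_nonneg _).trans (hM 0 0)
  set V : (Fin n → ℤ) → (Fin n → ℤ) → ℂ := fun j k => ∫ s, v j s * ee k s ∂(muQ n)
  set Wt : (Fin n → ℤ) → (Fin n → ℤ) → ℂ := fun j k => ∫ s, w k s * ee j s ∂(muQ n)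
  have h1 : ∀ j k, ∫ z, FF v w j k z * A j k z ∂(muz n) = V j k * Wt j k * A j k 0 := by
    intro j k
    have : ∀ z, FF v w j k z * A j k z = FF v w j k z * A j k 0 := fun z => by rw [hA j k z 0]
    simp only [this]
    rw [integral_mul_const]
    congr 1
    exact integral_prod_mul (fun s => v j s * ee k s) (fun s => w k s * ee j s)
  unfold BB
  simp only [h1]
  have h2 : ∑ j ∈ J, ∑ k ∈ K, ‖V j k‖ ^ 2 ≤ rr ^ n * ∑ j ∈ J, ∫ s, ‖v j s‖ ^ 2 ∂(muQ n) := by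
    rw [Finset.mul_sum]
    exact Finset.sum_le_sum fun j _ => bessel (hv.memLp j) K
  have h3 : ∑ j ∈ J, ∑ k ∈ K, ‖Wt j k‖ ^ 2 ≤ rr ^ n * ∑ k ∈ K, ∫ s, ‖w k s‖ ^ 2 ∂(muQ n) := by
    rw [Finset.sum_comm, Finset.mul_sum]
    exact Finset.sum_le_sum fun k _ => bessel (hw.memLp k) J
  have hr : 0 ≤ rr ^ n := pow_nonneg rr_pos.le n
  calc ‖∑ j ∈ J, ∑ k ∈ K, V j k * Wt j k * A j k 0‖ ≤ ∑ j ∈ J, ∑ k ∈ K, (‖V j k‖ * ‖Wt j k‖) * M := by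
        refine (norm_sum_le _ _).trans (Finset.sum_le_sum fun j _ => (norm_sum_le _ _).trans (Finset.sum_le_sum fun k _ => ?_))
        rw [norm_mul, norm_mul]
        exact mul_le_mul_of_nonneg_left (hM j k) (by positivity)
    _ = M * ∑ q ∈ J ×ˢ K, ‖V q.1 q.2‖ * ‖Wt q.1 q.2‖ := by
        rw [Finset.sum_product, Finset.mul_sum]
        refine Finset.sum_congr rfl fun j _ => ?_
        rw [← Finset.sum_mul, mul_comm]
    _ ≤ M * (√(∑ q ∈ J ×ˢ K, ‖V q.1 q.2‖ ^ 2) * √(∑ q ∈ J ×ˢ K, ‖Wt q.1 q.2‖ ^ 2)) :=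
        mul_le_mul_of_nonneg_left (Real.sum_mul_le_sqrt_mul_sqrt _ _ _) hM0
    _ ≤ M * (√(rr ^ n * ∑ j ∈ J, ∫ s, ‖v j s‖ ^ 2 ∂(muQ n)) * √(rr ^ n * ∑ k ∈ K, ∫ s, ‖w k s‖ ^ 2 ∂(muQ n))) := by
        rw [Finset.sum_product, Finset.sum_product]
        gcongr
    _ = rr ^ n * M * (nv J v * nv K w) := by
        rw [Real.sqrt_mul hr, Real.sqrt_mul hr]
        unfold nv
        have := Real.mul_self_sqrt hr
        linear_combination (M * √(∑ j ∈ J, ∫ s, ‖v j s‖ ^ 2 ∂(muQ n)) * √(∑ k ∈ K, ∫ s, ‖w k s‖ ^ 2 ∂(muQ n))) * this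

/-- cut off on the left -/
def mv (c : Fin n ⊕ Fin n) (ρ : ℝ) (v : (Fin n → ℤ) → EE n → ℂ) : (Fin n → ℤ) → EE n → ℂ :=
  Sum.elim (fun i j s => if ρ ≤ s i then v j s else 0) (fun _ => v) c

/-- cut off on the right -/
def mw (c : Fin n ⊕ Fin n) (ρ : ℝ) (v : (Fin n → ℤ) → EE n → ℂ) : (Fin n → ℤ) → EE n → ℂ :=
  Sum.elim (fun _ => v) (fun i j s => if ρ ≤ s i then v j s else 0) c

theorem cut_BM (i : Fin n) (ρ : ℝ) {v : (Fin n → ℤ) → EE n → ℂ} (hv : BM v) :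
    BM (fun j s => if ρ ≤ s i then v j s else 0) := by
  refine ⟨fun j => Measurable.ite (measurableSet_le measurable_const (coord_meas i)) (hv.1 j) measurable_const, ?_⟩
  obtain ⟨M, hM⟩ := hv.2
  refine ⟨M, fun j s => ?_⟩
  dsimp only
  split_ifs
  · exact hM j s
  · rw [norm_zero]; exact (norm_nonneg _).trans (hM j s)

theorem BM.sq_int {v : (Fin n → ℤ) → EE n → ℂ} (h : BM v) (j : Fin n → ℤ) :
    Integrable (fun s => ‖v j s‖ ^ 2) (muQ n) := (h.memLp j).integrable_norm_pow (by norm_num)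

theorem cut_nv (J : Finset (Fin n → ℤ)) (i : Fin n) (ρ : ℝ) {v : (Fin n → ℤ) → EE n → ℂ} (hv : BM v) :
    nv J (fun j s => if ρ ≤ s i then v j s else 0) ≤ nv J v := by
  unfold nv
  refine Real.sqrt_le_sqrt (Finset.sum_le_sum fun j _ => ?_)
  refine integral_mono ((cut_BM i ρ hv).sq_int j) (hv.sq_int j) fun s => ?_
  dsimp only
  split_ifs
  · exact le_rfl
  · rw [norm_zero, zero_pow (by norm_num)]; positivity

theorem mv_BM (c : Fin n ⊕ Fin n) (ρ : ℝ) {v : (Fin n → ℤ) → EE n → ℂ} (hv : BM v) : BM (mv c ρ v) := by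
  rcases c with i | i
  · exact cut_BM i ρ hv
  · exact hv

theorem mw_BM (c : Fin n ⊕ Fin n) (ρ : ℝ) {v : (Fin n → ℤ) → EE n → ℂ} (hv : BM v) : BM (mw c ρ v) := by
  rcases c with i | i
  · exact hv
  · exact cut_BM i ρ hv

theorem mv_nv (J : Finset (Fin n → ℤ)) (c : Fin n ⊕ Fin n) (ρ : ℝ) {v : (Fin n → ℤ) → EE n → ℂ} (hv : BM v) :
    nv J (mv c ρ v) ≤ nv J v := by
  rcases c with i | i
  · exact cut_nv J i ρ hv
  · exact le_rfl

theorem mw_nv (J : Finset (Fin n → ℤ)) (c : Fin n ⊕ Fin n) (ρ : ℝ) {v : (Fin n → ℤ) → EE n → ℂ} (hv : BM v) :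
    nv J (mw c ρ v) ≤ nv J v := by
  rcases c with i | i
  · exact le_rfl
  · exact cut_nv J i ρ hv

theorem FF_cut (c : Fin n ⊕ Fin n) (ρ : ℝ) (v w : (Fin n → ℤ) → EE n → ℂ) (j k : Fin n → ℤ) (z : EE n × EE n) (X : ℂ) :
    FF (mv c ρ v) (mw c ρ w) j k z * X = FF v w j k z * (if ρ ≤ crd c z then X else 0) := by
  rcases c with i | i
  · show ((if ρ ≤ z.1 i then v j z.1 else 0) * ee k z.1) * (w k z.2 * ee j z.2) * X =
      FF v w j k z * (if ρ ≤ z.1 i then X else 0)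
    unfold FF
    split_ifs <;> simp
  · show (v j z.1 * ee k z.1) * ((if ρ ≤ z.2 i then w k z.2 else 0) * ee j z.2) * X =
      FF v w j k z * (if ρ ≤ z.2 i then X else 0)
    unfold FF
    split_ifs <;> simp

theorem PP_step (J K : Finset (Fin n → ℤ)) (c : Fin n ⊕ Fin n) (A : (Fin n → ℤ) → (Fin n → ℤ) → EE n × EE n → ℂ) {M : ℝ}
    (hM : 0 ≤ M) (hA : ∀ j k, ContDiff ℝ (⊤ : ℕ∞) (A j k))
    (h0 : PP J K (fun j k z => A j k (Tc c z + (0 : ℝ) • dirC c)) M)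
    (h1 : ∀ ρ ∈ Set.Ioc 0 rr, PP J K (fun j k z => dLine (dirC c) (A j k) (Tc c z + ρ • dirC c)) M) :
    PP J K A ((1 + rr) * M) := by
  intro v w hv hw
  set D : (Fin n → ℤ) → (Fin n → ℤ) → ℝ → EE n × EE n → ℂ := fun j k ρ z =>
    dLine (dirC c) (A j k) (Tc c z + ρ • dirC c) with hD
  have hDc : ∀ j k, Continuous (fun q : (EE n × EE n) × ℝ => D j k q.2 q.1) := by
    intro j k
    have := (dLine_smooth (v := dirC c) (hA j k)).continuous
    simp only [hD]
    fun_prop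
  have hInt0 : ∀ j k, Integrable (fun q : (EE n × EE n) × ℝ => FF v w j k q.1 * (if q.2 ≤ crd c q.1 then D j k q.2 q.1 else 0))
      ((muz n).prod (volume.restrict (Set.Ioc 0 rr))) := by
    intro j k
    obtain ⟨M1, hM10, hM1⟩ := FF_bdd hv hw
    obtain ⟨M2, hM2⟩ := (Qz_compact (n := n)).exists_bound_of_continuousOn
      (dLine_smooth (v := dirC c) (hA j k)).continuous.continuousOn
    have hM20 : 0 ≤ M2 := (norm_nonneg _).trans (hM2 0 (fun c => by simp [rr_pos.le]))
    have hmeas : Measurable (fun q : (EE n × EE n) × ℝ => FF v w j k q.1 * (if q.2 ≤ crd c q.1 then D j k q.2 q.1 else 0)) := by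
      refine ((FF_meas hv hw j k).comp measurable_fst).mul ?_
      exact Measurable.ite (measurableSet_le measurable_snd ((crd c).continuous.measurable.comp measurable_fst))
        (hDc j k).measurable measurable_const
    refine Integrable.of_bound hmeas.aestronglyMeasurable (M1 * M2) ?_
    have ha : ∀ᵐ q ∂((muz n).prod (volume.restrict (Set.Ioc 0 rr))), q.1 ∈ Qz n :=
      Measure.quasiMeasurePreserving_fst.ae muz_ae
    have hb : ∀ᵐ q ∂((muz n).prod (volume.restrict (Set.Ioc 0 rr))), q.2 ∈ Set.Ioc 0 rr :=
      Measure.quasiMeasurePreserving_snd.ae (ae_restrict_mem measurableSet_Ioc)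
    filter_upwards [ha, hb] with q hq1 hq2
    rw [norm_mul]
    refine mul_le_mul (hM1 _ _ _) ?_ (norm_nonneg _) hM10
    split_ifs
    · exact hM2 _ (fr_mem c ⟨hq2.1.le, hq2.2⟩ hq1)
    · rw [norm_zero]; exact hM20
  have hFint : ∀ j k, Integrable (fun z => FF v w j k z * A j k (Tc c z + (0 : ℝ) • dirC c)) (muz n) := by
    intro j k
    obtain ⟨M1, hM10, hM1⟩ := FF_bdd hv hw
    obtain ⟨M2, hM2⟩ := (Qz_compact (n := n)).exists_bound_of_continuousOn (hA j k).continuous.continuousOn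
    have hc := (hA j k).continuous
    have hc2 : Continuous (fun z => A j k (Tc c z + (0 : ℝ) • dirC c)) := by fun_prop
    refine Integrable.of_bound ((FF_meas hv hw j k).mul hc2.measurable).aestronglyMeasurable (M1 * M2) ?_
    filter_upwards [muz_ae] with z hz
    rw [norm_mul]
    exact mul_le_mul (hM1 _ _ _) (hM2 _ (fr_mem c ⟨le_rfl, rr_pos.le⟩ hz)) (norm_nonneg _) hM10
  have hjk : ∀ j k, ∫ z, FF v w j k z * A j k z ∂(muz n) =
      ∫ z, FF v w j k z * A j k (Tc c z + (0 : ℝ) • dirC c) ∂(muz n) +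
      ∫ ρ in Set.Ioc 0 rr, ∫ z, FF (mv c ρ v) (mw c ρ w) j k z * D j k ρ z ∂(muz n) := by
    intro j k
    have e1 : ∫ z, FF v w j k z * A j k z ∂(muz n) = ∫ z, (FF v w j k z * A j k (Tc c z + (0 : ℝ) • dirC c) +
        ∫ ρ in Set.Ioc 0 rr, FF v w j k z * (if ρ ≤ crd c z then D j k ρ z else 0)) ∂(muz n) := by
      refine integral_congr_ae ?_
      filter_upwards [muz_ae] with z hz
      rw [integral_const_mul, ← mul_add]
      congr 1
      exact ftc_fr c (hA j k) hz
    rw [e1, integral_add (hFint j k) (hInt0 j k).integral_prod_left]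
    congr 1
    simp only [FF_cut]
    exact integral_integral_swap (hInt0 j k)
  have hBB : BB J K A v w = BB J K (fun j k z => A j k (Tc c z + (0 : ℝ) • dirC c)) v w +
      ∫ ρ in Set.Ioc 0 rr, BB J K (fun j k z => D j k ρ z) (mv c ρ v) (mw c ρ w) := by
    have hi : ∀ j k, Integrable (fun ρ => ∫ z, FF (mv c ρ v) (mw c ρ w) j k z * D j k ρ z ∂(muz n))
        (volume.restrict (Set.Ioc 0 rr)) := by
      intro j k
      simp only [FF_cut]
      exact (hInt0 j k).integral_prod_right
    unfold BB
    rw [integral_finsetSum _ (fun j _ => integrable_finsetSum _ fun k _ => hi j k), ← Finset.sum_add_distrib]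
    refine Finset.sum_congr rfl fun j _ => ?_
    rw [integral_finsetSum _ (fun k _ => hi j k), ← Finset.sum_add_distrib]
    exact Finset.sum_congr rfl fun k _ => hjk j k
  have hn1 : 0 ≤ nv J v := Real.sqrt_nonneg _
  have hn2 : 0 ≤ nv K w := Real.sqrt_nonneg _
  have hlast : ‖∫ ρ in Set.Ioc 0 rr, BB J K (fun j k z => D j k ρ z) (mv c ρ v) (mw c ρ w)‖ ≤
      M * (nv J v * nv K w) * rr := by
    have := norm_setIntegral_le_of_norm_le_const (μ := volume) (s := Set.Ioc 0 rr)
      (f := fun ρ => BB J K (fun j k z => D j k ρ z) (mv c ρ v) (mw c ρ w)) (C := M * (nv J v * nv K w))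
      (by simp) (fun ρ hρ => by
        refine (h1 ρ hρ _ _ (mv_BM c ρ hv) (mw_BM c ρ hw)).trans ?_
        refine mul_le_mul_of_nonneg_left ?_ hM
        exact mul_le_mul (mv_nv J c ρ hv) (mw_nv K c ρ hw) (Real.sqrt_nonneg _) hn1)
    simpa [Measure.real, rr_pos.le] using this
  rw [hBB]
  calc _ ≤ M * (nv J v * nv K w) + M * (nv J v * nv K w) * rr :=
        (norm_add_le _ _).trans (add_le_add (h0 v w hv hw) hlast)
    _ = _ := by ring

theorem PP_of_SB (J K : Finset (Fin n → ℤ)) {M : ℝ} (hM : 0 ≤ M) (L : List (Fin n ⊕ Fin n)) (hL : L.Nodup)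
    (A : (Fin n → ℤ) → (Fin n → ℤ) → EE n × EE n → ℂ) (hA : ∀ j k, ContDiff ℝ (⊤ : ℕ∞) (A j k))
    (hS : ∀ j k, SB (bdd (Qz n) M) (L.map dirC) (A j k))
    (hdep : ∀ j k z z', (∀ c ∈ L, crd c z = crd c z') → A j k z = A j k z') :
    PP J K A ((1 + rr) ^ L.length * (rr ^ n * M)) := by
  induction L generalizing A with
  | nil =>
    rw [List.length_nil, pow_zero, one_mul]
    refine PP_const J K A (fun j k z z' => hdep j k z z' (by simp)) fun j k => hS j k 0 (fun c => ?_)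
    simp [rr_pos.le]
  | cons c L ih =>
    rw [List.nodup_cons] at hL
    rw [List.length_cons, pow_succ', mul_assoc]
    have hT : ∀ v ∈ L.map dirC, Tc c v = v := by
      intro v hv
      rw [List.mem_map] at hv
      obtain ⟨c', hc', rfl⟩ := hv
      refine Tc_dir ?_
      rintro rfl
      exact hL.1 hc'
    have hfr : ∀ {ρ : ℝ} {z z' : EE n × EE n}, (∀ c' ∈ L, crd c' z = crd c' z') → ∀ c' ∈ c :: L,
        crd c' (Tc c z + ρ • dirC c) = crd c' (Tc c z' + ρ • dirC c) := by
      intro ρ z z' h c' hc'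
      rw [crd_fr, crd_fr]
      split_ifs with he
      · rfl
      · exact h c' ((List.mem_cons.1 hc').resolve_left he)
    have hsm : ∀ {g : EE n × EE n → ℂ} (ρ : ℝ), ContDiff ℝ (⊤ : ℕ∞) g →
        ContDiff ℝ (⊤ : ℕ∞) (fun z => g (Tc c z + ρ • dirC c)) := fun ρ hg =>
      hg.comp ((Tc c).contDiff.add contDiff_const)
    have hr := rr_pos
    refine PP_step J K c A (by positivity) hA ?_ fun ρ hρ => ?_
    · refine ih hL.2 _ (fun j k => hsm 0 (hA j k)) (fun j k => ?_) (fun j k z z' h => hdep j k _ _ (hfr h))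
      exact SB_affine _ (Tc c) _ hT (fun z hz => fr_mem c ⟨le_rfl, hr.le⟩ hz) (hA j k) (hS j k).1
    · refine ih hL.2 _ (fun j k => hsm ρ (dLine_smooth (hA j k))) (fun j k => ?_) (fun j k z z' h => ?_)
      · exact SB_affine _ (Tc c) _ hT (fun z hz => fr_mem c ⟨hρ.1.le, hρ.2⟩ hz) (dLine_smooth (hA j k)) (hS j k).2
      · have key : ∀ p q : EE n × EE n, (∀ c' ∈ c :: L, crd c' p = crd c' q) →
            dLine (dirC c) (A j k) p = dLine (dirC c) (A j k) q := by
          intro p q hpq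
          have e : A j k = fun x => A j k (x + (q - p)) := by
            funext x
            refine hdep j k _ _ fun c' hc' => ?_
            rw [map_add, map_sub, hpq c' hc']; simp
          unfold dLine
          conv_lhs => rw [e, fderiv_comp_add_right]
          congr 3
          abel
        exact key _ _ (hfr h)

end Bilin

section Tile
variable {n : ℕ}

/-- translated cubes -/
def Cub (k : Fin n → ℤ) : Set (EE n) := {x | x - rr • latt k ∈ QQ n}

/-- index of the cube -/
def flo (x : EE n) : Fin n → ℤ := fun i => ⌊x i / rr⌋

theorem Cub_iff (k : Fin n → ℤ) (x : EE n) : x ∈ Cub k ↔ k = flo x := by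
  have hr := rr_pos
  have h1 : ∀ i, (x - rr • latt k) i = x i - rr * k i := fun i => by simp [latt]
  constructor
  · intro h
    funext i
    have := h i
    rw [h1] at this
    symm
    show ⌊x i / rr⌋ = k i
    rw [Int.floor_eq_iff, le_div_iff₀ hr, div_lt_iff₀ hr]
    constructor <;> nlinarith [this.1, this.2]
  · rintro rfl i
    rw [h1]
    have a1 := Int.sub_floor_div_mul_nonneg (x i) hr
    have a2 := Int.sub_floor_div_mul_lt (x i) hr
    constructor
    · show 0 ≤ x i - rr * (⌊x i / rr⌋ : ℤ); linarith
    · show x i - rr * (⌊x i / rr⌋ : ℤ) < rr; linarith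

theorem Cub_meas (k : Fin n → ℤ) : MeasurableSet (Cub k) :=
  (measurable_id.sub_const (rr • latt k)) QQ_meas

theorem Cub_disj : Pairwise (Function.onFun Disjoint (Cub (n := n))) := by
  intro k l hkl
  refine Set.disjoint_left.2 fun x h1 h2 => hkl ?_
  rw [Cub_iff] at h1 h2
  rw [h1, h2]

theorem Cub_cover : (⋃ k, Cub (n := n) k) = Set.univ := by
  refine Set.eq_univ_of_forall fun x => Set.mem_iUnion.2 ⟨flo x, (Cub_iff _ _).2 rfl⟩

theorem Cub_shift (k : Fin n → ℤ) (s : EE n) : s + rr • latt k ∈ Cub k ↔ s ∈ QQ n := by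
  show s + rr • latt k - rr • latt k ∈ QQ n ↔ _
  rw [add_sub_cancel_right]

theorem lint_Cub (k : Fin n → ℤ) (F : EE n → ℝ≥0∞) :
    ∫⁻ x in Cub k, F x = ∫⁻ s, F (s + rr • latt k) ∂(muQ n) := by
  unfold muQ
  rw [← lintegral_indicator (Cub_meas k), ← lintegral_indicator QQ_meas,
    ← lintegral_add_right_eq_self _ (rr • latt k)]
  refine lintegral_congr fun s => ?_
  by_cases h : s ∈ QQ n
  · rw [Set.indicator_of_mem ((Cub_shift k s).2 h), Set.indicator_of_mem h]
  · rw [Set.indicator_of_notMem (fun h' => h ((Cub_shift k s).1 h')), Set.indicator_of_notMem h]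

theorem int_Cub (k : Fin n → ℤ) (F : EE n → ℂ) :
    ∫ x in Cub k, F x = ∫ s, F (s + rr • latt k) ∂(muQ n) := by
  unfold muQ
  rw [← integral_indicator (Cub_meas k), ← integral_indicator QQ_meas,
    ← integral_add_right_eq_self _ (rr • latt k)]
  congr 1
  funext s
  by_cases h : s ∈ QQ n
  · rw [Set.indicator_of_mem ((Cub_shift k s).2 h), Set.indicator_of_mem h]
  · rw [Set.indicator_of_notMem (fun h' => h ((Cub_shift k s).1 h')), Set.indicator_of_notMem h]

theorem tile_lint (F : EE n → ℝ≥0∞) : ∫⁻ x, F x = ∑' j, ∫⁻ s, F (s + rr • latt j) ∂(muQ n) := by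
  rw [← setLIntegral_univ, ← Cub_cover, lintegral_iUnion Cub_meas Cub_disj]
  simp only [lint_Cub]

theorem tile_int (K : Finset (Fin n → ℤ)) {F : EE n → ℂ} (hF : Integrable F volume)
    (h0 : ∀ x, flo x ∉ K → F x = 0) : ∫ x, F x = ∑ k ∈ K, ∫ s, F (s + rr • latt k) ∂(muQ n) := by
  rw [← setIntegral_eq_integral_of_forall_compl_eq_zero (s := ⋃ k ∈ K, Cub k),
    integral_biUnion_finset K (fun k _ => Cub_meas k) (fun k _ l _ h => Cub_disj h) (fun k _ => hF.integrableOn)]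
  · simp only [int_Cub]
  · intro x hx
    refine h0 x fun h => hx ?_
    simp only [Set.mem_iUnion]
    exact ⟨flo x, h, (Cub_iff _ _).2 rfl⟩

theorem exists_box {K : Set (EE n)} (hK : IsCompact K) : ∃ S : Finset (Fin n → ℤ), ∀ x ∈ K, flo x ∈ S := by
  obtain ⟨R, hR⟩ := hK.isBounded.exists_norm_le
  have hr := rr_pos
  refine ⟨Fintype.piFinset fun _ => Finset.Icc ⌊-R / rr⌋ ⌊R / rr⌋, fun x hx => ?_⟩
  rw [Fintype.mem_piFinset]
  intro i
  have h1 := abs_le.1 ((abs_coord_le x i).trans (hR x hx))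
  rw [Finset.mem_Icc]
  constructor
  · exact Int.floor_le_floor (div_le_div_of_nonneg_right h1.1 hr.le)
  · exact Int.floor_le_floor (div_le_div_of_nonneg_right h1.2 hr.le)

/-- transported amplitude -/
def amp (a : EE n × EE n → ℂ) (j k : Fin n → ℤ) (z : EE n × EE n) : ℂ :=
  Complex.exp (Complex.I * ((⟪z.1, z.2⟫ : ℝ) : ℂ)) * a (z + (rr • latt j, rr • latt k))

theorem inner_smooth : ContDiff ℝ (⊤ : ℕ∞) (fun z : EE n × EE n => Complex.exp (Complex.I * ((⟪z.1, z.2⟫ : ℝ) : ℂ))) := by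
  have h1 : ContDiff ℝ (⊤ : ℕ∞) (fun z : EE n × EE n => (⟪z.1, z.2⟫ : ℝ)) := contDiff_fst.inner ℝ contDiff_snd
  have h2 : ContDiff ℝ (⊤ : ℕ∞) (fun z : EE n × EE n => ((⟪z.1, z.2⟫ : ℝ) : ℂ)) := Complex.ofRealCLM.contDiff.comp h1
  exact (contDiff_const.mul h2).cexp

theorem amp_smooth {a : EE n × EE n → ℂ} (ha : ContDiff ℝ (⊤ : ℕ∞) a) (j k : Fin n → ℤ) :
    ContDiff ℝ (⊤ : ℕ∞) (amp a j k) :=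
  inner_smooth.mul (ha.comp (contDiff_id.add contDiff_const))

/-- hypothesis on the amplitude -/
def AmpB (a : EE n × EE n → ℂ) (A : ℝ) : Prop :=
  ∀ α β : Fin n → ℕ, (∀ i, α i ≤ 1) → (∀ i, β i ≤ 1) → ∀ z, ‖mderiv dX α (mderiv dY β a) z‖ ≤ A

theorem amp_PP (n : ℕ) : ∃ C : ℝ, 0 ≤ C ∧ ∀ (a : EE n × EE n → ℂ) (A : ℝ), 0 ≤ A → ContDiff ℝ (⊤ : ℕ∞) a →
    AmpB a A → ∀ J K : Finset (Fin n → ℤ), PP J K (amp a) (C * A) := by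
  set L : List (Fin n ⊕ Fin n) := (List.finRange n).map Sum.inr ++ (List.finRange n).map Sum.inl with hL
  have hLd : L.map dirC = (List.finRange n).map dY ++ (List.finRange n).map dX := by
    rw [hL, List.map_append, List.map_map, List.map_map]; rfl
  have hnd : L.Nodup := by
    rw [hL, List.nodup_append]
    refine ⟨(List.nodup_finRange n).map Sum.inr_injective, (List.nodup_finRange n).map Sum.inl_injective, ?_⟩
    intro x hx y hy
    rw [List.mem_map] at hx hy
    obtain ⟨i, _, rfl⟩ := hx
    obtain ⟨j, _, rfl⟩ := hy
    simp
  have hmem : ∀ c : Fin n ⊕ Fin n, c ∈ L := by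
    intro c
    rw [hL, List.mem_append]
    rcases c with i | i
    · right; simp
    · left; simp
  obtain ⟨N, hN0, hN⟩ := SB_exists (Qz_compact (n := n)) (L.map dirC) inner_smooth
  have hr := rr_pos
  refine ⟨(1 + rr) ^ L.length * (rr ^ n * (2 ^ (L.map dirC).length * N)), by positivity, fun a A hA0 ha hA J K => ?_⟩
  have hS : SB (bdd Set.univ A) (L.map dirC) a := by
    rw [hLd, SB_append]
    refine SB_of_lderiv _ _ _ (List.nodup_finRange n) ha fun β hβ => ?_
    refine SB_of_lderiv _ _ _ (List.nodup_finRange n) (lderiv_smooth _ _ ha _) fun α hα => ?_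
    intro z _
    have := hA α β hα hβ z
    rwa [mderiv_eq_lderiv, mderiv_eq_lderiv] at this
  have := PP_of_SB J K (M := 2 ^ (L.map dirC).length * (N * A)) (by positivity) L hnd (amp a) (amp_smooth ha)
    (fun j k => SB_mul hN0 hA0 _ inner_smooth (ha.comp (contDiff_id.add contDiff_const)) hN
      (SB_affine _ (ContinuousLinearMap.id ℝ _) _ (fun v _ => rfl) (fun _ _ => Set.mem_univ _) ha hS))
    (fun j k z z' h => by rw [ext_crd fun c => h c (hmem c)])
  convert this using 1
  ring

end Tile

section Claim2
variable {n : ℕ}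

theorem phase_split (j k : Fin n → ℤ) (s t : EE n) :
    Complex.exp (Complex.I * ((⟪s + rr • latt j, t + rr • latt k⟫ : ℝ) : ℂ)) =
      ee k s * ee j t * Complex.exp (Complex.I * ((⟪s, t⟫ : ℝ) : ℂ)) := by
  have h1 : (⟪latt j, latt k⟫ : ℝ) = ((∑ i, j i * k i : ℤ) : ℝ) := by
    rw [inner_latt]; push_cast; rfl
  have h2 : (⟪s + rr • latt j, t + rr • latt k⟫ : ℝ) =
      ⟪s, t⟫ + rr * ⟪latt k, s⟫ + rr * ⟪latt j, t⟫ + ((∑ i, j i * k i : ℤ) : ℝ) * (2 * π) := by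
    rw [inner_add_left, inner_add_right, inner_add_right, inner_smul_left, inner_smul_left, inner_smul_right,
      inner_smul_right, h1, ← rr_sq, real_inner_comm (latt k) s]
    simp only [conj_trivial]
    ring
  rw [h2]
  unfold ee
  rw [← Complex.exp_add, ← Complex.exp_add]
  have h3 := Complex.exp_int_mul_two_pi_mul_I (∑ i, j i * k i)
  have h4 : Complex.I * ((⟪s, t⟫ + rr * ⟪latt k, s⟫ + rr * ⟪latt j, t⟫ + ((∑ i, j i * k i : ℤ) : ℝ) * (2 * π) : ℝ) : ℂ) =
      (Complex.I * ((rr * ⟪latt k, s⟫ : ℝ) : ℂ) + Complex.I * ((rr * ⟪latt j, t⟫ : ℝ) : ℂ) + Complex.I * ((⟪s, t⟫ : ℝ) : ℂ)) +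
      ((∑ i, j i * k i : ℤ) : ℂ) * (2 * π * Complex.I) := by
    push_cast; ring
  rw [h4, Complex.exp_add, h3, mul_one]

theorem AmpB.bd {a : EE n × EE n → ℂ} {A : ℝ} (h : AmpB a A) (z : EE n × EE n) : ‖a z‖ ≤ A := by
  have := h 0 0 (fun i => by simp) (fun i => by simp) z
  rwa [mderiv_zero, mderiv_zero] at this

theorem claim2 (n : ℕ) : ∃ C : ℝ, 0 ≤ C ∧ ∀ (a : EE n × EE n → ℂ) (A : ℝ), 0 ≤ A → ContDiff ℝ (⊤ : ℕ∞) a →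
    AmpB a A → ∀ (Kc : Set (EE n)), IsCompact Kc → (∀ x ξ, ξ ∉ Kc → a (x, ξ) = 0) →
    ∀ (w : EE n → ℂ), Measurable w → (∃ B, ∀ ξ, ‖w ξ‖ ≤ B) →
    eLpNorm (fun x => ∫ ξ, Complex.exp (Complex.I * ((⟪x, ξ⟫ : ℝ) : ℂ)) * a (x, ξ) * w ξ) 2 volume ≤
      ENNReal.ofReal (C * A) * eLpNorm w 2 volume := by
  obtain ⟨C, hC0, hC⟩ := amp_PP n
  refine ⟨C, hC0, fun a A hA0 ha hA Kc hKc hsupp w hwm hwb => ?_⟩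
  obtain ⟨B, hB⟩ := hwb
  have hB0 : 0 ≤ B := (norm_nonneg _).trans (hB 0)
  obtain ⟨K, hK⟩ := exists_box hKc
  set Pw : EE n → ℂ := fun x => ∫ ξ, Complex.exp (Complex.I * ((⟪x, ξ⟫ : ℝ) : ℂ)) * a (x, ξ) * w ξ with hPw
  set wk : (Fin n → ℤ) → EE n → ℂ := fun k t => w (t + rr • latt k) with hwk
  have hac := ha.continuous
  have hampc : ∀ j k, Continuous (amp a j k) := fun j k => (amp_smooth ha j k).continuous
  have hwkB : BM wk := ⟨fun k => hwm.comp (measurable_add_const _), B, fun k s => hB _⟩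
  have hampb : ∀ j k z, ‖amp a j k z‖ ≤ A := fun j k z => by
    unfold amp; rw [norm_mul, osc_norm, one_mul]; exact hA.bd _
  -- the pieces
  set G : (Fin n → ℤ) → (Fin n → ℤ) → EE n → ℂ := fun j k s =>
    ∫ t, ee k s * (wk k t * ee j t) * amp a j k (s, t) ∂(muQ n) with hG
  have hPG : ∀ j s, Pw (s + rr • latt j) = ∑ k ∈ K, G j k s := by
    intro j s
    have hInt0 : Integrable (fun ξ => Complex.exp (Complex.I * ((⟪s + rr • latt j, ξ⟫ : ℝ) : ℂ)) *
        a (s + rr • latt j, ξ) * w ξ) volume := by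
      have hm : Measurable (fun ξ => Complex.exp (Complex.I * ((⟪s + rr • latt j, ξ⟫ : ℝ) : ℂ)) *
        a (s + rr • latt j, ξ) * w ξ) := by
        refine Measurable.mul (Continuous.measurable ?_) hwm
        fun_prop
      have hon : IntegrableOn (fun ξ => Complex.exp (Complex.I * ((⟪s + rr • latt j, ξ⟫ : ℝ) : ℂ)) *
          a (s + rr • latt j, ξ) * w ξ) Kc volume := by
        refine Measure.integrableOn_of_bounded (M := A * B) hKc.measure_lt_top.ne hm.aestronglyMeasurable ?_
        refine Filter.Eventually.of_forall fun ξ => ?_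
        rw [norm_mul, norm_mul, osc_norm, one_mul]
        exact mul_le_mul (hA.bd _) (hB _) (norm_nonneg _) hA0
      refine (integrableOn_iff_integrable_of_support_subset ?_).1 hon
      intro ξ hξ
      by_contra h
      exact hξ (by simp [hsupp _ ξ h])
    show ∫ ξ, _ = _
    rw [tile_int K hInt0 (fun ξ hξ => by
      have : ξ ∉ Kc := fun h => hξ (hK ξ h)
      simp [hsupp _ ξ this])]
    refine Finset.sum_congr rfl fun k _ => ?_
    refine integral_congr_ae (Filter.Eventually.of_forall fun t => ?_)
    dsimp only
    rw [phase_split]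
    have : a ((s, t) + (rr • latt j, rr • latt k)) = a (s + rr • latt j, t + rr • latt k) := rfl
    simp only [hwk, amp, this]
    ring
  have hGm : ∀ j k, StronglyMeasurable (G j k) := by
    intro j k
    have hm : Measurable (fun z : EE n × EE n => ee k z.1 * (wk k z.2 * ee j z.2) * amp a j k (z.1, z.2)) := by
      have h1 := (ee_cont k).measurable
      have h2 := (ee_cont j).measurable
      have h3 := hwkB.1 k
      have h4 := (hampc j k).measurable
      fun_prop
    exact hm.stronglyMeasurable.integral_prod_right (ν := muQ n)
  have hGb : ∀ j k s, ‖G j k s‖ ≤ B * A * (muQ n).real Set.univ := by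
    intro j k s
    refine norm_integral_le_of_norm_le_const (Filter.Eventually.of_forall fun t => ?_)
    rw [norm_mul, norm_mul, norm_mul, ee_norm, ee_norm, one_mul, mul_one]
    exact mul_le_mul (hwkB.2.choose_spec k t |>.trans (by
      exact le_rfl) |> fun _ => hB _) (hampb j k _) (norm_nonneg _) hB0
  set v : (Fin n → ℤ) → EE n → ℂ := fun j s => starRingEnd ℂ (∑ k ∈ K, G j k s) with hv
  have hvB : BM v := by
    refine ⟨fun j => ?_, ∑ _k ∈ K, B * A * (muQ n).real Set.univ, fun j s => ?_⟩
    · exact Complex.continuous_conj.measurable.comp (Finset.measurable_fun_sum _ fun k _ => (hGm j k).measurable)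
    · simp only [hv]
      rw [RCLike.norm_conj]
      exact (norm_sum_le _ _).trans (Finset.sum_le_sum fun k _ => hGb j k s)
  have hmain : ∀ J : Finset (Fin n → ℤ), BB J K (amp a) v wk = ((nv J v ^ 2 : ℝ) : ℂ) := by
    intro J
    unfold nv
    rw [Real.sq_sqrt (Finset.sum_nonneg fun j _ => integral_nonneg fun s => by positivity)]
    unfold BB
    push_cast
    refine Finset.sum_congr rfl fun j _ => ?_
    rw [← integral_complex_ofReal]
    have h1 : ∀ k, ∫ z, FF v wk j k z * amp a j k z ∂(muz n) = ∫ s, v j s * G j k s ∂(muQ n) := by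
      intro k
      have hi : Integrable (fun z => FF v wk j k z * amp a j k z) (muz n) := by
        obtain ⟨M1, hM10, hM1⟩ := FF_bdd hvB hwkB
        refine Integrable.of_bound ((FF_meas hvB hwkB j k).mul (hampc j k).measurable).aestronglyMeasurable (M1 * A) ?_
        refine Filter.Eventually.of_forall fun z => ?_
        rw [norm_mul]
        exact mul_le_mul (hM1 _ _ _) (hampb _ _ _) (norm_nonneg _) hM10
      unfold muz at hi ⊢
      rw [integral_prod _ hi]
      congr 1
      funext s
      rw [hG, ← integral_const_mul]
      congr 1
      funext t
      unfold FF
      ring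
    simp only [h1]
    rw [← integral_finsetSum]
    · congr 1
      funext s
      rw [← Finset.mul_sum]
      simp only [hv]
      rw [RCLike.norm_conj, mul_comm, Complex.mul_conj, Complex.normSq_eq_norm_sq]
    · intro k _
      obtain ⟨M1, hM1⟩ := hvB.2
      refine Integrable.of_bound ((hvB.1 j).mul (hGm j k).measurable).aestronglyMeasurable
        (M1 * (B * A * (muQ n).real Set.univ)) ?_
      refine Filter.Eventually.of_forall fun s => ?_
      rw [norm_mul]
      exact mul_le_mul (hM1 _ _) (hGb _ _ _) (norm_nonneg _) ((norm_nonneg _).trans (hM1 j s))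
  have hfin : ∀ J : Finset (Fin n → ℤ), nv J v ^ 2 ≤ (C * A) ^ 2 * nv K wk ^ 2 := by
    intro J
    have h1 := hC a A hA0 ha hA J K v wk hvB hwkB
    rw [hmain J, Complex.norm_real, Real.norm_eq_abs, abs_of_nonneg (sq_nonneg _)] at h1
    have hx : 0 ≤ nv J v := Real.sqrt_nonneg _
    have hy : 0 ≤ nv K wk := Real.sqrt_nonneg _
    have hCA : 0 ≤ C * A := by positivity
    have h2 : nv J v ≤ C * A * nv K wk := by
      rcases hx.eq_or_lt with h | h
      · rw [← h]; positivity
      · refine le_of_mul_le_mul_left ?_ h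
        calc nv J v * nv J v = nv J v ^ 2 := by ring
          _ ≤ _ := h1
          _ = _ := by ring
    calc nv J v ^ 2 ≤ (C * A * nv K wk) ^ 2 := pow_le_pow_left₀ hx h2 2
      _ = _ := by ring
  have hnv : ∀ (J : Finset (Fin n → ℤ)) (f : (Fin n → ℤ) → EE n → ℂ), BM f →
      ENNReal.ofReal (nv J f ^ 2) = ∑ j ∈ J, ∫⁻ s, ‖f j s‖ₑ ^ 2 ∂(muQ n) := by
    intro J f hf
    unfold nv
    rw [Real.sq_sqrt (Finset.sum_nonneg fun j _ => integral_nonneg fun s => by positivity),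
      ENNReal.ofReal_sum_of_nonneg (fun j _ => integral_nonneg fun s => by positivity)]
    refine Finset.sum_congr rfl fun j _ => ?_
    rw [ofReal_integral_eq_lintegral_ofReal (hf.sq_int j) (Filter.Eventually.of_forall fun s => by positivity)]
    refine lintegral_congr fun s => ?_
    rw [ENNReal.ofReal_pow (norm_nonneg _), ofReal_norm]
  have hsq : eLpNorm Pw 2 volume ^ 2 ≤ (ENNReal.ofReal (C * A) * eLpNorm w 2 volume) ^ 2 := by
    rw [mul_pow, eLpNorm_sq, eLpNorm_sq, tile_lint (fun x => ‖Pw x‖ₑ ^ 2), tile_lint (fun x => ‖w x‖ₑ ^ 2),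
      ENNReal.tsum_eq_iSup_sum]
    refine iSup_le fun J => ?_
    have e1 : ∑ j ∈ J, ∫⁻ s, ‖Pw (s + rr • latt j)‖ₑ ^ 2 ∂(muQ n) = ENNReal.ofReal (nv J v ^ 2) := by
      rw [hnv J v hvB]
      refine Finset.sum_congr rfl fun j _ => lintegral_congr fun s => ?_
      rw [hPG, ← ofReal_norm, ← ofReal_norm]
      simp only [hv]
      rw [RCLike.norm_conj]
    rw [e1]
    refine (ENNReal.ofReal_le_ofReal (hfin J)).trans ?_
    rw [ENNReal.ofReal_mul (by positivity), ENNReal.ofReal_pow (by positivity), hnv K wk hwkB]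
    gcongr
    exact ENNReal.sum_le_tsum _
  exact (ENNReal.pow_le_pow_left_iff (by norm_num)).1 hsq

end Claim2

/-- `L²`-boundedness of `Tu(x) = ∫∫ e^{i(x·ξ+φ(y,ξ))} a(x,ξ) u(y) dy dξ` when `∂_x^α ∂_ξ^β a ∈ L^∞` for all multi-indices `α, β ∈ {0,1}ⁿ`, with constant depending only on `n`, `C₀`, the phase constants and the bound `A`, independent of the compact set `K`. -/
theorem statement4 (n : ℕ) (C₀ : ℝ) (hC₀ : 0 < C₀) (Cph : (Fin n → ℕ) → ℝ) (A : ℝ) :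
    ∃ C : ℝ, 0 < C ∧
      ∀ (φ : EuclideanSpace ℝ (Fin n) × EuclideanSpace ℝ (Fin n) → ℝ)
        (a : EuclideanSpace ℝ (Fin n) × EuclideanSpace ℝ (Fin n) → ℂ)
        (K : Set (EuclideanSpace ℝ (Fin n))), IsCompact K →
        ContDiff ℝ (⊤ : ℕ∞) φ →
        -- nondegeneracy of the mixed Hessian `∂_y∂_ξ φ`:
        (∀ z, C₀ ≤ |Matrix.det (Matrix.of fun i j => mixedHessXY φ i j z)|) →
        -- bounded derivatives of the entries of `∂_y∂_ξ φ`: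
        (∀ i j : Fin n, ∀ α : Fin n → ℕ, mdeg α ≤ 2 * n + 1 →
          (∀ z, |mderiv dX α (mixedHessXY φ i j) z| ≤ Cph α) ∧
          (∀ z, |mderiv dY α (mixedHessXY φ i j) z| ≤ Cph α)) →
        -- `a` vanishes for `ξ` outside the compact set `K`:
        (∀ x ξ, ξ ∉ K → a (x, ξ) = 0) →
        ContDiff ℝ (⊤ : ℕ∞) a →
        -- derivatives of the amplitude with multi-indices in `{0,1}ⁿ` are bounded by `A`:
        (∀ α β : Fin n → ℕ, (∀ i, α i ≤ 1) → (∀ i, β i ≤ 1) →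
          ∀ z, ‖mderiv dX α (mderiv dY β a) z‖ ≤ A) →
        ∀ u : 𝓢(EuclideanSpace ℝ (Fin n), ℂ),
          eLpNorm (fun x => ∫ ξ, ∫ y,
              Complex.exp (Complex.I * ((⟪x, ξ⟫ + φ (y, ξ) : ℝ) : ℂ)) * a (x, ξ) * u y)
              2 volume
            ≤ ENNReal.ofReal C * eLpNorm (⇑u) 2 volume := by
  obtain ⟨M, hM0, hM⟩ := claim1 n C₀ hC₀ Cph
  obtain ⟨C, hC0, hC⟩ := claim2 n
  refine ⟨C * |A| * M + 1, by positivity, ?_⟩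
  intro φ a K hK hφ hdet hbd hsupp ha hA u
  have hA0 : 0 ≤ A := (norm_nonneg _).trans
    (hA (fun _ => 0) (fun _ => 0) (fun _ => by simp) (fun _ => by simp) 0)
  have hui : Integrable (⇑u) volume := u.integrable
  have hum : MemLp (⇑u) 2 volume := u.memLp 2
  let w : EuclideanSpace ℝ (Fin n) → ℂ :=
    fun ξ => ∫ y, Complex.exp (Complex.I * ((φ (y, ξ) : ℝ) : ℂ)) * u y
  have hφc := hφ.continuous
  have huc := u.continuous
  have hwm : Measurable w := by
    have hc : Continuous (fun p : EuclideanSpace ℝ (Fin n) × EuclideanSpace ℝ (Fin n) =>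
        Complex.exp (Complex.I * ((φ (p.2, p.1) : ℝ) : ℂ)) * u p.2) := by fun_prop
    exact (hc.stronglyMeasurable.integral_prod_right (ν := volume)).measurable
  have hwb : ∀ ξ, ‖w ξ‖ ≤ ∫ y, ‖u y‖ := by
    intro ξ
    refine (norm_integral_le_integral_norm _).trans (le_of_eq ?_)
    refine integral_congr_ae (Filter.Eventually.of_forall fun y => ?_)
    simp only [norm_mul, osc_norm, one_mul]
  have h1 := hM ⟨φ, ⟨hφ, hdet, hbd⟩⟩ (⇑u) hum hui
  have h2 := hC a A hA0 ha hA K hK hsupp w hwm ⟨_, hwb⟩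
  have he : (fun x => ∫ ξ, ∫ y,
      Complex.exp (Complex.I * ((⟪x, ξ⟫ + φ (y, ξ) : ℝ) : ℂ)) * a (x, ξ) * u y) =
      fun x => ∫ ξ, Complex.exp (Complex.I * ((⟪x, ξ⟫ : ℝ) : ℂ)) * a (x, ξ) * w ξ := by
    funext x
    congr 1
    funext ξ
    rw [← integral_const_mul]
    congr 1
    funext y
    rw [Complex.ofReal_add, mul_add, Complex.exp_add]
    ring
  rw [he]
  calc _ ≤ ENNReal.ofReal (C * A) * eLpNorm w 2 volume := h2
    _ ≤ ENNReal.ofReal (C * A) * (ENNReal.ofReal M * eLpNorm (⇑u) 2 volume) := by gcongr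
    _ = ENNReal.ofReal (C * A * M) * eLpNorm (⇑u) 2 volume := by
      rw [← mul_assoc, ← ENNReal.ofReal_mul (by positivity)]
    _ ≤ _ := by
      gcongr
      rw [abs_of_nonneg hA0]
      linarith
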